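/- Let M be a compact orientable even-dimensional Riemannian manifold and let T be a torus acting on M by isometries with nonempty fixed point set. Then the Euler characteristic of M equals the sum of the Euler characteristics of the connected components of the fixed point set Fix(M; T). -/

import Mathlib

open scoped Manifold

noncomputable section

/-- The singular chain complex of a topological space with rational coefficients,
obtained from the singular simplicial set via the free module functor and the
alternating face map complex. -/
def singularChainComplex (X : Type) [TopologicalSpace X] :
    ChainComplex (ModuleCat ℚ) ℕ :=
  (AlgebraicTopology.alternatingFaceMapComplex (ModuleCat ℚ)).obj
    (((CategoryTheory.SimplicialObject.whiskering _ _).obj (ModuleCat.free ℚ)).obj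
      (TopCat.toSSet.obj (TopCat.of X)))

/-- The `i`-th Betti number of a topological space: the rank of its `i`-th singular
homology with rational coefficients. -/
def betti (X : Type) [TopologicalSpace X] (i : ℕ) : ℕ :=
  Module.finrank ℚ ((singularChainComplex X).homology i)

/-- The Euler characteristic of a topological space: the alternating sum of its
Betti numbers. -/
def eulerChar (X : Type) [TopologicalSpace X] : ℤ :=
  ∑ᶠ i : ℕ, (-1 : ℤ) ^ i * betti X i

/-- A Riemannian metric on a smooth `n`-manifold `M`, bundled together with its
sectional curvature function and its geodesic distance function.  (Riemannian
geometry is not yet developed in Mathlib, so the sectional curvature is part of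
the data; the distance is tied to the metric tensor by `dist_eq`.) -/
structure RiemannianMetric (n : ℕ) (M : Type) [TopologicalSpace M]
    [ChartedSpace (EuclideanSpace ℝ (Fin n)) M] [IsManifold (𝓡 n) (⊤ : ℕ∞) M] where
  /-- the metric tensor: an inner product on each tangent space -/
  inner : ∀ x : M, TangentSpace (𝓡 n) x → TangentSpace (𝓡 n) x → ℝ
  symm : ∀ x u v, inner x u v = inner x v u
  add_left : ∀ x u v w, inner x (u + v) w = inner x u w + inner x v w
  smul_left : ∀ (x : M) (c : ℝ) (u v), inner x (c • u) v = c * inner x u v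
  posdef : ∀ x v, v ≠ 0 → 0 < inner x v v
  /-- the sectional curvature of the 2-plane spanned by two tangent vectors (its
  value is irrelevant when the two vectors are linearly dependent) -/
  sec : ∀ x : M, TangentSpace (𝓡 n) x → TangentSpace (𝓡 n) x → ℝ
  /-- the Riemannian (geodesic) distance -/
  dist : M → M → ℝ
  /-- the distance is the infimum of lengths of smooth curves joining two points -/
  dist_eq : ∀ x y : M, dist x y = sInf {L : ℝ | ∃ γ : ℝ → M,
    ContMDiff 𝓘(ℝ, ℝ) (𝓡 n) (⊤ : ℕ∞) γ ∧ γ 0 = x ∧ γ 1 = y ∧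
    L = ∫ t in (0:ℝ)..1, Real.sqrt (inner (γ t)
      (mfderiv 𝓘(ℝ, ℝ) (𝓡 n) γ t (show TangentSpace 𝓘(ℝ, ℝ) t from (1:ℝ)))
      (mfderiv 𝓘(ℝ, ℝ) (𝓡 n) γ t (show TangentSpace 𝓘(ℝ, ℝ) t from (1:ℝ))))}

/-- A self-map of `M` is a Riemannian isometry for `g` if it is a smooth bijection
whose differential preserves the metric tensor. -/
def IsRiemannianIsometry {n : ℕ} {M : Type} [TopologicalSpace M]
    [ChartedSpace (EuclideanSpace ℝ (Fin n)) M] [IsManifold (𝓡 n) (⊤ : ℕ∞) M]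
    (g : RiemannianMetric n M) (f : M → M) : Prop :=
  Function.Bijective f ∧ ContMDiff (𝓡 n) (𝓡 n) (⊤ : ℕ∞) f ∧
    ∀ (x : M) (u v : TangentSpace (𝓡 n) x),
      g.inner (f x) (mfderiv (𝓡 n) (𝓡 n) f x u) (mfderiv (𝓡 n) (𝓡 n) f x v) = g.inner x u v

/-- `M` has positive sectional curvature. -/
def PosSecCurv {n : ℕ} {M : Type} [TopologicalSpace M]
    [ChartedSpace (EuclideanSpace ℝ (Fin n)) M] [IsManifold (𝓡 n) (⊤ : ℕ∞) M]
    (g : RiemannianMetric n M) : Prop :=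
  ∀ (x : M) (u v : TangentSpace (𝓡 n) x), LinearIndependent ℝ ![u, v] → 0 < g.sec x u v

/-- `M` has nonnegative sectional curvature. -/
def NonnegSecCurv {n : ℕ} {M : Type} [TopologicalSpace M]
    [ChartedSpace (EuclideanSpace ℝ (Fin n)) M] [IsManifold (𝓡 n) (⊤ : ℕ∞) M]
    (g : RiemannianMetric n M) : Prop :=
  ∀ (x : M) (u v : TangentSpace (𝓡 n) x), LinearIndependent ℝ ![u, v] → 0 ≤ g.sec x u v

/-- An oriented (smooth) atlas on `M`: a family of charts from the maximal smooth atlas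
covering `M` all of whose transition maps have positive Jacobian determinant. -/
def OrientedAtlas (n : ℕ) (M : Type) [TopologicalSpace M]
    [ChartedSpace (EuclideanSpace ℝ (Fin n)) M] [IsManifold (𝓡 n) (⊤ : ℕ∞) M]
    (A : Set (OpenPartialHomeomorph M (EuclideanSpace ℝ (Fin n)))) : Prop :=
  A ⊆ (contDiffGroupoid (⊤ : ℕ∞) (𝓡 n)).maximalAtlas M ∧
  (⋃ e ∈ A, e.source) = Set.univ ∧
  ∀ e ∈ A, ∀ e' ∈ A, ∀ x ∈ (e.symm.trans e').source,
    0 < (fderiv ℝ (e.symm.trans e') x).det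

/-- A smooth manifold is orientable if it admits an oriented atlas. -/
def IsOrientable (n : ℕ) (M : Type) [TopologicalSpace M]
    [ChartedSpace (EuclideanSpace ℝ (Fin n)) M] [IsManifold (𝓡 n) (⊤ : ℕ∞) M] : Prop :=
  ∃ A, OrientedAtlas n M A

/-- A self-map of `M` preserves the orientation given by an oriented atlas `A` if its
coordinate representations have positive Jacobian determinant. -/
def PreservesOrientationOn (n : ℕ) (M : Type) [TopologicalSpace M]
    [ChartedSpace (EuclideanSpace ℝ (Fin n)) M] [IsManifold (𝓡 n) (⊤ : ℕ∞) M]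
    (A : Set (OpenPartialHomeomorph M (EuclideanSpace ℝ (Fin n)))) (f : M → M) : Prop :=
  ∀ e ∈ A, ∀ e' ∈ A, ∀ y ∈ e.target ∩ e.symm ⁻¹' (f ⁻¹' e'.source),
    0 < (fderiv ℝ (⇑e' ∘ f ∘ ⇑e.symm) y).det

section HopfTrace

open Module LinearMap

theorem trace_eq_add_of_exact {A B C : Type*} [AddCommGroup A] [AddCommGroup B] [AddCommGroup C]
    [Module ℚ A] [Module ℚ B] [Module ℚ C] [FiniteDimensional ℚ B]
    (i : A →ₗ[ℚ] B) (p : B →ₗ[ℚ] C) (hi : Function.Injective i) (hp : Function.Surjective p)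
    (hex : Function.Exact i p) (a : A →ₗ[ℚ] A) (b : B →ₗ[ℚ] B) (c : C →ₗ[ℚ] C)
    (hab : ∀ x, b (i x) = i (a x)) (hbc : ∀ x, p (b x) = c (p x)) :
    trace ℚ B b = trace ℚ A a + trace ℚ C c := by
  have : FiniteDimensional ℚ A := FiniteDimensional.of_injective i hi
  have : FiniteDimensional ℚ C := FiniteDimensional.of_surjective p hp
  obtain ⟨ρ, hρ⟩ := i.exists_leftInverse_of_injective (ker_eq_bot.2 hi)
  obtain ⟨s₀, hs₀⟩ := p.exists_rightInverse_of_surjective (range_eq_top.2 hp)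
  have hρ' : ∀ x, ρ (i x) = x := fun x => LinearMap.congr_fun hρ x
  have hs₀' : ∀ x, p (s₀ x) = x := fun x => LinearMap.congr_fun hs₀ x
  have hpi : ∀ x, p (i x) = 0 := fun x => (hex (i x)).2 ⟨x, rfl⟩
  set s : C →ₗ[ℚ] B := s₀ - i ∘ₗ ρ ∘ₗ s₀ with hs
  have hps : ∀ x, p (s x) = x := fun x => by simp [hs, hs₀', hpi]
  have hρs : ∀ x, ρ (s x) = 0 := fun x => by simp [hs, hρ']
  have hdec : ∀ x, x = i (ρ x) + s (p x) := by
    intro x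
    obtain ⟨y, hy⟩ := (hex (x - s (p x))).1 (by simp [hps])
    have : ρ x = y := by
      have := congrArg ρ hy
      simpa [hρ', hρs] using this.symm
    rw [this, hy]; abel
  have hb : b = (b ∘ₗ i) ∘ₗ ρ + (b ∘ₗ s) ∘ₗ p := by
    ext x; conv_lhs => rw [hdec x]
    simp
  have h1 : ρ ∘ₗ (b ∘ₗ i) = a := by ext x; simp [hab, hρ']
  have h2 : p ∘ₗ (b ∘ₗ s) = c := by ext x; simp [hbc, hps]
  rw [hb, map_add, trace_comp_comm', trace_comp_comm' p, h1, h2]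

variable {E E' E'' : ℕ → Type} [∀ n, AddCommGroup (E n)] [∀ n, Module ℚ (E n)]
  [∀ n, AddCommGroup (E' n)] [∀ n, Module ℚ (E' n)]
  [∀ n, AddCommGroup (E'' n)] [∀ n, Module ℚ (E'' n)]

/-- Cycles of the subcomplex `S` of the complex `(E, d)`. -/
def cyclesOf (d : ∀ n, E (n + 1) →ₗ[ℚ] E n) (S : ∀ n, Submodule ℚ (E n)) :
    ∀ n, Submodule ℚ (E n)
  | 0 => S 0
  | n + 1 => S (n + 1) ⊓ ker (d n)

/-- Boundaries of the subcomplex `S` of the complex `(E, d)`. -/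
def boundariesOf (d : ∀ n, E (n + 1) →ₗ[ℚ] E n) (S : ∀ n, Submodule ℚ (E n)) (n : ℕ) :
    Submodule ℚ (E n) :=
  (S (n + 1)).map (d n)

/-- Homology of the subcomplex `S` of the complex `(E, d)`. -/
abbrev homologyOf (d : ∀ n, E (n + 1) →ₗ[ℚ] E n) (S : ∀ n, Submodule ℚ (E n)) (n : ℕ) : Type :=
  ↥(cyclesOf d S n) ⧸ (boundariesOf d S n).submoduleOf (cyclesOf d S n)

/-- `S` is a subcomplex of the complex `(E, d)`. -/
structure IsSubcomplex (d : ∀ n, E (n + 1) →ₗ[ℚ] E n) (S : ∀ n, Submodule ℚ (E n)) : Prop where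
  d_d : ∀ n x, d n (d (n + 1) x) = 0
  d_mem : ∀ n, ∀ x ∈ S (n + 1), d n x ∈ S n

variable {d : ∀ n, E (n + 1) →ₗ[ℚ] E n} {S : ∀ n, Submodule ℚ (E n)}
  {d' : ∀ n, E' (n + 1) →ₗ[ℚ] E' n} {S' : ∀ n, Submodule ℚ (E' n)}
  {d'' : ∀ n, E'' (n + 1) →ₗ[ℚ] E'' n} {S'' : ∀ n, Submodule ℚ (E'' n)}

theorem cyclesOf_le (n : ℕ) : cyclesOf d S n ≤ S n := by
  cases n with
  | zero => exact le_rfl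
  | succ n => exact inf_le_left

theorem IsSubcomplex.boundariesOf_le (h : IsSubcomplex d S) (n : ℕ) :
    boundariesOf d S n ≤ cyclesOf d S n := by
  rintro _ ⟨x, hx, rfl⟩
  cases n with
  | zero => exact h.d_mem 0 x hx
  | succ n => exact ⟨h.d_mem _ x hx, h.d_d n x⟩

/-- A chain map taking the subcomplex `S` to the subcomplex `S'`. -/
structure IsSubcomplexMap (d : ∀ n, E (n + 1) →ₗ[ℚ] E n) (S : ∀ n, Submodule ℚ (E n))
    (d' : ∀ n, E' (n + 1) →ₗ[ℚ] E' n) (S' : ∀ n, Submodule ℚ (E' n))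
    (f : ∀ n, E n →ₗ[ℚ] E' n) : Prop where
  comm : ∀ n x, f n (d n x) = d' n (f (n + 1) x)
  map_mem : ∀ n, ∀ x ∈ S n, f n x ∈ S' n

variable {f g : ∀ n, E n →ₗ[ℚ] E' n} {k : ∀ n, E' n →ₗ[ℚ] E'' n}

theorem IsSubcomplexMap.map_cycles (hf : IsSubcomplexMap d S d' S' f) (n : ℕ) :
    ∀ x ∈ cyclesOf d S n, f n x ∈ cyclesOf d' S' n := by
  intro x hx
  cases n with
  | zero => exact hf.map_mem 0 x hx
  | succ n =>
    refine ⟨hf.map_mem _ x hx.1, ?_⟩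
    change d' n (f (n + 1) x) = 0
    rw [← hf.comm, show d n x = 0 from hx.2, map_zero]

theorem IsSubcomplexMap.map_boundaries (hf : IsSubcomplexMap d S d' S' f) (n : ℕ) :
    ∀ x ∈ boundariesOf d S n, f n x ∈ boundariesOf d' S' n := by
  rintro _ ⟨x, hx, rfl⟩
  exact ⟨f (n + 1) x, hf.map_mem _ x hx, (hf.comm n x).symm⟩

theorem IsSubcomplexMap.comp (hk : IsSubcomplexMap d' S' d'' S'' k)
    (hf : IsSubcomplexMap d S d' S' f) :
    IsSubcomplexMap d S d'' S'' (fun n => k n ∘ₗ f n) where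
  comm n x := by simp [hf.comm, hk.comm]
  map_mem n x hx := hk.map_mem n _ (hf.map_mem n x hx)

theorem isSubcomplexMap_id {T : ∀ n, Submodule ℚ (E n)} (h : ∀ n, S n ≤ T n) :
    IsSubcomplexMap d S d T (fun _ => LinearMap.id) where
  comm _ _ := rfl
  map_mem n _ hx := h n hx

/-- The map induced on homology by a chain map of subcomplexes. -/
def homologyOfMap (hf : IsSubcomplexMap d S d' S' f) (n : ℕ) :
    homologyOf d S n →ₗ[ℚ] homologyOf d' S' n :=
  Submodule.mapQ _ _ ((f n).restrict (hf.map_cycles n)) (fun _ hx => hf.map_boundaries n _ hx)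

theorem homologyOfMap_mk (hf : IsSubcomplexMap d S d' S' f) (n : ℕ) (x : cyclesOf d S n) :
    homologyOfMap hf n (Submodule.Quotient.mk x) =
      Submodule.Quotient.mk ⟨f n x, hf.map_cycles n x x.2⟩ := rfl

theorem homologyOfMap_comp (hk : IsSubcomplexMap d' S' d'' S'' k)
    (hf : IsSubcomplexMap d S d' S' f) (n : ℕ) :
    homologyOfMap (hk.comp hf) n = homologyOfMap hk n ∘ₗ homologyOfMap hf n := by
  refine LinearMap.ext fun x => ?_
  induction x using Submodule.Quotient.induction_on
  rfl

theorem homologyOfMap_id (h : IsSubcomplexMap d S d S (fun _ => LinearMap.id)) (n : ℕ) :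
    homologyOfMap h n = LinearMap.id := by
  refine LinearMap.ext fun x => ?_
  induction x using Submodule.Quotient.induction_on
  rfl

theorem homologyOf_mk_eq {n : ℕ} {x y : cyclesOf d S n} :
    (Submodule.Quotient.mk x : homologyOf d S n) = Submodule.Quotient.mk y ↔
      (x : E n) - y ∈ boundariesOf d S n :=
  Submodule.Quotient.eq _

theorem homologyOfMap_eq_of_homotopy (hf : IsSubcomplexMap d S d' S' f)
    (hg : IsSubcomplexMap d S d' S' g) (D : ∀ n, E n →ₗ[ℚ] E' (n + 1))
    (hD : ∀ n, ∀ x ∈ S n, D n x ∈ S' (n + 1))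
    (h0 : ∀ x ∈ S 0, d' 0 (D 0 x) = g 0 x - f 0 x)
    (hsucc : ∀ n, ∀ x ∈ S (n + 1),
      d' (n + 1) (D (n + 1) x) + D n (d n x) = g (n + 1) x - f (n + 1) x) (n : ℕ) :
    homologyOfMap hf n = homologyOfMap hg n := by
  refine LinearMap.ext fun x => ?_
  induction x using Submodule.Quotient.induction_on with
  | _ x =>
  symm
  rw [homologyOfMap_mk, homologyOfMap_mk, homologyOf_mk_eq]
  refine ⟨D n x, hD n x (cyclesOf_le n x.2), ?_⟩
  cases n with
  | zero => exact h0 _ x.2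
  | succ n =>
    have := hsucc n x x.2.1
    rwa [mem_ker.1 x.2.2, map_zero, add_zero] at this

theorem homologyOfMap_eq_of_eqOn (hf : IsSubcomplexMap d S d' S' f)
    (hg : IsSubcomplexMap d S d' S' g) (h : ∀ n, ∀ x ∈ S n, f n x = g n x) (n : ℕ) :
    homologyOfMap hf n = homologyOfMap hg n := by
  refine homologyOfMap_eq_of_homotopy hf hg (fun _ => 0) (fun _ _ _ => by simp) ?_ ?_ n
  · intro x hx; simp [h 0 x hx]
  · intro n x hx; simp [h _ x hx]

theorem hopf_trace_partial (h : IsSubcomplex d S) {f : ∀ n, E n →ₗ[ℚ] E n}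
    (hf : IsSubcomplexMap d S d S f) [∀ n, FiniteDimensional ℚ (S n)] (N : ℕ) :
    ∑ n ∈ Finset.range (N + 1), (-1 : ℚ) ^ n * trace ℚ (S n) ((f n).restrict (hf.map_mem n)) =
      ∑ n ∈ Finset.range (N + 1), (-1 : ℚ) ^ n * trace ℚ _ (homologyOfMap hf n) +
        (-1) ^ N * trace ℚ (boundariesOf d S N) ((f N).restrict (hf.map_boundaries N)) := by
  have fZ : ∀ n, FiniteDimensional ℚ (cyclesOf d S n) := fun n =>
    Submodule.finiteDimensional_of_le (cyclesOf_le n)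
  have hZ : ∀ n, trace ℚ (cyclesOf d S n) ((f n).restrict (hf.map_cycles n)) =
      trace ℚ (boundariesOf d S n) ((f n).restrict (hf.map_boundaries n)) +
        trace ℚ _ (homologyOfMap hf n) := by
    intro n
    refine trace_eq_add_of_exact (Submodule.inclusion (h.boundariesOf_le n)) (Submodule.mkQ _)
      (Submodule.inclusion_injective _) (Submodule.mkQ_surjective _) ?_ _ _ _
      (fun x => rfl) (fun x => rfl)
    intro x
    rw [Submodule.mkQ_apply, Submodule.Quotient.mk_eq_zero]
    exact ⟨fun hx => ⟨⟨x, hx⟩, rfl⟩, by rintro ⟨y, rfl⟩; exact y.2⟩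
  have hS : ∀ n, trace ℚ (S (n + 1)) ((f (n + 1)).restrict (hf.map_mem (n + 1))) =
      trace ℚ (cyclesOf d S (n + 1)) ((f (n + 1)).restrict (hf.map_cycles (n + 1))) +
        trace ℚ (boundariesOf d S n) ((f n).restrict (hf.map_boundaries n)) := by
    intro n
    refine trace_eq_add_of_exact (Submodule.inclusion (cyclesOf_le (n + 1)))
      ((d n).restrict (p := S (n + 1)) (q := boundariesOf d S n)
        (fun x hx => Submodule.mem_map_of_mem hx))
      (Submodule.inclusion_injective _) ?_ ?_ _ _ _
      (fun x => rfl) (fun x => ?_)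
    · rintro ⟨_, x, hx, rfl⟩
      exact ⟨⟨x, hx⟩, rfl⟩
    · intro x
      constructor
      · intro hx
        exact ⟨⟨x, x.2, congrArg Subtype.val hx⟩, rfl⟩
      · rintro ⟨y, rfl⟩
        exact Subtype.ext y.2.2
    · exact Subtype.ext (hf.comm n x).symm
  induction N with
  | zero => simp [add_comm, ← hZ 0]; rfl
  | succ N ih =>
    rw [Finset.sum_range_succ, ih, Finset.sum_range_succ _ (N + 1), hS, hZ]
    ring

/-- A trace formula for a complex whose homology is a retract of that of a degreewise
finite-dimensional complex. -/
theorem domination_trace (hO : IsSubcomplex d S) [∀ n, FiniteDimensional ℚ (S n)]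
    {T U : ∀ n, Submodule ℚ (E' n)}
    {P : ∀ n, E' n →ₗ[ℚ] E n} {s : ∀ n, E n →ₗ[ℚ] E' n}
    (hP : IsSubcomplexMap d' T d S P) (hs : IsSubcomplexMap d S d' T s)
    (hTU : IsSubcomplexMap d' T d' U (fun _ => LinearMap.id))
    (hbij : ∀ n, Function.Bijective (homologyOfMap hTU n))
    (hsP : ∀ n, homologyOfMap (hTU.comp (hs.comp hP)) n = homologyOfMap hTU n)
    (N : ℕ) (hN : ∀ n, N ≤ n → ∀ x ∈ S n, s n x = 0) :
    (∀ n, N ≤ n → finrank ℚ (homologyOf d' U n) = 0) ∧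
    ∑ n ∈ Finset.range N, (-1 : ℚ) ^ n * finrank ℚ (homologyOf d' U n) =
      ∑ n ∈ Finset.range N, (-1 : ℚ) ^ n *
        trace ℚ (S n) ((P n ∘ₗ s n).restrict ((hP.comp hs).map_mem n)) := by
  have hid : ∀ n, homologyOfMap hs n ∘ₗ homologyOfMap hP n = LinearMap.id := by
    intro n
    refine LinearMap.ext fun x => (hbij n).1 ?_
    have := LinearMap.congr_fun (hsP n) x
    rwa [homologyOfMap_comp hTU (hs.comp hP), homologyOfMap_comp hs hP] at this
  have fZ : ∀ n, FiniteDimensional ℚ (cyclesOf d S n) := fun n =>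
    Submodule.finiteDimensional_of_le (cyclesOf_le n)
  have fT : ∀ n, FiniteDimensional ℚ (homologyOf d' T n) := fun n =>
    FiniteDimensional.of_injective (homologyOfMap hP n)
      (Function.LeftInverse.injective (g := homologyOfMap hs n)
        (fun x => LinearMap.congr_fun (hid n) x))
  have hfr : ∀ n, finrank ℚ (homologyOf d' U n) = finrank ℚ (homologyOf d' T n) := fun n =>
    (LinearEquiv.finrank_eq (LinearEquiv.ofBijective _ (hbij n))).symm
  have htr : ∀ n, trace ℚ _ (homologyOfMap (hP.comp hs) n) = finrank ℚ (homologyOf d' U n) := by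
    intro n
    have := fT n
    rw [homologyOfMap_comp hP hs, trace_comp_comm', hid, trace_id, hfr]
  have hzero : ∀ n, N ≤ n → homologyOfMap hs n = 0 := by
    intro n hn
    refine LinearMap.ext fun x => ?_
    induction x using Submodule.Quotient.induction_on with
    | _ x =>
    rw [homologyOfMap_mk]
    simp only [hN n hn x (cyclesOf_le n x.2), LinearMap.zero_apply]
    rfl
  refine ⟨fun n hn => ?_, ?_⟩
  · have h := htr n
    rw [homologyOfMap_comp hP hs, hzero n hn, LinearMap.comp_zero, map_zero] at h
    exact_mod_cast h.symm
  · cases N with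
    | zero => simp
    | succ N =>
      have hb : (P N ∘ₗ s N).restrict ((hP.comp hs).map_boundaries N) = 0 := by
        refine LinearMap.ext ?_
        rintro ⟨_, x, hx, rfl⟩
        refine Subtype.ext ?_
        simp [hs.comm, hN (N + 1) le_rfl x hx]
      have := hopf_trace_partial hO (hP.comp hs) N
      rw [hb, map_zero, mul_zero, add_zero] at this
      rw [this]
      simp only [htr]

theorem trace_restrict_supported {ι : Type*} (R : Set ι) [Finite R] (f : (ι →₀ ℚ) →ₗ[ℚ] (ι →₀ ℚ))
    (hf : ∀ x ∈ Finsupp.supported ℚ ℚ R, f x ∈ Finsupp.supported ℚ ℚ R) :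
    trace ℚ (Finsupp.supported ℚ ℚ R) (f.restrict hf) =
      ∑ᶠ v ∈ R, f (Finsupp.single v 1) v := by
  classical
  have := Fintype.ofFinite R
  rw [trace_eq_matrix_trace ℚ (Basis.ofRepr (Finsupp.supportedEquivFinsupp R)), Matrix.trace,
    ← finsum_set_coe_eq_finsum_mem R, finsum_eq_sum_of_fintype]
  refine Finset.sum_congr rfl fun v _ => ?_
  rw [Matrix.diag_apply, LinearMap.toMatrix_apply]
  have : ((Basis.ofRepr (Finsupp.supportedEquivFinsupp (M := ℚ) (R := ℚ) R)) v :
      Finsupp.supported ℚ ℚ R) = ⟨Finsupp.single v 1, Finsupp.single_mem_supported ℚ 1 v.2⟩ := by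
    refine Subtype.ext ?_
    simp [Basis.coe_ofRepr]
  rw [this]
  rfl

end HopfTrace

section FaceComplex

/-- The boundary operator on the free modules on a graded set with face maps. -/
def bd {K : ℕ → Type} (φ : ∀ n, Fin (n + 1) → K (n + 1) → K n) (n : ℕ) :
    (K (n + 1) →₀ ℚ) →ₗ[ℚ] (K n →₀ ℚ) :=
  ∑ i : Fin (n + 1), (-1 : ℚ) ^ (i : ℕ) • Finsupp.lmapDomain ℚ ℚ (φ n i)

theorem bd_single {K : ℕ → Type} (φ : ∀ n, Fin (n + 1) → K (n + 1) → K n) (n : ℕ) (x : K (n + 1)) :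
    bd φ n (Finsupp.single x 1) =
      ∑ i : Fin (n + 1), (-1 : ℚ) ^ (i : ℕ) • Finsupp.single (φ n i x) 1 := by
  simp [bd, Finsupp.mapDomain_single]

theorem bd_map {K L : ℕ → Type} {φ : ∀ n, Fin (n + 1) → K (n + 1) → K n}
    {ψ : ∀ n, Fin (n + 1) → L (n + 1) → L n} (θ : ∀ n, K n → L n)
    (hθ : ∀ n i x, θ n (φ n i x) = ψ n i (θ (n + 1) x)) (n : ℕ) (x : K (n + 1) →₀ ℚ) :
    Finsupp.lmapDomain ℚ ℚ (θ n) (bd φ n x) = bd ψ n (Finsupp.lmapDomain ℚ ℚ (θ (n + 1)) x) := by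
  have : Finsupp.lmapDomain ℚ ℚ (θ n) ∘ₗ bd φ n =
      bd ψ n ∘ₗ Finsupp.lmapDomain ℚ ℚ (θ (n + 1)) := by
    refine Finsupp.lhom_ext' fun x => LinearMap.ext_ring ?_
    simp [bd_single, Finsupp.mapDomain_single, hθ]
  exact LinearMap.congr_fun this x

/-- The face maps of tuples. -/
def tupleFace (Z : Type) (n : ℕ) (i : Fin (n + 1)) (v : Fin (n + 1) → Z) : Fin n → Z :=
  v ∘ i.succAbove

/-- Formal rational combinations of tuples of length `n`. -/
abbrev Tup (Z : Type) (n : ℕ) : Type := (Fin n → Z) →₀ ℚ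

/-- The boundary operator of the (augmented) complex of tuples. -/
abbrev tbd (Z : Type) (n : ℕ) : Tup Z (n + 1) →ₗ[ℚ] Tup Z n :=
  bd (K := fun n => Fin n → Z) (tupleFace Z) n

/-- The map of tuples induced by a function. -/
abbrev tupMap {Z Z' : Type} (β : Z → Z') (n : ℕ) : Tup Z n →ₗ[ℚ] Tup Z' n :=
  Finsupp.lmapDomain ℚ ℚ (fun v : Fin n → Z => β ∘ v)

theorem tbd_tupMap {Z Z' : Type} (β : Z → Z') (n : ℕ) (x : Tup Z (n + 1)) :
    tupMap β n (tbd Z n x) = tbd Z' n (tupMap β (n + 1) x) :=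
  bd_map (fun n (v : Fin n → Z) => β ∘ v) (fun _ _ _ => rfl) n x

/-- The cone operator on tuples. -/
abbrev tcone {Z : Type} (b : Z) (n : ℕ) : Tup Z n →ₗ[ℚ] Tup Z (n + 1) :=
  Finsupp.lmapDomain ℚ ℚ (fun v : Fin n → Z => (Fin.cons b v : Fin (n + 1) → Z))

theorem tbd_tcone_zero {Z : Type} (b : Z) (x : Tup Z 0) : tbd Z 0 (tcone b 0 x) = x := by
  have : tbd Z 0 ∘ₗ tcone b 0 = LinearMap.id := by
    refine Finsupp.lhom_ext' fun x => LinearMap.ext_ring ?_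
    simp only [LinearMap.comp_apply, Finsupp.lsingle_apply, Finsupp.lmapDomain_apply,
      Finsupp.mapDomain_single, bd_single]
    simp
  exact LinearMap.congr_fun this x

theorem tbd_tcone {Z : Type} (b : Z) (n : ℕ) (x : Tup Z (n + 1)) :
    tbd Z (n + 1) (tcone b (n + 1) x) = x - tcone b n (tbd Z n x) := by
  have : tbd Z (n + 1) ∘ₗ tcone b (n + 1) = LinearMap.id - tcone b n ∘ₗ tbd Z n := by
    refine Finsupp.lhom_ext' fun x => LinearMap.ext_ring ?_
    simp only [LinearMap.comp_apply, Finsupp.lsingle_apply, Finsupp.lmapDomain_apply,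
      Finsupp.mapDomain_single, bd_single, LinearMap.sub_apply, LinearMap.id_apply]
    rw [Fin.sum_univ_succ]
    have h0 : tupleFace Z (n + 1) 0 (Fin.cons b x) = x := by
      ext j; simp [tupleFace]
    have hs : ∀ i : Fin (n + 1), tupleFace Z (n + 1) i.succ (Fin.cons b x) =
        Fin.cons b (tupleFace Z n i x) := by
      intro i; ext j
      refine Fin.cases ?_ (fun j => ?_) j <;> simp [tupleFace]
    simp only [h0, hs, Fin.val_zero, pow_zero, one_smul, Fin.val_succ, pow_succ]
    rw [← Finsupp.lmapDomain_apply ℚ ℚ, map_sum, sub_eq_add_neg, ← Finset.sum_neg_distrib]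
    simp [Finsupp.mapDomain_single]
  exact LinearMap.congr_fun this x

theorem Tup.induction_single {Z : Type} {n : ℕ} {E : Type*} [AddCommGroup E] [Module ℚ E]
    {f g : Tup Z n →ₗ[ℚ] E} (h : ∀ w, f (Finsupp.single w 1) = g (Finsupp.single w 1))
    (x : Tup Z n) :
    f x = g x := by
  have : f = g := Finsupp.lhom_ext' fun x => LinearMap.ext_ring (by simpa using h x)
  rw [this]

theorem single_eq_tcone {Z : Type} {n : ℕ} (w : Fin (n + 1) → Z) :
    Finsupp.single w (1 : ℚ) = tcone (w 0) n (Finsupp.single (Fin.tail w) 1) := by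
  simp [Finsupp.mapDomain_single]

theorem tbd_tbd {Z : Type} (n : ℕ) (x : Tup Z (n + 2)) : tbd Z n (tbd Z (n + 1) x) = 0 := by
  refine Tup.induction_single (f := tbd Z n ∘ₗ tbd Z (n + 1)) (g := 0) (fun w => ?_) x
  rw [LinearMap.comp_apply, single_eq_tcone, tbd_tcone, map_sub, LinearMap.zero_apply]
  cases n with
  | zero => rw [tbd_tcone_zero, sub_self]
  | succ n =>
    rw [tbd_tcone, tbd_tbd n, map_zero, sub_zero, sub_self]

/-- The linear extension of a function on tuples. -/
abbrev tlift {Z : Type} {n : ℕ} {E : Type*} [AddCommGroup E] [Module ℚ E] (f : (Fin n → Z) → E) :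
    Tup Z n →ₗ[ℚ] E :=
  Finsupp.linearCombination ℚ f

/-- The augmentation preserving chain map determined by a choice of cone points. -/
def coneMap {W Z : Type} (b : ∀ n, (Fin (n + 1) → W) → Z) : ∀ n, Tup W n →ₗ[ℚ] Tup Z n
  | 0 => Finsupp.lmapDomain ℚ ℚ (fun _ => Fin.elim0)
  | n + 1 => tlift fun w => tcone (b n w) n (coneMap b n (tbd W n (Finsupp.single w 1)))

theorem coneMap_single {W Z : Type} (b : ∀ n, (Fin (n + 1) → W) → Z) (n : ℕ) (w : Fin (n + 1) → W) :
    coneMap b (n + 1) (Finsupp.single w 1) =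
      tcone (b n w) n (coneMap b n (tbd W n (Finsupp.single w 1))) := by
  simp [coneMap]

theorem tbd_coneMap {W Z : Type} (b : ∀ n, (Fin (n + 1) → W) → Z) (n : ℕ) (x : Tup W (n + 1)) :
    coneMap b n (tbd W n x) = tbd Z n (coneMap b (n + 1) x) := by
  refine Tup.induction_single (f := coneMap b n ∘ₗ tbd W n) (g := tbd Z n ∘ₗ coneMap b (n + 1))
    (fun w => ?_) x
  rw [LinearMap.comp_apply, LinearMap.comp_apply, coneMap_single]
  cases n with
  | zero => rw [tbd_tcone_zero]
  | succ n => rw [tbd_tcone, ← tbd_coneMap b n, tbd_tbd, map_zero, map_zero, sub_zero]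

theorem coneMap_natural {W Z W' Z' : Type} {b : ∀ n, (Fin (n + 1) → W) → Z}
    {b' : ∀ n, (Fin (n + 1) → W') → Z'} (α : W → W') (β : Z → Z')
    (h : ∀ n w, β (b n w) = b' n (α ∘ w)) (n : ℕ) (x : Tup W n) :
    tupMap β n (coneMap b n x) = coneMap b' n (tupMap α n x) := by
  refine Tup.induction_single (f := tupMap β n ∘ₗ coneMap b n) (g := coneMap b' n ∘ₗ tupMap α n)
    (fun w => ?_) x
  cases n with
  | zero =>
    simp only [coneMap, LinearMap.comp_apply, Finsupp.lmapDomain_apply, Finsupp.mapDomain_single]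
    congr 1
    exact Subsingleton.elim _ _
  | succ n =>
    have hc : ∀ y, tupMap β (n + 1) (tcone (b n w) n y) =
        tcone (b' n (α ∘ w)) n (tupMap β n y) := by
      intro y
      simp only [Finsupp.lmapDomain_apply, ← Finsupp.mapDomain_comp]
      congr 1
      ext v j
      refine Fin.cases ?_ (fun j => ?_) j <;> simp [h]
    have hw : tupMap α (n + 1) (Finsupp.single w 1) = Finsupp.single (α ∘ w) 1 := by
      simp [Finsupp.mapDomain_single]
    rw [LinearMap.comp_apply, LinearMap.comp_apply, coneMap_single, hc, coneMap_natural α β h n,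
      tbd_tupMap, hw, coneMap_single]

/-- The homotopy between two chain maps determined by a choice of cone points. -/
def coneHtpy {W Z : Type} (b : ∀ n, (Fin (n + 1) → W) → Z) (f g : ∀ n, Tup W n →ₗ[ℚ] Tup Z n) :
    ∀ n, Tup W n →ₗ[ℚ] Tup Z (n + 1)
  | 0 => 0
  | n + 1 => tlift fun w => tcone (b n w) (n + 1)
      ((g (n + 1) - f (n + 1)) (Finsupp.single w 1) -
        coneHtpy b f g n (tbd W n (Finsupp.single w 1)))

theorem coneHtpy_single {W Z : Type} (b : ∀ n, (Fin (n + 1) → W) → Z)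
    (f g : ∀ n, Tup W n →ₗ[ℚ] Tup Z n) (n : ℕ) (w : Fin (n + 1) → W) :
    coneHtpy b f g (n + 1) (Finsupp.single w 1) = tcone (b n w) (n + 1)
      ((g (n + 1) - f (n + 1)) (Finsupp.single w 1) -
        coneHtpy b f g n (tbd W n (Finsupp.single w 1))) := by
  simp [coneHtpy]

theorem tbd_coneHtpy {W Z : Type} (b : ∀ n, (Fin (n + 1) → W) → Z)
    {f g : ∀ n, Tup W n →ₗ[ℚ] Tup Z n} (hf : ∀ n x, f n (tbd W n x) = tbd Z n (f (n + 1) x))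
    (hg : ∀ n x, g n (tbd W n x) = tbd Z n (g (n + 1) x)) (h0 : ∀ x, f 0 x = g 0 x)
    (n : ℕ) (x : Tup W (n + 1)) :
    tbd Z (n + 1) (coneHtpy b f g (n + 1) x) + coneHtpy b f g n (tbd W n x) =
      g (n + 1) x - f (n + 1) x := by
  refine Tup.induction_single
    (f := tbd Z (n + 1) ∘ₗ coneHtpy b f g (n + 1) + coneHtpy b f g n ∘ₗ tbd W n)
    (g := g (n + 1) - f (n + 1)) (fun w => ?_) x
  rw [LinearMap.add_apply, LinearMap.comp_apply, LinearMap.comp_apply, coneHtpy_single, tbd_tcone]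
  have hz : tbd Z n ((g (n + 1) - f (n + 1)) (Finsupp.single w 1) -
        coneHtpy b f g n (tbd W n (Finsupp.single w 1))) = 0 := by
    rw [map_sub, LinearMap.sub_apply, map_sub, ← hf, ← hg]
    cases n with
    | zero => simp [coneHtpy, h0]
    | succ n =>
      have := tbd_coneHtpy b hf hg h0 n (tbd W (n + 1) (Finsupp.single w 1))
      rw [tbd_tbd, map_zero, add_zero] at this
      rw [this, sub_self]
  rw [hz, map_zero, sub_zero, sub_add_cancel]

theorem coneHtpy_natural {W Z W' Z' : Type} {b : ∀ n, (Fin (n + 1) → W) → Z}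
    {b' : ∀ n, (Fin (n + 1) → W') → Z'} (α : W → W') (β : Z → Z')
    (h : ∀ n w, β (b n w) = b' n (α ∘ w)) {f g : ∀ n, Tup W n →ₗ[ℚ] Tup Z n}
    {f' g' : ∀ n, Tup W' n →ₗ[ℚ] Tup Z' n}
    (hf : ∀ n x, tupMap β n (f n x) = f' n (tupMap α n x))
    (hg : ∀ n x, tupMap β n (g n x) = g' n (tupMap α n x)) (n : ℕ) (x : Tup W n) :
    tupMap β (n + 1) (coneHtpy b f g n x) = coneHtpy b' f' g' n (tupMap α n x) := by
  refine Tup.induction_single (f := tupMap β (n + 1) ∘ₗ coneHtpy b f g n)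
    (g := coneHtpy b' f' g' n ∘ₗ tupMap α n) (fun w => ?_) x
  cases n with
  | zero => simp [coneHtpy]
  | succ n =>
    have hc : ∀ y, tupMap β (n + 2) (tcone (b n w) (n + 1) y) =
        tcone (b' n (α ∘ w)) (n + 1) (tupMap β (n + 1) y) := by
      intro y
      simp only [Finsupp.lmapDomain_apply, ← Finsupp.mapDomain_comp]
      congr 1
      ext v j
      refine Fin.cases ?_ (fun j => ?_) j <;> simp [h]
    have hw : tupMap α (n + 1) (Finsupp.single w 1) = Finsupp.single (α ∘ w) 1 := by
      simp [Finsupp.mapDomain_single]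
    rw [LinearMap.comp_apply, LinearMap.comp_apply, coneHtpy_single, hc,
      map_sub (tupMap β (n + 1)), coneHtpy_natural α β h hf hg n, tbd_tupMap, LinearMap.sub_apply,
      map_sub (tupMap β (n + 1)), hf, hg, hw,
      coneHtpy_single, LinearMap.sub_apply]

end FaceComplex

section OrderedTuples

theorem map_supported_le {ι E : Type*} [AddCommGroup E] [Module ℚ E] {S : Set ι}
    {L : (ι →₀ ℚ) →ₗ[ℚ] E} {T : Submodule ℚ E} (h : ∀ w ∈ S, L (Finsupp.single w 1) ∈ T)
    {x : ι →₀ ℚ} (hx : x ∈ Finsupp.supported ℚ ℚ S) : L x ∈ T := by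
  rw [Finsupp.supported_eq_span_single] at hx
  have : Submodule.span ℚ ((fun i => Finsupp.single i (1 : ℚ)) '' S) ≤ T.comap L := by
    rw [Submodule.span_le]
    rintro _ ⟨w, hw, rfl⟩
    exact h w hw
  exact this hx

/-- Chains of tuples with entries in `s`. -/
abbrev tsup {Z : Type} (s : Set Z) (n : ℕ) : Submodule ℚ (Tup Z n) :=
  Finsupp.supported ℚ ℚ {v : Fin n → Z | ∀ i, v i ∈ s}

theorem bd_mem_supported {K : ℕ → Type} {φ : ∀ n, Fin (n + 1) → K (n + 1) → K n}
    {S : ∀ n, Set (K n)} (h : ∀ n i x, x ∈ S (n + 1) → φ n i x ∈ S n) (n : ℕ)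
    {x : K (n + 1) →₀ ℚ} (hx : x ∈ Finsupp.supported ℚ ℚ (S (n + 1))) :
    bd φ n x ∈ Finsupp.supported ℚ ℚ (S n) := by
  refine map_supported_le (fun w hw => ?_) hx
  rw [bd_single]
  exact Submodule.sum_mem _ fun i _ => Submodule.smul_mem _ _
    (Finsupp.single_mem_supported ℚ 1 (h n i w hw))

theorem tbd_mem_tsup {Z : Type} {s : Set Z} {n : ℕ} {x : Tup Z (n + 1)} (hx : x ∈ tsup s (n + 1)) :
    tbd Z n x ∈ tsup s n :=
  bd_mem_supported (K := fun n => Fin n → Z) (S := fun _ => {v | ∀ i, v i ∈ s})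
    (fun _ _ _ hx _ => hx _) n hx

theorem tcone_mem_tsup {Z : Type} {s : Set Z} {n : ℕ} {b : Z} (hb : b ∈ s) {x : Tup Z n}
    (hx : x ∈ tsup s n) : tcone b n x ∈ tsup s (n + 1) := by
  refine map_supported_le (fun w hw => ?_) hx
  rw [Finsupp.lmapDomain_apply, Finsupp.mapDomain_single]
  refine Finsupp.single_mem_supported ℚ 1 fun i => ?_
  refine Fin.cases ?_ (fun j => ?_) i
  · simpa using hb
  · simpa using hw j

theorem coneHtpy_mem_tsup {Z : Type} {b : ∀ n, (Fin (n + 1) → Z) → Z} {s : Set Z}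
    (hb : ∀ n w, (∀ i, w i ∈ s) → b n w ∈ s) {f g : ∀ n, Tup Z n →ₗ[ℚ] Tup Z n}
    (hf : ∀ n, ∀ x ∈ tsup s n, f n x ∈ tsup s n) (hg : ∀ n, ∀ x ∈ tsup s n, g n x ∈ tsup s n)
    (n : ℕ) {x : Tup Z n} (hx : x ∈ tsup s n) : coneHtpy b f g n x ∈ tsup s (n + 1) := by
  refine map_supported_le (fun w hw => ?_) hx
  have hw' : Finsupp.single w (1 : ℚ) ∈ tsup s n := Finsupp.single_mem_supported ℚ 1 hw
  cases n with
  | zero => simp [coneHtpy]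
  | succ n =>
    rw [coneHtpy_single]
    exact tcone_mem_tsup (hb n w hw) (Submodule.sub_mem _
      (Submodule.sub_mem _ (hg _ _ hw') (hf _ _ hw'))
      (coneHtpy_mem_tsup hb hf hg n (tbd_mem_tsup hw')))

variable {Z : Type} [LinearOrder Z]

/-- The cone operator discarding the tuples which are not strictly increasing. -/
def ocone (b : Z) (n : ℕ) : Tup Z n →ₗ[ℚ] Tup Z (n + 1) :=
  open Classical in
  tlift fun v => if StrictMono (Fin.cons b v : Fin (n + 1) → Z) then
    Finsupp.single (Fin.cons b v) 1 else 0

/-- Chains of strictly increasing tuples with entries in `s`. -/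
abbrev osup (s : Set Z) (n : ℕ) : Submodule ℚ (Tup Z n) :=
  Finsupp.supported ℚ ℚ {v : Fin n → Z | StrictMono v ∧ ∀ i, v i ∈ s}

theorem ocone_single_of {b : Z} {n : ℕ} {v : Fin n → Z}
    (h : StrictMono (Fin.cons b v : Fin (n + 1) → Z)) :
    ocone b n (Finsupp.single v 1) = Finsupp.single (Fin.cons b v) 1 := by
  simp [ocone, h]

theorem ocone_single_of_not {b : Z} {n : ℕ} {v : Fin n → Z}
    (h : ¬ StrictMono (Fin.cons b v : Fin (n + 1) → Z)) :
    ocone b n (Finsupp.single v 1) = 0 := by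
  simp [ocone, h]

theorem ocone_mem_osup {s : Set Z} {n : ℕ} {b : Z} (hb : b ∈ s) {x : Tup Z n}
    (hx : x ∈ tsup s n) : ocone b n x ∈ osup s (n + 1) := by
  refine map_supported_le (fun w hw => ?_) hx
  by_cases h : StrictMono (Fin.cons b w : Fin (n + 1) → Z)
  · rw [ocone_single_of h]
    refine Finsupp.single_mem_supported ℚ 1 ⟨h, fun i => ?_⟩
    refine Fin.cases ?_ (fun j => ?_) i
    · simpa using hb
    · simpa using hw j
  · rw [ocone_single_of_not h]
    exact Submodule.zero_mem _

theorem osup_le_tsup (s : Set Z) (n : ℕ) : osup s n ≤ tsup s n :=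
  Finsupp.supported_mono fun _ hv => hv.2

theorem ocone_tcone (b : Z) (n : ℕ) (x : Tup Z n) : ocone b (n + 1) (tcone b n x) = 0 := by
  refine Tup.induction_single (f := ocone b (n + 1) ∘ₗ tcone b n) (g := 0) (fun w => ?_) x
  rw [LinearMap.comp_apply, Finsupp.lmapDomain_apply, Finsupp.mapDomain_single,
    ocone_single_of_not, LinearMap.zero_apply]
  intro h
  have := h (show (0 : Fin (n + 2)) < 1 from by simp)
  simp [Fin.cons_one] at this

theorem tbd_ocone_zero (b : Z) (x : Tup Z 0) : tbd Z 0 (ocone b 0 x) = x := by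
  refine Tup.induction_single (f := tbd Z 0 ∘ₗ ocone b 0) (g := LinearMap.id) (fun w => ?_) x
  have : Subsingleton (Fin (0 + 1)) := inferInstanceAs (Subsingleton (Fin 1))
  rw [LinearMap.comp_apply, ocone_single_of (Subsingleton.strictMono _)]
  conv_rhs => rw [LinearMap.id_apply, ← tbd_tcone_zero b (Finsupp.single w 1)]
  rw [Finsupp.lmapDomain_apply, Finsupp.mapDomain_single]

theorem strictMono_cons {b : Z} {n : ℕ} {v : Fin n → Z} (hv : StrictMono v) (h : ∀ i, b < v i) :
    StrictMono (Fin.cons b v : Fin (n + 1) → Z) := by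
  intro i j hij
  induction i using Fin.cases with
  | zero =>
    induction j using Fin.cases with
    | zero => exact absurd hij (lt_irrefl _)
    | succ j => simpa using h j
  | succ i =>
    induction j using Fin.cases with
    | zero => exact absurd hij (Fin.not_lt_zero _)
    | succ j => simpa using hv (Fin.succ_lt_succ_iff.1 hij)

theorem tbd_ocone (b : Z) (n : ℕ) {x : Tup Z (n + 1)} (hx : x ∈ osup (Set.Ici b) (n + 1)) :
    tbd Z (n + 1) (ocone b (n + 1) x) = x - ocone b n (tbd Z n x) := by
  rw [← sub_eq_zero]
  have := map_supported_le (L := tbd Z (n + 1) ∘ₗ ocone b (n + 1) -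
    (LinearMap.id - ocone b n ∘ₗ tbd Z n)) (T := ⊥) (fun v hv => ?_) hx
  · simpa using this
  rw [Submodule.mem_bot, LinearMap.sub_apply, sub_eq_zero]
  simp only [LinearMap.comp_apply, LinearMap.sub_apply, LinearMap.id_apply]
  rcases (hv.2 0).lt_or_eq with h | h
  · have hb : ∀ i, b < v i := fun i => h.trans_le (hv.1.monotone (Fin.zero_le i))
    have h1 : ocone b n (tbd Z n (Finsupp.single v 1)) =
        tcone b n (tbd Z n (Finsupp.single v 1)) := by
      rw [bd_single, map_sum, map_sum]
      refine Finset.sum_congr rfl fun i _ => ?_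
      rw [map_smul, map_smul, ocone_single_of, Finsupp.lmapDomain_apply, Finsupp.mapDomain_single]
      exact strictMono_cons (hv.1.comp (Fin.strictMono_succAbove i)) (fun j => hb _)
    rw [ocone_single_of (strictMono_cons hv.1 hb), h1, ← tbd_tcone, Finsupp.lmapDomain_apply,
      Finsupp.mapDomain_single]
  · rw [ocone_single_of_not, map_zero]
    · have hv' : StrictMono (Fin.cons b (Fin.tail v) : Fin (n + 1) → Z) := by
        rw [h, Fin.cons_self_tail]; exact hv.1
      have h2 : Finsupp.single v (1 : ℚ) = ocone b n (Finsupp.single (Fin.tail v) 1) := by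
        rw [ocone_single_of hv', h, Fin.cons_self_tail]
      have h3 := single_eq_tcone v
      rw [← h] at h3
      rw [eq_comm, sub_eq_zero]
      conv_rhs => rw [h3]
      cases n with
      | zero => rw [tbd_tcone_zero, h2]
      | succ n => rw [tbd_tcone, map_sub, ocone_tcone, sub_zero, h2]
    · intro hm
      have := hm (show (0 : Fin (n + 2)) < 1 from by simp)
      simp [Fin.cons_one, ← h] at this

/-- The smallest entry of a nonempty tuple. -/
def tmin (n : ℕ) (w : Fin (n + 1) → Z) : Z := Finset.univ.inf' Finset.univ_nonempty w

theorem tmin_le (n : ℕ) (w : Fin (n + 1) → Z) (i : Fin (n + 1)) : tmin n w ≤ w i :=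
  Finset.inf'_le _ (Finset.mem_univ i)

theorem tmin_mem (n : ℕ) (w : Fin (n + 1) → Z) : ∃ i, tmin n w = w i := by
  obtain ⟨i, -, hi⟩ := Finset.exists_mem_eq_inf' Finset.univ_nonempty w
  exact ⟨i, hi⟩

/-- The normalization of tuples to strictly increasing tuples. -/
def ordMap : ∀ n, Tup Z n →ₗ[ℚ] Tup Z n
  | 0 => LinearMap.id
  | n + 1 => tlift fun w => ocone (tmin n w) n (ordMap n (tbd Z n (Finsupp.single w 1)))

theorem ordMap_single (n : ℕ) (w : Fin (n + 1) → Z) :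
    ordMap (n + 1) (Finsupp.single w 1) =
      ocone (tmin n w) n (ordMap n (tbd Z n (Finsupp.single w 1))) := by
  simp [ordMap]

theorem ordMap_mem {s : Set Z} (n : ℕ) {x : Tup Z n} (hx : x ∈ tsup s n) :
    ordMap n x ∈ osup s n := by
  refine map_supported_le (fun w hw => ?_) hx
  have hw' : Finsupp.single w (1 : ℚ) ∈ tsup s n := Finsupp.single_mem_supported ℚ 1 hw
  cases n with
  | zero => exact Finsupp.single_mem_supported ℚ 1 ⟨Subsingleton.strictMono _, hw⟩
  | succ n =>
    rw [ordMap_single]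
    obtain ⟨i, hi⟩ := tmin_mem n w
    exact ocone_mem_osup (hi ▸ hw i) (osup_le_tsup s n (ordMap_mem n (tbd_mem_tsup hw')))

theorem tbd_ordMap (n : ℕ) (x : Tup Z (n + 1)) :
    ordMap n (tbd Z n x) = tbd Z n (ordMap (n + 1) x) := by
  refine Tup.induction_single (f := ordMap n ∘ₗ tbd Z n) (g := tbd Z n ∘ₗ ordMap (n + 1))
    (fun w => ?_) x
  rw [LinearMap.comp_apply, LinearMap.comp_apply, ordMap_single]
  cases n with
  | zero => rw [tbd_ocone_zero]
  | succ n =>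
    have hw : Finsupp.single w (1 : ℚ) ∈ tsup (Set.Ici (tmin (n + 1) w)) (n + 2) :=
      Finsupp.single_mem_supported ℚ 1 (fun i => tmin_le _ w i)
    rw [tbd_ocone _ _ (ordMap_mem _ (tbd_mem_tsup hw)), ← tbd_ordMap n, tbd_tbd, map_zero,
      map_zero, sub_zero]

theorem exists_normalization_of_linearOrder (Z : Type) [LinearOrder Z] :
    ∃ (A : ∀ n, Tup Z n →ₗ[ℚ] Tup Z n) (D : ∀ n, Tup Z n →ₗ[ℚ] Tup Z (n + 1)),
      (∀ n x, A n (tbd Z n x) = tbd Z n (A (n + 1) x)) ∧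
      (∀ s : Set Z, ∀ n, ∀ x ∈ tsup s n, A n x ∈ tsup s n) ∧
      (∀ s : Set Z, s.Finite → ∀ n, s.ncard < n → ∀ x ∈ tsup s n, A n x = 0) ∧
      (∀ s : Set Z, ∀ n, ∀ x ∈ tsup s n, D n x ∈ tsup s (n + 1)) ∧
      (∀ x, D 0 x = 0) ∧
      (∀ n x, tbd Z (n + 1) (D (n + 1) x) + D n (tbd Z n x) = x - A (n + 1) x) := by
  have hA : ∀ s : Set Z, ∀ n, ∀ x ∈ tsup s n, ordMap n x ∈ tsup s n := fun s n x hx =>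
    osup_le_tsup s n (ordMap_mem n hx)
  refine ⟨ordMap, coneHtpy (fun n w => w 0) ordMap (fun _ => LinearMap.id), tbd_ordMap, hA,
    fun s hs n hn x hx => ?_, fun s n x hx => ?_, fun x => rfl, fun n x => ?_⟩
  · have h := ordMap_mem n hx
    have he : {v : Fin n → Z | StrictMono v ∧ ∀ i, v i ∈ s} = ∅ := by
      rw [Set.eq_empty_iff_forall_notMem]
      rintro v ⟨hv, hvs⟩
      have h1 : (Set.range v).ncard ≤ s.ncard :=
        Set.ncard_le_ncard (by rintro _ ⟨i, rfl⟩; exact hvs i) hs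
      rw [← Nat.card_coe_set_eq, Nat.card_range_of_injective hv.injective, Nat.card_fin] at h1
      omega
    rw [osup, he, Finsupp.supported_empty] at h
    exact h
  · exact coneHtpy_mem_tsup (b := fun _ w => w 0) (f := ordMap) (g := fun _ => LinearMap.id)
      (fun _ _ hw => hw 0) (hA s) (fun _ _ hx => hx) n hx
  · exact tbd_coneHtpy (fun _ w => w 0) (f := ordMap) (g := fun _ => LinearMap.id) tbd_ordMap
      (fun _ _ => rfl) (fun _ => rfl) n x

end OrderedTuples

/-- Tuples may be normalized so that long tuples in a finite set vanish. -/
theorem exists_normalization (Z : Type) :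
    ∃ (A : ∀ n, Tup Z n →ₗ[ℚ] Tup Z n) (D : ∀ n, Tup Z n →ₗ[ℚ] Tup Z (n + 1)),
      (∀ n x, A n (tbd Z n x) = tbd Z n (A (n + 1) x)) ∧
      (∀ s : Set Z, ∀ n, ∀ x ∈ tsup s n, A n x ∈ tsup s n) ∧
      (∀ s : Set Z, s.Finite → ∀ n, s.ncard < n → ∀ x ∈ tsup s n, A n x = 0) ∧
      (∀ s : Set Z, ∀ n, ∀ x ∈ tsup s n, D n x ∈ tsup s (n + 1)) ∧
      (∀ x, D 0 x = 0) ∧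
      (∀ n x, tbd Z (n + 1) (D (n + 1) x) + D n (tbd Z n x) = x - A (n + 1) x) := by
  classical
  exact @exists_normalization_of_linearOrder Z (linearOrderOfSTO (WellOrderingRel (α := Z)))

section Singular

/-- The standard simplex with `n` vertices. -/
abbrev Simp (n : ℕ) : Type := ↥(stdSimplex ℝ (Fin n))

/-- The convex combination of the entries of a tuple with barycentric coordinates `x`. -/
def comb {V : Type} [AddCommGroup V] [Module ℝ V] {m : ℕ} (v : Fin m → V) (x : Simp m) : V :=
  ∑ i, x i • v i

theorem comb_mem {V : Type} [AddCommGroup V] [Module ℝ V] {m : ℕ} {s : Set V} (hs : Convex ℝ s)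
    {v : Fin m → V} (hv : ∀ i, v i ∈ s) (x : Simp m) : comb v x ∈ s :=
  hs.sum_mem (fun i _ => x.2.1 i) x.2.2 (fun i _ => hv i)

theorem comb_map {V : Type} [AddCommGroup V] [Module ℝ V] {m k : ℕ} (v : Fin k → V)
    (f : Fin m → Fin k) (x : Simp m) : comb v (stdSimplex.map f x) = comb (v ∘ f) x := by
  have h : ∀ j, (stdSimplex.map f x) j = ∑ i with f i = j, x i := fun j => by
    rw [stdSimplex.map_coe, FunOnFinite.linearMap_apply_apply]
  simp only [comb, h, Finset.sum_smul, Function.comp_apply]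
  rw [← Finset.sum_fiberwise Finset.univ f]
  refine Finset.sum_congr rfl fun j _ => Finset.sum_congr rfl fun i hi => ?_
  rw [(Finset.mem_filter.1 hi).2]

theorem comb_vertex {V : Type} [AddCommGroup V] [Module ℝ V] {m : ℕ} (v : Fin m → V)
    (i : Fin m) : comb v (stdSimplex.vertex i) = v i := by
  simp [comb, Pi.single_apply]

theorem continuous_comb {V : Type} [AddCommGroup V] [Module ℝ V] [TopologicalSpace V]
    [ContinuousAdd V] [ContinuousSMul ℝ V] {m : ℕ} (v : Fin m → V) : Continuous (comb v) := by
  unfold comb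
  refine continuous_finsetSum _ fun i _ => Continuous.smul ?_ continuous_const
  exact (continuous_apply i).comp continuous_subtype_val

/-- The affine map between standard simplices with prescribed vertices. -/
def aff {k m : ℕ} (w : Fin m → Simp k) (x : Simp m) : Simp k :=
  ⟨comb (fun i => (w i : Fin k → ℝ)) x, comb_mem (convex_stdSimplex ℝ (Fin k)) (fun i => (w i).2) x⟩

theorem continuous_aff {k m : ℕ} (w : Fin m → Simp k) : Continuous (aff w) :=
  (continuous_comb _).subtype_mk _

theorem comb_aff {V : Type} [AddCommGroup V] [Module ℝ V] {m k : ℕ} (v : Fin k → V)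
    (u : Fin m → Simp k) (x : Simp m) : comb (fun i => comb v (u i)) x = comb v (aff u x) := by
  have h : ∀ j, (aff u x) j = ∑ i, x i * u i j := fun j => by
    change comb (fun i => (u i : Fin k → ℝ)) x j = _
    simp [comb]
  simp only [comb, h, Finset.smul_sum, Finset.sum_smul, smul_smul]
  rw [Finset.sum_comm]

/-- The coface maps of the standard simplices. -/
def coface {n : ℕ} (i : Fin (n + 1)) : Simp n → Simp (n + 1) := stdSimplex.map i.succAbove

theorem aff_coface {k m : ℕ} (w : Fin (m + 1) → Simp k) (i : Fin (m + 1)) (x : Simp m) :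
    aff w (coface i x) = aff (w ∘ i.succAbove) x :=
  Subtype.ext (comb_map _ _ _)

theorem aff_aff {k m l : ℕ} (w : Fin m → Simp k) (u : Fin l → Simp m) (x : Simp l) :
    aff (fun i => aff w (u i)) x = aff w (aff u x) :=
  Subtype.ext (comb_aff _ _ _)

theorem aff_vertex {k m : ℕ} (w : Fin m → Simp k) (i : Fin m) :
    aff w (stdSimplex.vertex i) = w i :=
  Subtype.ext (comb_vertex _ _)

theorem aff_vertices {k : ℕ} (x : Simp k) :
    aff (fun i => stdSimplex.vertex i) x = x := by
  refine Subtype.ext ?_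
  ext j
  change comb (fun i => ((stdSimplex.vertex i : Simp k) : Fin k → ℝ)) x j = x j
  simp [comb, Pi.single_apply]

theorem coface_eq_aff {n : ℕ} (i : Fin (n + 1)) (x : Simp n) :
    coface i x = aff (fun j => stdSimplex.vertex (i.succAbove j)) x := by
  rw [← aff_vertices (coface i x), aff_coface]
  rfl

theorem coface_aff {m n : ℕ} (i : Fin (n + 1)) (w : Fin m → Simp n) (x : Simp m) :
    coface i (aff w x) = aff (coface i ∘ w) x := by
  rw [coface_eq_aff, ← aff_aff]
  congr 1
  ext1 j
  exact (coface_eq_aff _ _).symm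

theorem coface_vertex {n : ℕ} (i : Fin (n + 1)) (j : Fin n) :
    coface i (stdSimplex.vertex j) = stdSimplex.vertex (i.succAbove j) :=
  stdSimplex.map_vertex _ _

/-- Formal rational combinations of (not necessarily continuous) simplices with `n` vertices. -/
abbrev Sing (Y : Type) (n : ℕ) : Type := (Simp n → Y) →₀ ℚ

/-- The face maps of singular simplices. -/
def singFace (Y : Type) (n : ℕ) (i : Fin (n + 1)) (σ : Simp (n + 1) → Y) : Simp n → Y :=
  σ ∘ coface i

/-- The boundary operator of the (augmented) singular complex. -/
abbrev sbd (Y : Type) (n : ℕ) : Sing Y (n + 1) →ₗ[ℚ] Sing Y n :=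
  bd (K := fun n => Simp n → Y) (singFace Y) n

/-- The fundamental tuple of the standard simplex. -/
def verts (n : ℕ) : Tup (Simp n) n := Finsupp.single (fun i => stdSimplex.vertex i) 1

theorem tbd_verts (n : ℕ) : tbd (Simp (n + 1)) n (verts (n + 1)) =
    ∑ i : Fin (n + 1), (-1 : ℚ) ^ (i : ℕ) • tupMap (coface i) n (verts n) := by
  rw [verts, bd_single]
  refine Finset.sum_congr rfl fun i _ => ?_
  rw [verts, Finsupp.lmapDomain_apply, Finsupp.mapDomain_single]
  congr 2
  ext1 j
  exact (coface_vertex i j).symm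

/-- Realization of tuples as simplices. -/
abbrev tpush {Z Y : Type} (B : ∀ m, (Fin m → Z) → Simp m → Y) (m : ℕ) : Tup Z m →ₗ[ℚ] Sing Y m :=
  Finsupp.lmapDomain ℚ ℚ (B m)

theorem tpush_tbd {Z Y : Type} {B : ∀ m, (Fin m → Z) → Simp m → Y}
    (hB : ∀ m w i x, B (m + 1) w (coface i x) = B m (w ∘ i.succAbove) x) (m : ℕ)
    (x : Tup Z (m + 1)) : tpush B m (tbd Z m x) = sbd Y m (tpush B (m + 1) x) :=
  bd_map (K := fun n => Fin n → Z) (L := fun n => Simp n → Y) B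
    (fun m i w => by ext x; exact (hB m w i x).symm) m x

section Universal

variable {Y Y' : Type} {Zf : ℕ → Type} {k : ℕ} (B : ∀ n m, (Fin m → Zf n) → Simp m → Zf n)
  (κ : ∀ n, Fin (n + 1) → Zf n → Zf (n + 1)) (c : ∀ n m, Tup (Simp n) m →ₗ[ℚ] Tup (Zf n) (m + k))
  (G : ∀ n, (Simp n → Y) → Zf n → Y')

/-- The operator on singular chains determined by its values on fundamental tuples. -/
def uop (n : ℕ) : Sing Y n →ₗ[ℚ] Sing Y' (n + k) :=
  Finsupp.linearCombination ℚ fun σ => tpush (fun m w => G n σ ∘ B n m w) (n + k) (c n n (verts n))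

theorem uop_single (n : ℕ) (σ : Simp n → Y) : uop B c G n (Finsupp.single σ 1) =
    tpush (fun m w => G n σ ∘ B n m w) (n + k) (c n n (verts n)) := by
  simp [uop]

variable {B κ c G}

theorem uop_sbd (hG : ∀ n i σ z, G n (σ ∘ coface i) z = G (n + 1) σ (κ n i z))
    (hB : ∀ n m i w x, κ n i (B n m w x) = B (n + 1) m (κ n i ∘ w) x)
    (hc : ∀ n m i x, tupMap (κ n i) (m + k) (c n m x) = c (n + 1) m (tupMap (coface i) m x))
    (n : ℕ) (σ : Simp (n + 1) → Y) : uop B c G n (sbd Y n (Finsupp.single σ 1)) =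
      tpush (fun m w => G (n + 1) σ ∘ B (n + 1) m w) (n + k)
        (c (n + 1) n (tbd _ n (verts (n + 1)))) := by
  rw [bd_single, tbd_verts, map_sum, map_sum, map_sum]
  refine Finset.sum_congr rfl fun i _ => ?_
  rw [map_smul, map_smul, map_smul, uop_single, ← hc]
  congr 1
  simp only [Finsupp.lmapDomain_apply, ← Finsupp.mapDomain_comp]
  congr 1
  ext w x
  simp only [Function.comp_apply, singFace, hG, hB]

end Universal

/-- The barycentric subdivision operator on tuples in a simplex. -/
def sd (n m : ℕ) : Tup (Simp n) m →ₗ[ℚ] Tup (Simp n) m :=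
  coneMap (fun _ w => aff w stdSimplex.barycenter) m

/-- The homotopy between the identity and barycentric subdivision on tuples. -/
def sdHtpy (n m : ℕ) : Tup (Simp n) m →ₗ[ℚ] Tup (Simp n) (m + 1) :=
  coneHtpy (fun _ w => aff w stdSimplex.barycenter) (fun _ => LinearMap.id) (sd n) m

theorem sd_natural {k n m : ℕ} (u : Fin k → Simp n) (x : Tup (Simp k) m) :
    tupMap (aff u) m (sd k m x) = sd n m (tupMap (aff u) m x) :=
  coneMap_natural (aff u) (aff u) (fun _ w => (aff_aff u w _).symm) m x

theorem coface_eq_aff' {n : ℕ} (i : Fin (n + 1)) :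
    (coface i : Simp n → Simp (n + 1)) = aff (fun j => stdSimplex.vertex (i.succAbove j)) :=
  funext (coface_eq_aff i)

theorem sdHtpy_natural {k n m : ℕ} (u : Fin k → Simp n) (x : Tup (Simp k) m) :
    tupMap (aff u) (m + 1) (sdHtpy k m x) = sdHtpy n m (tupMap (aff u) m x) :=
  coneHtpy_natural (aff u) (aff u) (fun _ w => (aff_aff u w _).symm) (fun _ _ => rfl)
    (fun _ _ => sd_natural u _) m x

theorem tbd_sd (n m : ℕ) (x : Tup (Simp n) (m + 1)) :
    sd n m (tbd _ m x) = tbd _ m (sd n (m + 1) x) :=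
  tbd_coneMap _ m x

theorem sd_zero (n : ℕ) (x : Tup (Simp n) 0) : sd n 0 x = x := by
  refine Tup.induction_single (f := sd n 0) (g := LinearMap.id) (fun w => ?_) x
  simp only [sd, coneMap, Finsupp.lmapDomain_apply, Finsupp.mapDomain_single, LinearMap.id_apply]
  congr 1
  exact Subsingleton.elim _ _

theorem tbd_sdHtpy (n m : ℕ) (x : Tup (Simp n) (m + 1)) :
    tbd _ (m + 1) (sdHtpy n (m + 1) x) + sdHtpy n m (tbd _ m x) = sd n (m + 1) x - x :=
  tbd_coneHtpy _ (f := fun _ => LinearMap.id) (fun _ _ => rfl) (tbd_sd n)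
    (fun x => (sd_zero n x).symm) m x

/-- Barycentric subdivision of singular chains. -/
def ssd (Y : Type) (n : ℕ) : Sing Y n →ₗ[ℚ] Sing Y n :=
  uop (k := 0) (Zf := Simp) (fun _ _ => aff) sd (fun _ σ => σ) n

/-- The homotopy between the identity and barycentric subdivision. -/
def ssdHtpy (Y : Type) (n : ℕ) : Sing Y n →ₗ[ℚ] Sing Y (n + 1) :=
  uop (k := 1) (Zf := Simp) (fun _ _ => aff) sdHtpy (fun _ σ => σ) n

theorem tpush_aff_tbd {Y : Type} {n : ℕ} (σ : Simp n → Y) (m : ℕ) (x : Tup (Simp n) (m + 1)) :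
    tpush (fun _ w => σ ∘ aff w) m (tbd _ m x) =
      sbd Y m (tpush (fun _ w => σ ∘ aff w) (m + 1) x) :=
  tpush_tbd (B := fun _ w => σ ∘ aff w) (fun _ w i x => by simp [aff_coface]) m x

theorem tpush_verts {Y : Type} {n : ℕ} (σ : Simp n → Y) :
    tpush (fun _ w => σ ∘ aff w) n (verts n) = Finsupp.single σ 1 := by
  rw [verts, Finsupp.lmapDomain_apply, Finsupp.mapDomain_single]
  congr 1
  ext x
  simp [aff_vertices]

theorem Sing.induction_single {Y : Type} {n : ℕ} {E : Type*} [AddCommGroup E] [Module ℚ E]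
    {f g : Sing Y n →ₗ[ℚ] E} (h : ∀ w, f (Finsupp.single w 1) = g (Finsupp.single w 1))
    (x : Sing Y n) : f x = g x := by
  have : f = g := Finsupp.lhom_ext' fun x => LinearMap.ext_ring (by simpa using h x)
  rw [this]

theorem ssd_sbd {Y : Type} (n : ℕ) (x : Sing Y (n + 1)) :
    ssd Y n (sbd Y n x) = sbd Y n (ssd Y (n + 1) x) := by
  refine Sing.induction_single (f := ssd Y n ∘ₗ sbd Y n) (g := sbd Y n ∘ₗ ssd Y (n + 1))
    (fun σ => ?_) x
  rw [LinearMap.comp_apply, LinearMap.comp_apply, ssd, ssd, uop_single,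
    uop_sbd (k := 0) (Zf := Simp) (κ := fun _ => coface) (fun _ _ _ _ => rfl)
      (fun _ _ _ _ _ => coface_aff _ _ _)
      (fun _ _ i x => by rw [coface_eq_aff']; exact sd_natural _ x)]
  change _ = sbd Y n (tpush (fun _ w => σ ∘ aff w) (n + 1) (sd (n + 1) (n + 1) (verts (n + 1))))
  rw [← tpush_aff_tbd, ← tbd_sd]
  rfl

theorem sbd_ssdHtpy {Y : Type} (n : ℕ) (x : Sing Y (n + 1)) :
    sbd Y (n + 1) (ssdHtpy Y (n + 1) x) + ssdHtpy Y n (sbd Y n x) = ssd Y (n + 1) x - x := by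
  refine Sing.induction_single
    (f := sbd Y (n + 1) ∘ₗ ssdHtpy Y (n + 1) + ssdHtpy Y n ∘ₗ sbd Y n)
    (g := ssd Y (n + 1) - LinearMap.id) (fun σ => ?_) x
  rw [LinearMap.add_apply, LinearMap.comp_apply, LinearMap.comp_apply, LinearMap.sub_apply,
    LinearMap.id_apply, ssd, ssdHtpy, ssdHtpy, uop_single,
    uop_sbd (k := 1) (Zf := Simp) (κ := fun _ => coface) (fun _ _ _ _ => rfl)
      (fun _ _ _ _ _ => coface_aff _ _ _)
      (fun _ _ i x => by rw [coface_eq_aff']; exact sdHtpy_natural _ x),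
    ← tpush_aff_tbd, ← map_add, tbd_sdHtpy, uop_single, map_sub, tpush_verts]

theorem ssdHtpy_zero {Y : Type} (x : Sing Y 0) : ssdHtpy Y 0 x = 0 := by
  refine Sing.induction_single (f := ssdHtpy Y 0) (g := 0) (fun σ => ?_) x
  rw [ssdHtpy, uop_single]
  simp [sdHtpy, coneHtpy]

/-- Iterated subdivision of a simplex is computed on the fundamental tuple. -/
theorem ssd_iterate_single {Y : Type} (K n : ℕ) (σ : Simp n → Y) :
    (ssd Y n ^ K) (Finsupp.single σ 1) =
      tpush (fun _ w => σ ∘ aff w) n ((sd n n ^ K) (verts n)) := by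
  have key : ∀ x : Tup (Simp n) n, ssd Y n (tpush (fun _ w => σ ∘ aff w) n x) =
      tpush (fun _ w => σ ∘ aff w) n (sd n n x) := by
    intro x
    refine Tup.induction_single (f := ssd Y n ∘ₗ tpush (fun _ w => σ ∘ aff w) n)
      (g := tpush (fun _ w => σ ∘ aff w) n ∘ₗ sd n n) (fun w => ?_) x
    have hw : Finsupp.single w (1 : ℚ) = tupMap (aff w) n (verts n) := by
      rw [verts, Finsupp.lmapDomain_apply, Finsupp.mapDomain_single]
      congr 1
      ext1 i
      exact (aff_vertex w i).symm
    rw [LinearMap.comp_apply, LinearMap.comp_apply, Finsupp.lmapDomain_apply,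
      Finsupp.mapDomain_single, ssd, uop_single, hw, ← sd_natural]
    simp only [Finsupp.lmapDomain_apply, ← Finsupp.mapDomain_comp]
    congr 1
    ext u x
    simp only [Function.comp_apply, ← aff_aff]
    rfl
  induction K with
  | zero => exact (tpush_verts σ).symm
  | succ K ih => rw [pow_succ', Module.End.mul_apply, ih, key, pow_succ', Module.End.mul_apply]

end Singular

section Iterate

variable {E : ℕ → Type} [∀ n, AddCommGroup (E n)] [∀ n, Module ℚ (E n)]
  {d : ∀ n, E (n + 1) →ₗ[ℚ] E n} {S T U : ∀ n, Submodule ℚ (E n)} {f : ∀ n, E n →ₗ[ℚ] E n}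

theorem IsSubcomplexMap.pow (hf : IsSubcomplexMap d S d S f) (K : ℕ) :
    IsSubcomplexMap d S d S (fun n => f n ^ K) := by
  induction K with
  | zero => exact ⟨fun _ _ => rfl, fun _ _ hx => hx⟩
  | succ K ih =>
    simp only [pow_succ']
    exact hf.comp ih

theorem homologyOfMap_pow_eq_id (hf : IsSubcomplexMap d S d S f) {n : ℕ}
    (h : homologyOfMap hf n = LinearMap.id) (K : ℕ) :
    homologyOfMap (hf.pow K) n = LinearMap.id := by
  induction K with
  | zero =>
    refine LinearMap.ext fun x => ?_
    induction x using Submodule.Quotient.induction_on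
    rfl
  | succ K ih =>
    have h1 : homologyOfMap (hf.pow (K + 1)) n = homologyOfMap (hf.comp (hf.pow K)) n :=
      homologyOfMap_eq_of_eqOn _ _ (fun n x _ => by simp [pow_succ']) n
    rw [h1, homologyOfMap_comp hf (hf.pow K), h, ih, LinearMap.id_comp]

theorem homologyOfMap_incl_bijective (hfT : IsSubcomplexMap d T d T f)
    (hfU : IsSubcomplexMap d U d U f) (hTU : IsSubcomplexMap d T d U (fun _ => LinearMap.id))
    (hT : ∀ n, homologyOfMap hfT n = LinearMap.id) (hU : ∀ n, homologyOfMap hfU n = LinearMap.id)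
    (hK : ∀ n, ∀ x ∈ U n, ∃ K, (f n ^ K) x ∈ T n) (n : ℕ) :
    Function.Bijective (homologyOfMap hTU n) := by
  constructor
  · rw [injective_iff_map_eq_zero]
    intro x hx
    induction x using Submodule.Quotient.induction_on with
    | _ x =>
    rw [homologyOfMap_mk, Submodule.Quotient.mk_eq_zero] at hx
    obtain ⟨y, hy, hyx⟩ := hx
    obtain ⟨K, hK⟩ := hK _ y hy
    rw [← LinearMap.id_apply (R := ℚ) (Submodule.Quotient.mk x : homologyOf d T n),
      ← homologyOfMap_pow_eq_id hfT (hT n) K, homologyOfMap_mk, Submodule.Quotient.mk_eq_zero]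
    refine ⟨_, hK, ?_⟩
    rw [← (hfT.pow K).comm, hyx]
    rfl
  · intro x
    induction x using Submodule.Quotient.induction_on with
    | _ x =>
    obtain ⟨K, hK⟩ := hK _ x (cyclesOf_le n x.2)
    have h1 := (hfU.pow K).map_cycles n x x.2
    have h2 : (f n ^ K) x ∈ cyclesOf d T n := by
      cases n with
      | zero => exact hK
      | succ n => exact ⟨hK, h1.2⟩
    refine ⟨Submodule.Quotient.mk ⟨_, h2⟩, ?_⟩
    rw [← LinearMap.id_apply (R := ℚ) (Submodule.Quotient.mk x : homologyOf d U n),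
      ← homologyOfMap_pow_eq_id hfU (hU n) K, homologyOfMap_mk, homologyOfMap_mk]
    rfl

end Iterate

section Prism

/-- The affine structure on the prism. -/
def prismAff (n m : ℕ) (w : Fin m → Simp n × Simp 2) (x : Simp m) : Simp n × Simp 2 :=
  (aff (fun i => (w i).1) x, aff (fun i => (w i).2) x)

theorem continuous_prismAff (n m : ℕ) (w : Fin m → Simp n × Simp 2) :
    Continuous (prismAff n m w) :=
  (continuous_aff _).prodMk (continuous_aff _)

/-- The inclusion of a slice of the prism on tuples. -/
abbrev slice (n : ℕ) (t : Simp 2) (m : ℕ) : Tup (Simp n) m →ₗ[ℚ] Tup (Simp n × Simp 2) m :=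
  tupMap (fun x => (x, t)) m

/-- The prism operator on tuples. -/
def prismOp (n m : ℕ) : Tup (Simp n) m →ₗ[ℚ] Tup (Simp n × Simp 2) (m + 1) :=
  coneHtpy (fun _ w => (w 0, stdSimplex.vertex 0)) (slice n (stdSimplex.vertex 0))
    (slice n (stdSimplex.vertex 1)) m

theorem slice_natural {n : ℕ} (i : Fin (n + 1)) (t : Simp 2) (m : ℕ) (x : Tup (Simp n) m) :
    tupMap (Prod.map (coface i) id) m (slice n t m x) =
      slice (n + 1) t m (tupMap (coface i) m x) := by
  simp only [Finsupp.lmapDomain_apply, ← Finsupp.mapDomain_comp]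
  rfl

theorem prismOp_natural (n m : ℕ) (i : Fin (n + 1)) (x : Tup (Simp n) m) :
    tupMap (Prod.map (coface i) id) (m + 1) (prismOp n m x) =
      prismOp (n + 1) m (tupMap (coface i) m x) :=
  coneHtpy_natural (coface i) (Prod.map (coface i) id) (fun _ _ => rfl)
    (slice_natural i _) (slice_natural i _) m x

theorem tbd_prismOp (n m : ℕ) (x : Tup (Simp n) (m + 1)) :
    tbd _ (m + 1) (prismOp n (m + 1) x) + prismOp n m (tbd _ m x) =
      slice n (stdSimplex.vertex 1) (m + 1) x - slice n (stdSimplex.vertex 0) (m + 1) x := by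
  refine tbd_coneHtpy _ (fun _ _ => tbd_tupMap _ _ _) (fun _ _ => tbd_tupMap _ _ _)
    (fun x => ?_) m x
  refine congrArg (fun f => Finsupp.lmapDomain ℚ ℚ f x) ?_
  ext1 v
  exact Subsingleton.elim _ _

/-- A natural family of homotopies induces a chain homotopy. -/
theorem exists_prism {Y Y' : Type} (G : ∀ n, (Simp n → Y) → Simp n × Simp 2 → Y')
    (hG : ∀ n i σ z, G n (σ ∘ coface i) z = G (n + 1) σ (coface i z.1, z.2)) :
    ∃ D : ∀ n, Sing Y n →ₗ[ℚ] Sing Y' (n + 1),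
      (∀ x, D 0 x = 0) ∧
      (∀ n x, sbd Y' (n + 1) (D (n + 1) x) + D n (sbd Y n x) =
        Finsupp.lmapDomain ℚ ℚ (fun σ x => G (n + 1) σ (x, stdSimplex.vertex 1)) x -
        Finsupp.lmapDomain ℚ ℚ (fun σ x => G (n + 1) σ (x, stdSimplex.vertex 0)) x) ∧
      ∀ n σ, D n (Finsupp.single σ 1) ∈ Finsupp.supported ℚ ℚ
        {τ | ∃ g : Simp (n + 1) → Simp n × Simp 2, Continuous g ∧ τ = G n σ ∘ g} := by
  let D : ∀ n, Sing Y n →ₗ[ℚ] Sing Y' (n + 1) :=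
    uop (k := 1) (Zf := fun n => Simp n × Simp 2) prismAff prismOp G
  have hD : ∀ n σ, D n (Finsupp.single σ 1) = _ := fun n σ => uop_single _ _ _ n σ
  refine ⟨D, fun x => ?_, fun n x => ?_, fun n σ => ?_⟩
  · refine Sing.induction_single (f := D 0) (g := 0) (fun σ => ?_) x
    rw [hD]
    simp [prismOp, coneHtpy]
  · have hpush : ∀ (σ : Simp (n + 1) → Y) (m : ℕ) (x),
        tpush (fun m w => G (n + 1) σ ∘ prismAff (n + 1) m w) m (tbd _ m x) =
          sbd Y' m (tpush (fun m w => G (n + 1) σ ∘ prismAff (n + 1) m w) (m + 1) x) := by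
      intro σ m x
      refine tpush_tbd (B := fun m w => G (n + 1) σ ∘ prismAff (n + 1) m w) ?_ m x
      intro m w i x
      simp only [prismAff, Function.comp_apply, aff_coface]
      rfl
    have hsl : ∀ (σ : Simp (n + 1) → Y) (t : Simp 2),
        tpush (fun m w => G (n + 1) σ ∘ prismAff (n + 1) m w) (n + 1)
          (slice (n + 1) t (n + 1) (verts (n + 1))) =
        Finsupp.single (fun x => G (n + 1) σ (x, t)) 1 := by
      intro σ t
      rw [verts]
      simp only [Finsupp.lmapDomain_apply, Finsupp.mapDomain_single]
      congr 1
      ext x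
      simp only [Function.comp_def, prismAff, aff_vertices]
      congr 2
      refine Subtype.ext ?_
      change ∑ i, x i • (t : Fin 2 → ℝ) = t
      rw [← Finset.sum_smul, stdSimplex.sum_eq_one, one_smul]
    refine Sing.induction_single (f := sbd Y' (n + 1) ∘ₗ D (n + 1) + D n ∘ₗ sbd Y n) (g := _ - _)
      (fun σ => ?_) x
    have h := uop_sbd (k := 1) (Zf := fun n => Simp n × Simp 2) (B := prismAff) (c := prismOp)
      (κ := fun n i => Prod.map (coface i) id) hG ?_ prismOp_natural n σ
    · rw [LinearMap.add_apply, LinearMap.comp_apply, LinearMap.comp_apply, hD, LinearMap.sub_apply]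
      erw [h]
      rw [← hpush, ← map_add, tbd_prismOp, map_sub, hsl, hsl]
      simp only [Finsupp.lmapDomain_apply, Finsupp.mapDomain_single]
    · intro n m i w x
      simp only [prismAff, Prod.map, coface_aff]
      rfl
  · rw [hD]
    refine map_supported_le (S := Set.univ) (fun w _ => ?_) (by simp)
    rw [Finsupp.lmapDomain_apply, Finsupp.mapDomain_single]
    exact Finsupp.single_mem_supported ℚ 1 ⟨_, continuous_prismAff _ _ _, rfl⟩

end Prism

section Small

theorem dist_comb_le {V : Type} [NormedAddCommGroup V] [NormedSpace ℝ V] {m k : ℕ}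
    {v : Fin m → V} {u : Fin k → V} {c : ℝ} (h : ∀ i j, dist (v i) (u j) ≤ c)
    (x : Simp m) (y : Simp k) : dist (comb v x) (comb u y) ≤ c := by
  have hx : comb v x ∈ convexHull ℝ (Set.range v) :=
    comb_mem (convex_convexHull ℝ _) (fun i => subset_convexHull ℝ _ (Set.mem_range_self i)) x
  have hy : comb u y ∈ convexHull ℝ (Set.range u) :=
    comb_mem (convex_convexHull ℝ _) (fun i => subset_convexHull ℝ _ (Set.mem_range_self i)) y
  obtain ⟨_, ⟨i, rfl⟩, _, ⟨j, rfl⟩, hij⟩ := convexHull_exists_dist_ge2 hx hy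
  exact hij.trans (h i j)

theorem dist_aff_le {n m k : ℕ} {v : Fin m → Simp n} {u : Fin k → Simp n} {c : ℝ}
    (h : ∀ i j, dist (v i) (u j) ≤ c) (x : Simp m) (y : Simp k) :
    dist (aff v x) (aff u y) ≤ c :=
  dist_comb_le (v := fun i => (v i : Fin n → ℝ)) (u := fun i => (u i : Fin n → ℝ)) h x y

theorem dist_barycenter_le {n m : ℕ} {w : Fin (m + 1) → Simp n} {D : ℝ}
    (h : ∀ i j, dist (w i) (w j) ≤ D) (x : Simp (m + 1)) :
    dist (aff w stdSimplex.barycenter) (aff w x) ≤ m / (m + 1) * D := by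
  have key : ∀ j, dist (aff w stdSimplex.barycenter) (w j) ≤ m / (m + 1) * D := by
    intro j
    rw [Subtype.dist_eq, dist_eq_norm]
    have h1 : (aff w stdSimplex.barycenter).1 - (w j).1 =
        ∑ i, (1 / (m + 1) : ℝ) • ((w i).1 - (w j).1) := by
      simp only [smul_sub, Finset.sum_sub_distrib, Finset.sum_const, Finset.card_univ,
        Fintype.card_fin]
      congr 1
      · change ∑ i, (stdSimplex.barycenter : Simp (m + 1)) i • (w i).1 = _
        refine Finset.sum_congr rfl fun i _ => congrArg (· • (w i).1) ?_
        exact (stdSimplex.barycenter_apply i).trans (by simp)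
      · rw [← Nat.cast_smul_eq_nsmul ℝ, smul_smul]
        push_cast
        rw [mul_one_div_cancel (by positivity), one_smul]
    rw [h1]
    calc ‖∑ i, (1 / (m + 1) : ℝ) • ((w i).1 - (w j).1)‖
        ≤ ∑ i, ‖(1 / (m + 1) : ℝ) • ((w i).1 - (w j).1)‖ := norm_sum_le _ _
      _ = (1 / (m + 1) : ℝ) * ∑ i, dist (w i) (w j) := by
        rw [Finset.mul_sum]
        refine Finset.sum_congr rfl fun i _ => ?_
        rw [norm_smul, Real.norm_of_nonneg (by positivity), Subtype.dist_eq, dist_eq_norm]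
      _ = (1 / (m + 1) : ℝ) * ∑ i : Fin m, dist (w (j.succAbove i)) (w j) := by
        rw [Fin.sum_univ_succAbove _ j, dist_self, zero_add]
      _ ≤ (1 / (m + 1) : ℝ) * ∑ i : Fin m, D := by
        gcongr with i
        exact h _ _
      _ = m / (m + 1) * D := by simp; ring
  have h2 := dist_aff_le (v := fun _ : Fin 1 => aff w stdSimplex.barycenter) (u := w)
    (fun _ j => key j) (stdSimplex.vertex 0) x
  rwa [aff_vertex] at h2

theorem sd_small {n : ℕ} (m : ℕ) {w : Fin m → Simp n} {D : ℝ} (hD : 0 ≤ D)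
    (h : ∀ i j, dist (w i) (w j) ≤ D) :
    sd n m (Finsupp.single w 1) ∈ Finsupp.supported ℚ ℚ
      {u | (∀ i, ∃ x, u i = aff w x) ∧ ∀ i j, dist (u i) (u j) ≤ (m - 1) / m * D} := by
  induction m with
  | zero => 
    rw [sd_zero]
    exact Finsupp.single_mem_supported ℚ 1 ⟨fun i => i.elim0, fun i => i.elim0⟩
  | succ m ih =>
    rw [sd, coneMap_single]
    change tcone _ m (sd n m _) ∈ _
    rw [bd_single, map_sum, map_sum]
    refine Submodule.sum_mem _ fun i _ => ?_
    rw [map_smul, map_smul]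
    refine Submodule.smul_mem _ _ ?_
    refine map_supported_le (fun u hu => ?_) (ih (w := tupleFace _ m i w) fun j k => h _ _)
    rw [Finsupp.lmapDomain_apply, Finsupp.mapDomain_single]
    have hu' : ∀ j, ∃ x, u j = aff w x := fun j => by
      obtain ⟨x, hx⟩ := hu.1 j
      exact ⟨coface i x, by rw [hx, aff_coface]; rfl⟩
    have hle : ((m : ℝ) - 1) / m * D ≤ ((m + 1 : ℕ) - 1) / (m + 1 : ℕ) * D := by
      gcongr ?_ * D
      push_cast
      rcases Nat.eq_zero_or_pos m with rfl | hm
      · simp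
      · have : (0 : ℝ) < m := by exact_mod_cast hm
        rw [div_le_div_iff₀ (by positivity) (by positivity)]
        nlinarith
    have hb : ∀ j, dist (aff w stdSimplex.barycenter) (u j) ≤
        ((m + 1 : ℕ) - 1) / (m + 1 : ℕ) * D := fun j => by
      obtain ⟨x, hx⟩ := hu' j
      rw [hx]
      refine (dist_barycenter_le h x).trans_eq ?_
      push_cast; ring
    refine Finsupp.single_mem_supported ℚ 1 ⟨fun j => ?_, fun j k => ?_⟩
    · induction j using Fin.cases with
      | zero => exact ⟨stdSimplex.barycenter, by simp⟩
      | succ j => simpa using hu' j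
    · induction j using Fin.cases with
      | zero =>
        induction k using Fin.cases with
        | zero =>
          simp only [dist_self]
          push_cast
          simp only [add_sub_cancel_right]
          positivity
        | succ k => simpa using hb k
      | succ j =>
        induction k using Fin.cases with
        | zero => rw [dist_comm]; simpa using hb j
        | succ k => simpa using (hu.2 j k).trans hle

theorem sd_pow_small {n : ℕ} (K : ℕ) :
    (sd n n ^ K) (verts n) ∈ Finsupp.supported ℚ ℚ
      {u : Fin n → Simp n | ∀ i j, dist (u i) (u j) ≤ (((n : ℝ) - 1) / n) ^ K * 2} := by
  have hc : 0 ≤ ((n : ℝ) - 1) / n := by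
    rcases Nat.eq_zero_or_pos n with rfl | hn
    · simp
    · have : (1 : ℝ) ≤ n := by exact_mod_cast hn
      exact div_nonneg (by linarith) (by linarith)
  induction K with
  | zero =>
    refine Finsupp.single_mem_supported ℚ 1 fun i j => ?_
    have h1 := stdSimplex_subset_closedBall (stdSimplex.vertex (S := ℝ) i).2
    have h2 := stdSimplex_subset_closedBall (stdSimplex.vertex (S := ℝ) j).2
    rw [Metric.mem_closedBall] at h1 h2
    rw [Subtype.dist_eq]
    have := dist_triangle_right (stdSimplex.vertex (S := ℝ) i).1 (stdSimplex.vertex (S := ℝ) j).1 0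
    rw [pow_zero]
    linarith
  | succ K ih =>
    rw [pow_succ' (sd n n), Module.End.mul_apply]
    refine map_supported_le (fun u hu => ?_) ih
    refine Finsupp.supported_mono ?_ (sd_small n (by positivity) hu)
    intro v hv i j
    refine (hv.2 i j).trans_eq ?_
    ring

/-- A family of sets of simplices closed under continuous reparametrization. -/
def IsStable {Y : Type} (S : ∀ n, Set (Simp n → Y)) : Prop :=
  ∀ m n (g : Simp m → Simp n), Continuous g → ∀ σ ∈ S n, σ ∘ g ∈ S m

variable {Y : Type}

theorem IsStable.tpush_mem {S : ∀ n, Set (Simp n → Y)} (hS : IsStable S) {m n : ℕ}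
    {σ : Simp n → Y} (hσ : σ ∈ S n) (x : Tup (Simp n) m) :
    tpush (fun _ w => σ ∘ aff w) m x ∈ Finsupp.supported ℚ ℚ (S m) := by
  refine map_supported_le (S := Set.univ) (fun w _ => ?_) (by simp)
  rw [Finsupp.lmapDomain_apply, Finsupp.mapDomain_single]
  exact Finsupp.single_mem_supported ℚ 1 (hS _ _ _ (continuous_aff w) σ hσ)

theorem IsStable.ssd_mem {S : ∀ n, Set (Simp n → Y)} (hS : IsStable S) (n : ℕ)
    (x) (hx : x ∈ Finsupp.supported ℚ ℚ (S n)) : ssd Y n x ∈ Finsupp.supported ℚ ℚ (S n) := by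
  refine map_supported_le (fun σ hσ => ?_) hx
  rw [ssd, uop_single]
  exact hS.tpush_mem hσ _

theorem IsStable.ssdHtpy_mem {S : ∀ n, Set (Simp n → Y)} (hS : IsStable S) (n : ℕ)
    (x) (hx : x ∈ Finsupp.supported ℚ ℚ (S n)) :
    ssdHtpy Y n x ∈ Finsupp.supported ℚ ℚ (S (n + 1)) := by
  refine map_supported_le (fun σ hσ => ?_) hx
  rw [ssdHtpy, uop_single]
  exact hS.tpush_mem hσ _

/-- The (unaugmented) complex of chains on a stable family of simplices. -/
abbrev sub (S : ∀ n, Set (Simp n → Y)) (n : ℕ) : Submodule ℚ (Sing Y (n + 1)) :=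
  Finsupp.supported ℚ ℚ (S (n + 1))

/-- The (unaugmented) singular boundary operator. -/
abbrev sbd' (Y : Type) (n : ℕ) : Sing Y (n + 2) →ₗ[ℚ] Sing Y (n + 1) := sbd Y (n + 1)

theorem IsStable.isSubcomplexMap_ssd {S : ∀ n, Set (Simp n → Y)} (hS : IsStable S) :
    IsSubcomplexMap (sbd' Y) (sub S) (sbd' Y) (sub S) (fun n => ssd Y (n + 1)) :=
  ⟨fun n x => ssd_sbd (n + 1) x, fun n x hx => hS.ssd_mem (n + 1) x hx⟩

theorem IsStable.homologyOfMap_ssd {S : ∀ n, Set (Simp n → Y)} (hS : IsStable S) (n : ℕ) :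
    homologyOfMap hS.isSubcomplexMap_ssd n = LinearMap.id := by
  rw [← homologyOfMap_id (isSubcomplexMap_id fun _ => le_rfl)]
  symm
  refine homologyOfMap_eq_of_homotopy _ _ (fun n => ssdHtpy Y (n + 1))
    (fun n x hx => hS.ssdHtpy_mem _ x hx) (fun x _ => ?_) (fun n x _ => sbd_ssdHtpy (n + 1) x) n
  have := sbd_ssdHtpy 0 x
  rwa [ssdHtpy_zero, add_zero] at this

/-- Continuous simplices in `X`. -/
def singIn [TopologicalSpace Y] (X : Set Y) (n : ℕ) : Set (Simp n → Y) :=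
  {σ | Continuous σ ∧ ∀ x, σ x ∈ X}

/-- Continuous simplices in `X` of size less than `ε`. -/
def singSmall [PseudoMetricSpace Y] (X : Set Y) (ε : ℝ) (n : ℕ) : Set (Simp n → Y) :=
  {σ | (Continuous σ ∧ ∀ x, σ x ∈ X) ∧ ∀ x y, dist (σ x) (σ y) < ε}

theorem isStable_singIn [TopologicalSpace Y] (X : Set Y) : IsStable (singIn X) :=
  fun _ _ g hg _ hσ => ⟨hσ.1.comp hg, fun x => hσ.2 (g x)⟩

theorem isStable_singSmall [PseudoMetricSpace Y] (X : Set Y) (ε : ℝ) : IsStable (singSmall X ε) :=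
  fun _ _ g hg _ hσ => ⟨⟨hσ.1.1.comp hg, fun x => hσ.1.2 (g x)⟩, fun x y => hσ.2 (g x) (g y)⟩

theorem eventually_ssd_pow_mem [PseudoMetricSpace Y] (X : Set Y) {ε : ℝ} (hε : 0 < ε) (n : ℕ)
    {x : Sing Y n} (hx : x ∈ Finsupp.supported ℚ ℚ (singIn X n)) :
    ∀ᶠ K in Filter.atTop, (ssd Y n ^ K) x ∈ Finsupp.supported ℚ ℚ (singSmall X ε n) := by
  have h1 : ∀ σ ∈ singIn X n, ∀ᶠ K in Filter.atTop,
      (ssd Y n ^ K) (Finsupp.single σ 1) ∈ Finsupp.supported ℚ ℚ (singSmall X ε n) := by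
    intro σ hσ
    have hu := CompactSpace.uniformContinuous_of_continuous hσ.1
    obtain ⟨δ, hδ, hu⟩ := Metric.uniformContinuous_iff.1 hu ε hε
    have hlim : Filter.Tendsto (fun K : ℕ => (((n : ℝ) - 1) / n) ^ K * 2) Filter.atTop
        (nhds (0 * 2)) := by
      refine Filter.Tendsto.mul_const _ (tendsto_pow_atTop_nhds_zero_of_lt_one ?_ ?_)
      · rcases Nat.eq_zero_or_pos n with rfl | hn
        · simp
        · have : (1 : ℝ) ≤ n := by exact_mod_cast hn
          exact div_nonneg (by linarith) (by linarith)
      · rcases Nat.eq_zero_or_pos n with rfl | hn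
        · simp
        · have : (0 : ℝ) < n := by exact_mod_cast hn
          rw [div_lt_one this]
          linarith
    rw [zero_mul] at hlim
    filter_upwards [hlim.eventually (gt_mem_nhds hδ)] with K hK
    rw [ssd_iterate_single]
    refine map_supported_le (fun u hu' => ?_) (sd_pow_small K)
    rw [Finsupp.lmapDomain_apply, Finsupp.mapDomain_single]
    refine Finsupp.single_mem_supported ℚ 1 ⟨⟨hσ.1.comp (continuous_aff u), fun x => hσ.2 _⟩,
      fun x y => hu ?_⟩
    exact (dist_aff_le hu' x y).trans_lt hK
  rw [Finsupp.supported_eq_span_single] at hx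
  induction hx using Submodule.span_induction with
  | mem x hx =>
    obtain ⟨σ, hσ, rfl⟩ := hx
    exact h1 σ hσ
  | zero => simp
  | add x y _ _ hx hy =>
    filter_upwards [hx, hy] with K h1 h2
    rw [map_add]
    exact Submodule.add_mem _ h1 h2
  | smul a x _ hx =>
    filter_upwards [hx] with K h1
    rw [map_smul]
    exact Submodule.smul_mem _ _ h1

theorem singSmall_subset [PseudoMetricSpace Y] (X : Set Y) (ε : ℝ) (n : ℕ) :
    singSmall X ε n ⊆ singIn X n := fun _ h => h.1

theorem isSubcomplexMap_small [PseudoMetricSpace Y] (X : Set Y) (ε : ℝ) :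
    IsSubcomplexMap (sbd' Y) (sub (singSmall X ε)) (sbd' Y) (sub (singIn X))
      (fun _ => LinearMap.id) :=
  isSubcomplexMap_id fun n => Finsupp.supported_mono (singSmall_subset X ε (n + 1))

/-- Small simplices compute singular homology. -/
theorem homologyOfMap_small_bijective [PseudoMetricSpace Y] (X : Set Y) {ε : ℝ}
    (hε : 0 < ε) (n : ℕ) :
    Function.Bijective (homologyOfMap (isSubcomplexMap_small X ε) n) :=
  homologyOfMap_incl_bijective (isStable_singSmall X ε).isSubcomplexMap_ssd
    (isStable_singIn X).isSubcomplexMap_ssd _ (isStable_singSmall X ε).homologyOfMap_ssd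
    (isStable_singIn X).homologyOfMap_ssd
    (fun n _ hx => (eventually_ssd_pow_mem X hε (n + 1) hx).exists) n

end Small

section TraceFormula

variable {V : Type} [NormedAddCommGroup V] [NormedSpace ℝ V]

/-- The realization of tuples through a map `r`. -/
abbrev realize (r : V → V) (m : ℕ) : Tup V m →ₗ[ℚ] Sing V m :=
  tpush (fun _ v => r ∘ comb v) m

theorem realize_tbd (r : V → V) (m : ℕ) (x : Tup V (m + 1)) :
    realize r m (tbd V m x) = sbd V m (realize r (m + 1) x) :=
  tpush_tbd (B := fun _ v => r ∘ comb v) (fun _ v _ x => congrArg r (comb_map v _ x)) m x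

/-- The tuple of (approximated) vertices of a simplex. -/
abbrev vertexMap (q : V → V) (m : ℕ) : Sing V m →ₗ[ℚ] Tup V m :=
  Finsupp.lmapDomain ℚ ℚ (fun σ i => q (σ (stdSimplex.vertex i)))

theorem vertexMap_sbd (q : V → V) (m : ℕ) (x : Sing V (m + 1)) :
    vertexMap q m (sbd V m x) = tbd V m (vertexMap q (m + 1) x) :=
  bd_map (K := fun n => Simp n → V) (L := fun n => Fin n → V)
    (fun _ σ i => q (σ (stdSimplex.vertex i)))
    (fun m i σ => by ext j; simp [singFace, tupleFace, coface_vertex]) m x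

/-- The map induced on singular chains by a function. -/
abbrev singMap {Y Y' : Type} (φ : Y → Y') (m : ℕ) : Sing Y m →ₗ[ℚ] Sing Y' m :=
  Finsupp.lmapDomain ℚ ℚ (fun σ => φ ∘ σ)

theorem singMap_sbd {Y Y' : Type} (φ : Y → Y') (m : ℕ) (x : Sing Y (m + 1)) :
    singMap φ m (sbd Y m x) = sbd Y' m (singMap φ (m + 1) x) :=
  bd_map (K := fun n => Simp n → Y) (L := fun n => Simp n → Y') (fun _ σ => φ ∘ σ)
    (fun _ _ _ => rfl) m x

theorem isSubcomplexMap_singMap {Y Y' : Type} [TopologicalSpace Y] [TopologicalSpace Y']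
    {X : Set Y} {X' : Set Y'} {φ : Y → Y'}
    (hc : ContinuousOn φ X) (hm : Set.MapsTo φ X X') :
    IsSubcomplexMap (sbd' Y) (sub (singIn X)) (sbd' Y') (sub (singIn X'))
      (fun n => singMap φ (n + 1)) :=
  ⟨fun n x => singMap_sbd φ (n + 1) x, fun n x hx => by
    refine map_supported_le (fun σ hσ => ?_) hx
    rw [Finsupp.lmapDomain_apply, Finsupp.mapDomain_single]
    exact Finsupp.single_mem_supported ℚ 1 ⟨hc.comp_continuous hσ.1 hσ.2, fun x => hm (hσ.2 x)⟩⟩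

/-- Homotopic maps induce the same map in homology. -/
theorem homologyOfMap_singMap_eq {Y Y' : Type} [TopologicalSpace Y] [TopologicalSpace Y']
    {X : Set Y} {X' : Set Y'} {φ ψ : Y → Y'} (hφ : ContinuousOn φ X) (hφm : Set.MapsTo φ X X')
    (hψ : ContinuousOn ψ X) (hψm : Set.MapsTo ψ X X') (H : ℝ → Y → Y')
    (hH : ContinuousOn (Function.uncurry H) (Set.Icc 0 1 ×ˢ X))
    (hHm : ∀ t ∈ Set.Icc (0 : ℝ) 1, Set.MapsTo (H t) X X') (h0 : ∀ x ∈ X, H 0 x = φ x)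
    (h1 : ∀ x ∈ X, H 1 x = ψ x) (n : ℕ) :
    homologyOfMap (isSubcomplexMap_singMap hφ hφm) n =
      homologyOfMap (isSubcomplexMap_singMap hψ hψm) n := by
  obtain ⟨D, hD0, hD, hDs⟩ := exists_prism (Y := Y) (Y' := Y')
    (fun n σ z => H (z.2 1) (σ z.1)) (fun _ _ _ _ => rfl)
  have hend : ∀ (n : ℕ), ∀ x ∈ sub (singIn X) n,
      Finsupp.lmapDomain ℚ ℚ (fun (σ : Simp (n + 1) → Y) x =>
        H ((stdSimplex.vertex 1 : Simp 2) 1) (σ x)) x -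
      Finsupp.lmapDomain ℚ ℚ (fun (σ : Simp (n + 1) → Y) x =>
        H ((stdSimplex.vertex 0 : Simp 2) 1) (σ x)) x =
        singMap ψ (n + 1) x - singMap φ (n + 1) x := by
    intro n x hx
    rw [← sub_eq_zero]
    refine (Submodule.mem_bot ℚ).1 (map_supported_le (L := (_ - _) - (_ - _)) (T := ⊥)
      (fun σ hσ => ?_) hx)
    have e1 : (fun x => H ((stdSimplex.vertex 1 : Simp 2) 1) (σ x)) = ψ ∘ σ := by
      ext x; simp [h1 _ (hσ.2 x)]
    have e0 : (fun x => H ((stdSimplex.vertex 0 : Simp 2) 1) (σ x)) = φ ∘ σ := by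
      ext x; simp [h0 _ (hσ.2 x)]
    simp only [Submodule.mem_bot, LinearMap.sub_apply, Finsupp.lmapDomain_apply,
      Finsupp.mapDomain_single, e1, e0, sub_self]
  refine homologyOfMap_eq_of_homotopy _ _ (fun n => D (n + 1)) (fun n x hx => ?_)
    (fun x hx => ?_) (fun n x hx => ?_) n
  · refine map_supported_le (fun σ hσ => ?_) hx
    refine Finsupp.supported_mono ?_ (hDs _ σ)
    rintro _ ⟨g, hg, rfl⟩
    have ht : ∀ z, ((g z).2 1 : ℝ) ∈ Set.Icc (0 : ℝ) 1 := fun z =>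
      ⟨stdSimplex.zero_le _ _, stdSimplex.le_one _ _⟩
    refine ⟨?_, fun z => hHm _ (ht z) (hσ.2 _)⟩
    refine hH.comp_continuous (f := fun z => (((g z).2 1 : ℝ), σ (g z).1)) ?_
      (fun z => ⟨ht z, hσ.2 _⟩)
    refine Continuous.prodMk ?_ (hσ.1.comp (continuous_fst.comp hg))
    exact (continuous_apply (1 : Fin 2)).comp
      (continuous_subtype_val.comp (continuous_snd.comp hg))
  · have := hD 0 x
    rw [hD0, add_zero] at this
    rw [← hend 0 x hx]
    exact this
  · rw [← hend (n + 1) x hx]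
    exact hD (n + 1) x

/-- Tuples of approximating points of `X` of size less than `ρ`. -/
def vert (q : V → V) (X : Set V) (ρ : ℝ) (n : ℕ) : Set (Fin n → V) :=
  {v | (∀ i, v i ∈ q '' X) ∧ ∀ i j, dist (v i) (v j) < ρ}

/-- The chain map on tuples whose traces compute Euler characteristics. -/
def lefOp (A : ∀ n, Tup V n →ₗ[ℚ] Tup V n) (r q φ : V → V) (K n : ℕ) : Tup V n →ₗ[ℚ] Tup V n :=
  vertexMap q n ∘ₗ (ssd V n ^ K) ∘ₗ singMap φ n ∘ₗ realize r n ∘ₗ A n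

/-- The (unaugmented) boundary operator on tuples. -/
abbrev tbd' (Z : Type) (n : ℕ) : Tup Z (n + 2) →ₗ[ℚ] Tup Z (n + 1) := tbd Z (n + 1)

/-- A pair of a set `X` and approximate retractions onto it at scale `ε`. -/
structure IsApprox (r q φ : V → V) (W X : Set V) (ε : ℝ) : Prop where
  pos : 0 < ε
  q_maps : Set.MapsTo q X X
  q_fin : (q '' X).Finite
  q_dist : ∀ x ∈ X, dist (q x) x < ε
  r_eq : ∀ x ∈ X, r x = x
  r_cont : ContinuousOn r W
  hull : ∀ s ⊆ X, (∀ x ∈ s, ∀ y ∈ s, dist x y < 3 * ε) → ∀ u ∈ convexHull ℝ s, u ∈ W ∧ r u ∈ X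
  φ_cont : ContinuousOn φ X
  φ_maps : Set.MapsTo φ X X
  φ_hom : ∀ n, homologyOfMap (isSubcomplexMap_singMap φ_cont φ_maps) n = LinearMap.id

variable {r q φ : V → V} {W X : Set V} {ε : ℝ}

theorem IsApprox.isSubcomplex_vert (_h : IsApprox r q φ W X ε) :
    IsSubcomplex (tbd' V) (fun n => Finsupp.supported ℚ ℚ (vert q X (3 * ε) (n + 1))) :=
  ⟨fun n x => tbd_tbd (n + 1) x, fun n x hx =>
    bd_mem_supported (K := fun n => Fin n → V) (S := vert q X (3 * ε))
      (fun _ _ _ hv => ⟨fun _ => hv.1 _, fun _ _ => hv.2 _ _⟩) (n + 1) hx⟩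

theorem IsApprox.isSubcomplexMap_vertexMap (h : IsApprox r q φ W X ε) :
    IsSubcomplexMap (sbd' V) (sub (singSmall X ε)) (tbd' V)
      (fun n => Finsupp.supported ℚ ℚ (vert q X (3 * ε) (n + 1)))
      (fun n => vertexMap q (n + 1)) :=
  ⟨fun n x => vertexMap_sbd q (n + 1) x, fun n x hx => by
    refine map_supported_le (fun σ hσ => ?_) hx
    rw [Finsupp.lmapDomain_apply, Finsupp.mapDomain_single]
    refine Finsupp.single_mem_supported ℚ 1 ⟨fun i => ⟨_, hσ.1.2 _, rfl⟩, fun i j => ?_⟩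
    have h1 := h.q_dist _ (hσ.1.2 (stdSimplex.vertex i))
    have h2 := h.q_dist _ (hσ.1.2 (stdSimplex.vertex j))
    have h3 := hσ.2 (stdSimplex.vertex i) (stdSimplex.vertex j)
    have h4 := dist_triangle4 (q (σ (stdSimplex.vertex i))) (σ (stdSimplex.vertex i))
      (σ (stdSimplex.vertex j)) (q (σ (stdSimplex.vertex j)))
    rw [dist_comm (σ (stdSimplex.vertex j))] at h4
    linarith⟩

theorem vert_map_mem {ρ : ℝ} {k : ℕ} {L : ∀ n, Tup V n →ₗ[ℚ] Tup V (n + k)}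
    (hL : ∀ s : Set V, ∀ n, ∀ x ∈ tsup s n, L n x ∈ tsup s (n + k)) (n : ℕ)
    (x) (hx : x ∈ Finsupp.supported ℚ ℚ (vert q X ρ n)) :
    L n x ∈ Finsupp.supported ℚ ℚ (vert q X ρ (n + k)) := by
  refine map_supported_le (fun v hv => ?_) hx
  refine Finsupp.supported_mono ?_ (hL (Set.range v) n _ (Finsupp.single_mem_supported ℚ 1
    (fun i => Set.mem_range_self i)))
  intro u hu
  choose j hj using hu
  exact ⟨fun i => hj i ▸ hv.1 _, fun i i' => by rw [← hj i, ← hj i']; exact hv.2 _ _⟩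

theorem IsApprox.isSubcomplexMap_realize (h : IsApprox r q φ W X ε) :
    IsSubcomplexMap (tbd' V) (fun n => Finsupp.supported ℚ ℚ (vert q X (3 * ε) (n + 1)))
      (sbd' V) (sub (singIn X)) (fun n => realize r (n + 1)) :=
  ⟨fun n x => realize_tbd r (n + 1) x, fun n x hx => by
    refine map_supported_le (fun v hv => ?_) hx
    rw [Finsupp.lmapDomain_apply, Finsupp.mapDomain_single]
    have hh : ∀ x, comb v x ∈ W ∧ r (comb v x) ∈ X := fun x => by
      refine h.hull (Set.range v) ?_ ?_ _ (comb_mem (convex_convexHull ℝ _)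
        (fun i => subset_convexHull ℝ _ (Set.mem_range_self i)) x)
      · rintro _ ⟨i, rfl⟩
        obtain ⟨x, hx, hxi⟩ := hv.1 i
        exact hxi ▸ h.q_maps hx
      · rintro _ ⟨i, rfl⟩ _ ⟨j, rfl⟩
        exact hv.2 i j
    exact Finsupp.single_mem_supported ℚ 1
      ⟨h.r_cont.comp_continuous (continuous_comb v) fun x => (hh x).1, fun x => (hh x).2⟩⟩

theorem IsApprox.homologyOfMap_realize_vertexMap (h : IsApprox r q φ W X ε) (n : ℕ) :
    homologyOfMap (h.isSubcomplexMap_realize.comp h.isSubcomplexMap_vertexMap) n =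
      homologyOfMap (isSubcomplexMap_small X ε) n := by
  symm
  obtain ⟨D, hD0, hD, hDs⟩ := exists_prism (Y := V) (Y' := V)
    (fun n σ z => r (z.2 0 • σ z.1 + z.2 1 • comb (fun i => q (σ (stdSimplex.vertex i))) z.1))
    (fun n i σ z => by
      have hc := comb_map (fun j => q (σ (stdSimplex.vertex j))) i.succAbove z.1
      simp only [Function.comp_def] at hc
      simp only [Function.comp_apply, coface_vertex]
      rw [← hc]
      rfl)
  have hend : ∀ (n : ℕ), ∀ x ∈ sub (singSmall X ε) n,
      Finsupp.lmapDomain ℚ ℚ (fun (σ : Simp (n + 1) → V) x =>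
        r ((stdSimplex.vertex 1 : Simp 2) 0 • σ x + (stdSimplex.vertex 1 : Simp 2) 1 •
          comb (fun i => q (σ (stdSimplex.vertex i))) x)) x -
      Finsupp.lmapDomain ℚ ℚ (fun (σ : Simp (n + 1) → V) x =>
        r ((stdSimplex.vertex 0 : Simp 2) 0 • σ x + (stdSimplex.vertex 0 : Simp 2) 1 •
          comb (fun i => q (σ (stdSimplex.vertex i))) x)) x =
        realize r (n + 1) (vertexMap q (n + 1) x) - x := by
    intro n x hx
    rw [← sub_eq_zero]
    refine (Submodule.mem_bot ℚ).1 (map_supported_le (L := (_ - _) - (realize r (n + 1) ∘ₗ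
      vertexMap q (n + 1) - LinearMap.id)) (T := ⊥) (fun σ hσ => ?_) hx)
    have e1 : (fun x => r ((stdSimplex.vertex 1 : Simp 2) 0 • σ x +
        (stdSimplex.vertex 1 : Simp 2) 1 • comb (fun i => q (σ (stdSimplex.vertex i))) x)) =
        r ∘ comb (fun i => q (σ (stdSimplex.vertex i))) := by
      ext x; simp
    have e0 : (fun x => r ((stdSimplex.vertex 0 : Simp 2) 0 • σ x +
        (stdSimplex.vertex 0 : Simp 2) 1 • comb (fun i => q (σ (stdSimplex.vertex i))) x)) =
        σ := by
      ext x; simp [h.r_eq _ (hσ.1.2 x)]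
    simp only [Submodule.mem_bot, LinearMap.sub_apply, Finsupp.lmapDomain_apply,
      Finsupp.mapDomain_single, e1, e0, sub_self, LinearMap.comp_apply, LinearMap.id_apply]
  refine homologyOfMap_eq_of_homotopy _ _ (fun n => D (n + 1)) (fun n x hx => ?_)
    (fun x hx => ?_) (fun n x hx => ?_) n
  · refine map_supported_le (fun σ hσ => ?_) hx
    refine Finsupp.supported_mono ?_ (hDs _ σ)
    rintro _ ⟨g, hg, rfl⟩
    have hh : ∀ z : Simp (n + 1) × Simp 2,
        (z.2 0 • σ z.1 + z.2 1 • comb (fun i => q (σ (stdSimplex.vertex i))) z.1) ∈ W ∧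
        r (z.2 0 • σ z.1 + z.2 1 • comb (fun i => q (σ (stdSimplex.vertex i))) z.1) ∈ X := by
      intro z
      refine h.hull (Set.range σ ∪ q '' Set.range σ) ?_ ?_ _ ?_
      · rintro _ (⟨x, rfl⟩ | ⟨_, ⟨x, rfl⟩, rfl⟩)
        · exact hσ.1.2 x
        · exact h.q_maps (hσ.1.2 x)
      · have hp := h.pos
        rintro _ (⟨x, rfl⟩ | ⟨_, ⟨x, rfl⟩, rfl⟩) _ (⟨y, rfl⟩ | ⟨_, ⟨y, rfl⟩, rfl⟩)
        · linarith [hσ.2 x y]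
        · have h1 := h.q_dist _ (hσ.1.2 y)
          have h2 := dist_triangle_right (σ x) (q (σ y)) (σ y)
          linarith [hσ.2 x y]
        · have h1 := h.q_dist _ (hσ.1.2 x)
          have h2 := dist_triangle (q (σ x)) (σ x) (σ y)
          linarith [hσ.2 x y]
        · have h1 := h.q_dist _ (hσ.1.2 x)
          have h1' := h.q_dist _ (hσ.1.2 y)
          have h2 := dist_triangle4 (q (σ x)) (σ x) (σ y) (q (σ y))
          rw [dist_comm (σ y)] at h2
          linarith [hσ.2 x y]
      · have hcv := convex_convexHull ℝ (Set.range σ ∪ q '' Set.range σ)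
        exact hcv (subset_convexHull ℝ _ (Or.inl (Set.mem_range_self _)))
          (comb_mem hcv (fun i => subset_convexHull ℝ _
            (Or.inr ⟨_, Set.mem_range_self _, rfl⟩)) _)
          (stdSimplex.zero_le _ _) (stdSimplex.zero_le _ _) (stdSimplex.add_eq_one _)
    refine ⟨h.r_cont.comp_continuous ?_ fun z => (hh (g z)).1, fun z => (hh (g z)).2⟩
    have hcoord : ∀ i : Fin 2, Continuous fun z => ((g z).2 i : ℝ) := fun i =>
      (continuous_apply i).comp (continuous_subtype_val.comp (continuous_snd.comp hg))
    have hg1 : Continuous fun z => (g z).1 := continuous_fst.comp hg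
    exact ((hcoord 0).smul (hσ.1.1.comp hg1)).add
      ((hcoord 1).smul ((continuous_comb _).comp hg1))
  · have := hD 0 x
    rw [hD0, add_zero] at this
    rw [LinearMap.comp_apply, LinearMap.id_apply, ← hend 0 x hx]
    exact this
  · rw [LinearMap.comp_apply, LinearMap.id_apply, ← hend (n + 1) x hx]
    exact hD (n + 1) x

theorem IsApprox.finite_vert (h : IsApprox r q φ W X ε) (ρ : ℝ) (n : ℕ) : (vert q X ρ n).Finite :=
  (Set.Finite.pi' fun _ : Fin n => h.q_fin).subset fun _ hv => hv.1

open Filter in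
/-- The Euler characteristic of `X` is computed by traces. -/
theorem IsApprox.trace_formula (h : IsApprox r q φ W X ε)
    {A : ∀ n, Tup V n →ₗ[ℚ] Tup V n} {D : ∀ n, Tup V n →ₗ[ℚ] Tup V (n + 1)}
    (hA : ∀ n x, A n (tbd V n x) = tbd V n (A (n + 1) x))
    (hAs : ∀ s : Set V, ∀ n, ∀ x ∈ tsup s n, A n x ∈ tsup s n)
    (hAz : ∀ s : Set V, s.Finite → ∀ n, s.ncard < n → ∀ x ∈ tsup s n, A n x = 0)
    (hDs : ∀ s : Set V, ∀ n, ∀ x ∈ tsup s n, D n x ∈ tsup s (n + 1))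
    (hD0 : ∀ x, D 0 x = 0)
    (hD : ∀ n x, tbd V (n + 1) (D (n + 1) x) + D n (tbd V n x) = x - A (n + 1) x)
    {N : ℕ} (hN : (q '' X).ncard ≤ N) :
    ∀ᶠ K in atTop,
      (∀ n, N ≤ n → Module.finrank ℚ (homologyOf (sbd' V) (sub (singIn X)) n) = 0) ∧
      ∑ n ∈ Finset.range N,
          (-1 : ℚ) ^ n * Module.finrank ℚ (homologyOf (sbd' V) (sub (singIn X)) n) =
        ∑ n ∈ Finset.range N, (-1 : ℚ) ^ n *
          ∑ᶠ v ∈ vert q X (3 * ε) (n + 1), lefOp A r q φ K (n + 1) (Finsupp.single v 1) v := by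
  have hOfin : ∀ n, FiniteDimensional ℚ
      (Finsupp.supported ℚ ℚ (vert q X (3 * ε) (n + 1))) := fun n => by
    have : Finite (vert q X (3 * ε) (n + 1)) := h.finite_vert _ _
    exact (Finsupp.supportedEquivFinsupp (M := ℚ) (R := ℚ)
      (vert q X (3 * ε) (n + 1))).symm.finiteDimensional
  have hts : ∀ n x, x ∈ Finsupp.supported ℚ ℚ (vert q X (3 * ε) n) → x ∈ tsup (q '' X) n :=
    fun n x hx => Finsupp.supported_mono (fun v hv => hv.1) hx
  have hAO : IsSubcomplexMap (tbd' V) (fun n => Finsupp.supported ℚ ℚ (vert q X (3 * ε) (n + 1)))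
      (tbd' V) (fun n => Finsupp.supported ℚ ℚ (vert q X (3 * ε) (n + 1))) (fun n => A (n + 1)) :=
    ⟨fun n x => hA (n + 1) x, fun n x hx => vert_map_mem (k := 0) hAs (n + 1) x hx⟩
  have hAO1 : ∀ n, homologyOfMap hAO n = LinearMap.id := by
    intro n
    rw [← homologyOfMap_id (isSubcomplexMap_id fun _ => le_rfl)]
    refine homologyOfMap_eq_of_homotopy _ _ (fun n => D (n + 1))
      (fun n x hx => vert_map_mem (k := 1) hDs (n + 1) x hx) (fun x _ => ?_)
      (fun n x _ => hD (n + 1) x) n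
    have := hD 0 x
    rwa [hD0, add_zero] at this
  have hφ := isSubcomplexMap_singMap h.φ_cont h.φ_maps
  have hrA := hφ.comp (h.isSubcomplexMap_realize.comp hAO)
  have hev : ∀ᶠ K in atTop, ∀ n ∈ Finset.range N, ∀ v ∈ vert q X (3 * ε) (n + 1),
      (ssd V (n + 1) ^ K) (singMap φ (n + 1) (realize r (n + 1) (A (n + 1) (Finsupp.single v 1)))) ∈
        Finsupp.supported ℚ ℚ (singSmall X ε (n + 1)) := by
    rw [Filter.eventually_all_finset]
    intro n _
    rw [(h.finite_vert (3 * ε) (n + 1)).eventually_all]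
    intro v hv
    exact eventually_ssd_pow_mem X h.pos (n + 1)
      (hrA.map_mem n _ (Finsupp.single_mem_supported ℚ 1 hv))
  filter_upwards [hev] with K hK
  have hAz' : ∀ n, N ≤ n → ∀ x ∈ Finsupp.supported ℚ ℚ (vert q X (3 * ε) (n + 1)),
      A (n + 1) x = 0 := fun n hn x hx =>
    hAz _ h.q_fin _ (by omega) x (hts _ x hx)
  have hs : IsSubcomplexMap (tbd' V)
      (fun n => Finsupp.supported ℚ ℚ (vert q X (3 * ε) (n + 1))) (sbd' V) (sub (singSmall X ε))
      (fun n => (ssd V (n + 1) ^ K) ∘ₗ singMap φ (n + 1) ∘ₗ realize r (n + 1) ∘ₗ A (n + 1)) := by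
    refine ⟨fun n x => ?_, fun n x hx => ?_⟩
    · exact (((isStable_singIn X).isSubcomplexMap_ssd.pow K).comp hrA).comm n x
    · rcases lt_or_ge n N with hn | hn
      · exact map_supported_le (fun v hv => hK n (Finset.mem_range.2 hn) v hv) hx
      · simp [hAz' n hn x hx]
  have hsP : ∀ n, homologyOfMap ((isSubcomplexMap_small X ε).comp
      (hs.comp h.isSubcomplexMap_vertexMap)) n = homologyOfMap (isSubcomplexMap_small X ε) n := by
    intro n
    have e : homologyOfMap ((isSubcomplexMap_small X ε).comp
        (hs.comp h.isSubcomplexMap_vertexMap)) n =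
        homologyOfMap (((isStable_singIn X).isSubcomplexMap_ssd.pow K).comp
          (hφ.comp (h.isSubcomplexMap_realize.comp (hAO.comp h.isSubcomplexMap_vertexMap)))) n :=
      homologyOfMap_eq_of_eqOn _ _ (fun n x _ => rfl) n
    rw [e, homologyOfMap_comp ((isStable_singIn X).isSubcomplexMap_ssd.pow K)
        (hφ.comp (h.isSubcomplexMap_realize.comp (hAO.comp h.isSubcomplexMap_vertexMap))),
      homologyOfMap_pow_eq_id _ ((isStable_singIn X).homologyOfMap_ssd n),
      homologyOfMap_comp hφ
        (h.isSubcomplexMap_realize.comp (hAO.comp h.isSubcomplexMap_vertexMap)), h.φ_hom n,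
      homologyOfMap_comp h.isSubcomplexMap_realize (hAO.comp h.isSubcomplexMap_vertexMap),
      homologyOfMap_comp hAO h.isSubcomplexMap_vertexMap, hAO1 n, LinearMap.id_comp,
      LinearMap.id_comp, LinearMap.id_comp, ← h.homologyOfMap_realize_vertexMap,
      homologyOfMap_comp h.isSubcomplexMap_realize h.isSubcomplexMap_vertexMap]
  obtain ⟨h1, h2⟩ := domination_trace h.isSubcomplex_vert h.isSubcomplexMap_vertexMap hs
    (isSubcomplexMap_small X ε) (homologyOfMap_small_bijective X h.pos) hsP N
    (fun n hn x hx => by simp [hAz' n hn x hx])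
  refine ⟨h1, h2.trans (Finset.sum_congr rfl fun n _ => ?_)⟩
  have : Finite (vert q X (3 * ε) (n + 1)) := h.finite_vert _ _
  rw [trace_restrict_supported]
  rfl

end TraceFormula

section Betti

open CategoryTheory

theorem finrank_quotient_eq {A B : Type} [AddCommGroup A] [AddCommGroup B] [Module ℚ A]
    [Module ℚ B] {Z I : Submodule ℚ A} {Z' I' : Submodule ℚ B} (ψ : A →ₗ[ℚ] B)
    (hψ : Function.Injective ψ) (hZ : Z.map ψ = Z') (hI : I.map ψ = I') :
    Module.finrank ℚ (↥Z ⧸ I.submoduleOf Z) = Module.finrank ℚ (↥Z' ⧸ I'.submoduleOf Z') := by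
  subst hZ hI
  refine (Submodule.Quotient.equiv _ _ (Submodule.equivMapOfInjective ψ hψ Z) ?_).finrank_eq
  ext ⟨_, x, hx, rfl⟩
  simp only [Submodule.mem_map, Submodule.submoduleOf, Submodule.mem_comap, Submodule.subtype_apply]
  constructor
  · rintro ⟨y, hy, hyx⟩
    exact ⟨y, hy, by simpa using congrArg Subtype.val hyx⟩
  · rintro ⟨y, hy, hyx⟩
    rw [hψ hyx] at hy
    exact ⟨⟨x, hx⟩, hy, by ext; simp⟩

theorem finrank_sc_homology (S : ShortComplex (ModuleCat.{0} ℚ)) :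
    Module.finrank ℚ S.homology = Module.finrank ℚ
      (↥(LinearMap.ker S.g.hom) ⧸
        (LinearMap.range S.f.hom).submoduleOf (LinearMap.ker S.g.hom)) := by
  rw [S.moduleCatHomologyIso.toLinearEquiv.finrank_eq]
  have : LinearMap.range S.moduleCatToCycles =
      (LinearMap.range S.f.hom).submoduleOf (LinearMap.ker S.g.hom) := by
    ext ⟨x, hx⟩
    simp only [LinearMap.mem_range, Submodule.submoduleOf, Submodule.mem_comap,
      Submodule.subtype_apply]
    exact ⟨fun ⟨y, hy⟩ => ⟨y, congrArg Subtype.val hy⟩, fun ⟨y, hy⟩ => ⟨y, Subtype.ext hy⟩⟩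
  rw [← this]
  rfl

theorem finrank_homology_eq {E : ℕ → Type} [∀ n, AddCommGroup (E n)] [∀ n, Module ℚ (E n)]
    {d : ∀ n, E (n + 1) →ₗ[ℚ] E n} {S : ∀ n, Submodule ℚ (E n)}
    (K : ChainComplex (ModuleCat.{0} ℚ) ℕ) (ψ : ∀ n, K.X n →ₗ[ℚ] E n)
    (hψ : ∀ n, Function.Injective (ψ n)) (hS : ∀ n, LinearMap.range (ψ n) = S n)
    (hd : ∀ n x, ψ n ((K.d (n + 1) n).hom x) = d n (ψ (n + 1) x)) (n : ℕ) :
    Module.finrank ℚ (K.homology n) = Module.finrank ℚ (homologyOf d S n) := by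
  have hI : (LinearMap.range (K.d (n + 1) n).hom).map (ψ n) = boundariesOf d S n := by
    ext y
    simp only [boundariesOf, ← hS, Submodule.mem_map, LinearMap.mem_range]
    constructor
    · rintro ⟨_, ⟨x, rfl⟩, rfl⟩
      exact ⟨_, ⟨x, rfl⟩, (hd n x).symm⟩
    · rintro ⟨_, ⟨x, rfl⟩, rfl⟩
      exact ⟨_, ⟨x, rfl⟩, hd n x⟩
  cases n with
  | zero =>
    have e := ShortComplex.homologyMapIso (K.isoSc' 1 0 0 (by simp) (by simp))
    refine (e.toLinearEquiv.finrank_eq.trans (finrank_sc_homology _)).trans ?_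
    refine finrank_quotient_eq (ψ 0) (hψ 0) ?_ hI
    change (LinearMap.ker (K.d 0 0).hom).map (ψ 0) = _
    rw [K.shape 0 0 (by simp)]
    simp [cyclesOf, ← hS]
  | succ n =>
    have e := ShortComplex.homologyMapIso (K.isoSc' (n + 2) (n + 1) n (by simp) (by simp))
    refine (e.toLinearEquiv.finrank_eq.trans (finrank_sc_homology _)).trans ?_
    refine finrank_quotient_eq (ψ (n + 1)) (hψ _) ?_ hI
    change (LinearMap.ker (K.d (n + 1) n).hom).map (ψ (n + 1)) = _
    ext y
    simp only [cyclesOf, ← hS, Submodule.mem_map, Submodule.mem_inf, LinearMap.mem_range,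
      LinearMap.mem_ker]
    constructor
    · rintro ⟨x, hx, rfl⟩
      exact ⟨⟨x, rfl⟩, by rw [← hd, hx, map_zero]⟩
    · rintro ⟨⟨x, rfl⟩, hx⟩
      exact ⟨x, hψ n (by rw [hd, hx, map_zero]), rfl⟩

/-- The Betti numbers of a subspace of `V`. -/
theorem betti_eq_finrank {Y V : Type} [TopologicalSpace Y] [TopologicalSpace V] {e : Y → V}
    (he : Topology.IsEmbedding e) (n : ℕ) :
    betti Y n = Module.finrank ℚ (homologyOf (sbd' V) (sub (singIn (Set.range e))) n) := by
  let θ : ∀ n : ℕ, (TopCat.toSSet.obj (TopCat.of Y)).obj (Opposite.op (SimplexCategory.mk n)) →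
      (Simp (n + 1) → V) := fun n s x => e ((TopCat.of Y).toSSetObjEquiv _ s x)
  have hθ : ∀ n, Function.Injective (θ n) := fun n s t hst => by
    refine ((TopCat.of Y).toSSetObjEquiv _).injective (ContinuousMap.ext fun x => ?_)
    exact he.injective (congrFun hst x)
  have hθr : ∀ n, Set.range (θ n) = singIn (Set.range e) (n + 1) := fun n => by
    ext σ
    constructor
    · rintro ⟨s, rfl⟩
      exact ⟨he.continuous.comp (ContinuousMap.continuous _), fun x => ⟨_, rfl⟩⟩
    · rintro ⟨hc, hm⟩
      choose τ hτ using hm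
      have hτc : Continuous τ := by
        rw [he.continuous_iff]
        exact (funext hτ : e ∘ τ = σ) ▸ hc
      refine ⟨((TopCat.of Y).toSSetObjEquiv (Opposite.op (SimplexCategory.mk n))).symm ⟨τ, hτc⟩,
        funext fun x => ?_⟩
      simp only [θ, Equiv.apply_symm_apply]
      exact hτ x
  refine finrank_homology_eq (singularChainComplex Y)
    (fun n => (Finsupp.lmapDomain ℚ ℚ (θ n) : _ →ₗ[ℚ] Sing V (n + 1)))
    (fun n => Finsupp.mapDomain_injective (hθ n)) (fun n => ?_) (fun n x => ?_) n
  · have hr : LinearMap.range (Finsupp.lmapDomain ℚ ℚ (θ n)) = sub (singIn (Set.range e)) n := by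
      rw [LinearMap.range_eq_map, ← Finsupp.supported_univ, Finsupp.lmapDomain_supported,
        Set.image_univ, hθr]
    exact hr
  · have hmain : (Finsupp.lmapDomain ℚ ℚ (θ n)) ∘ₗ (∑ i : Fin (n + 2), (-1 : ℤ) ^ (i : ℕ) •
        Finsupp.lmapDomain ℚ ℚ ((TopCat.toSSet.obj (TopCat.of Y)).δ i)) =
        sbd' V n ∘ₗ Finsupp.lmapDomain ℚ ℚ (θ (n + 1)) := by
      refine Finsupp.lhom_ext' fun s => LinearMap.ext_ring ?_
      have hbd := bd_single (K := fun n => Simp n → V) (singFace V) (n + 1) (θ (n + 1) s)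
      simp only [LinearMap.comp_apply, Finsupp.lsingle_apply, LinearMap.sum_apply, map_sum,
        LinearMap.smul_apply, map_zsmul, Finsupp.lmapDomain_apply,
        Finsupp.mapDomain_single] at hbd ⊢
      rw [hbd]
      refine Finset.sum_congr rfl fun i _ => ?_
      rw [← Int.cast_smul_eq_zsmul ℚ]
      push_cast
      rfl
    have hd : ((singularChainComplex Y).d (n + 1) n).hom = ∑ i : Fin (n + 2), (-1 : ℤ) ^ (i : ℕ) •
        Finsupp.lmapDomain ℚ ℚ ((TopCat.toSSet.obj (TopCat.of Y)).δ i) := by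
      have h := AlgebraicTopology.alternatingFaceMapComplex_obj_d
        (((CategoryTheory.SimplicialObject.whiskering _ _).obj (ModuleCat.free ℚ)).obj
          (TopCat.toSSet.obj (TopCat.of Y))) n
      refine (congrArg ModuleCat.Hom.hom h).trans ?_
      rw [AlgebraicTopology.AlternatingFaceMapComplex.objD, ModuleCat.hom_sum]
      rfl
    rw [hd]
    exact LinearMap.congr_fun hmain x

end Betti

section Comparison

variable {V : Type} [NormedAddCommGroup V] [NormedSpace ℝ V] {r q φ : V → V} {W X : Set V} {ε : ℝ}

theorem exists_of_lefOp_ne_zero {A : ∀ n, Tup V n →ₗ[ℚ] Tup V n}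
    (hAs : ∀ s : Set V, ∀ n, ∀ x ∈ tsup s n, A n x ∈ tsup s n) {K n : ℕ} {v : Fin n → V}
    (hv : lefOp A r q φ K n (Finsupp.single v 1) v ≠ 0) (i : Fin n) :
    ∃ u ∈ convexHull ℝ (Set.range v), v i = q (φ (r u)) := by
  let S : ∀ n, Set (Simp n → V) := fun n =>
    {σ | ∀ x, ∃ u ∈ convexHull ℝ (Set.range v), σ x = φ (r u)}
  have hS : IsStable S := fun m n g _ σ hσ x => hσ (g x)
  have h1 : A n (Finsupp.single v 1) ∈ tsup (Set.range v) n :=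
    hAs _ _ _ (Finsupp.single_mem_supported ℚ 1 fun i => Set.mem_range_self i)
  have h2 : (singMap φ n ∘ₗ realize r n) (A n (Finsupp.single v 1)) ∈
      Finsupp.supported ℚ ℚ (S n) := by
    refine map_supported_le (fun w hw => ?_) h1
    rw [LinearMap.comp_apply, Finsupp.lmapDomain_apply, Finsupp.lmapDomain_apply,
      Finsupp.mapDomain_single, Finsupp.mapDomain_single]
    exact Finsupp.single_mem_supported ℚ 1 fun x => ⟨comb w x,
      comb_mem (convex_convexHull ℝ _) (fun i => subset_convexHull ℝ _ (hw i)) x, rfl⟩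
  have h3 : ∀ K, ((ssd V n) ^ K) ((singMap φ n ∘ₗ realize r n) (A n (Finsupp.single v 1))) ∈
      Finsupp.supported ℚ ℚ (S n) := by
    intro K
    induction K with
    | zero => simpa using h2
    | succ K ih =>
      rw [pow_succ', Module.End.mul_apply]
      exact hS.ssd_mem n _ ih
  have h4 : lefOp A r q φ K n (Finsupp.single v 1) ∈ Finsupp.supported ℚ ℚ
      {w : Fin n → V | ∀ i, ∃ u ∈ convexHull ℝ (Set.range v), w i = q (φ (r u))} := by
    refine map_supported_le (L := vertexMap q n) (fun σ hσ => ?_) (h3 K)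
    rw [Finsupp.lmapDomain_apply, Finsupp.mapDomain_single]
    refine Finsupp.single_mem_supported ℚ 1 fun i => ?_
    obtain ⟨u, hu, hσu⟩ := hσ (stdSimplex.vertex i)
    exact ⟨u, hu, congrArg q hσu⟩
  exact h4 (Finsupp.mem_support_iff.2 hv) i

open Filter in
/-- The Euler characteristic of `X` is the sum of those of the pieces containing the
approximate fixed points of `φ`. -/
theorem IsApprox.exists_sum_eq {ι : Type} [Finite ι] (hX : IsApprox r q φ W X ε) {C : ι → Set V}
    (hC : ∀ i, IsApprox r q φ W (C i) ε) (hCX : ∀ i, C i ⊆ X)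
    (hsep : ∀ i j, ∀ x ∈ C i, ∀ y ∈ C j, dist x y < 3 * ε → i = j)
    (hfix : ∀ s ⊆ X, (∀ x ∈ s, ∀ y ∈ s, dist x y < 3 * ε) → ∀ u ∈ convexHull ℝ s,
      q (φ (r u)) ∈ s → ∃ i, φ (r u) ∈ C i) :
    ∃ N, (∀ n, N ≤ n → Module.finrank ℚ (homologyOf (sbd' V) (sub (singIn X)) n) = 0) ∧
      (∀ i n, N ≤ n → Module.finrank ℚ (homologyOf (sbd' V) (sub (singIn (C i))) n) = 0) ∧
      ∑ n ∈ Finset.range N,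
          (-1 : ℚ) ^ n * Module.finrank ℚ (homologyOf (sbd' V) (sub (singIn X)) n) =
      ∑ᶠ i, ∑ n ∈ Finset.range N,
          (-1 : ℚ) ^ n * Module.finrank ℚ (homologyOf (sbd' V) (sub (singIn (C i))) n) := by
  classical
  have := Fintype.ofFinite ι
  obtain ⟨A, D, hA, hAs, hAz, hDs, hD0, hD⟩ := exists_normalization V
  have hXf := hX.trace_formula hA hAs hAz hDs hD0 hD le_rfl
  have hCf := fun i => (hC i).trace_formula hA hAs hAz hDs hD0 hD (N := (q '' X).ncard)
    (Set.ncard_le_ncard (Set.image_mono (hCX i)) hX.q_fin)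
  obtain ⟨K, hK, hKC⟩ := (hXf.and (eventually_all.2 hCf)).exists
  refine ⟨(q '' X).ncard, hK.1, fun i => (hKC i).1, ?_⟩
  rw [finsum_eq_sum_of_fintype, hK.2, Finset.sum_congr rfl fun i _ => (hKC i).2, Finset.sum_comm]
  refine Finset.sum_congr rfl fun n _ => ?_
  rw [← Finset.mul_sum]
  congr 1
  set f : (Fin (n + 1) → V) → ℚ := fun v => lefOp A r q φ K (n + 1) (Finsupp.single v 1) v with hf
  have hdisj : Pairwise (Function.onFun Disjoint fun i => vert q (C i) (3 * ε) (n + 1)) := by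
    intro i j hij
    refine Set.disjoint_left.2 fun v hv hv' => hij ?_
    obtain ⟨x, hx, hxv⟩ := hv.1 0
    obtain ⟨y, hy, hyv⟩ := hv'.1 0
    refine hsep i j _ ((hC i).q_maps hx) _ ((hC j).q_maps hy) ?_
    rw [hxv, hyv]
    exact hv.2 0 0
  rw [← finsum_eq_sum_of_fintype, ← finsum_mem_iUnion hdisj fun i => (hC i).finite_vert _ _]
  refine finsum_mem_inter_support_eq _ _ _ ?_
  ext v
  simp only [Set.mem_inter_iff, Set.mem_iUnion, Function.mem_support, and_congr_left_iff]
  intro hv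
  have hv' := fun i => exists_of_lefOp_ne_zero hAs hv i
  constructor
  · intro hvX
    have hsub : Set.range v ⊆ X := by
      rintro _ ⟨i, rfl⟩
      obtain ⟨x, hx, hxv⟩ := hvX.1 i
      exact hxv ▸ hX.q_maps hx
    have hC' : ∀ j, ∃ i, v j ∈ q '' C i := fun j => by
      obtain ⟨u, hu, hvu⟩ := hv' j
      obtain ⟨i, hi⟩ := hfix _ hsub (by rintro _ ⟨a, rfl⟩ _ ⟨b, rfl⟩; exact hvX.2 a b) u hu
        (hvu ▸ Set.mem_range_self j)
      exact ⟨i, _, hi, hvu.symm⟩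
    choose i hi using hC'
    have hm : ∀ j, v j ∈ C (i j) := fun j => (hC _).q_maps.image_subset (hi j)
    have hij : ∀ j, i j = i 0 := fun j => hsep _ _ _ (hm j) _ (hm 0) (hvX.2 j 0)
    exact ⟨i 0, fun j => hij j ▸ hi j, hvX.2⟩
  · rintro ⟨i, hi⟩
    exact ⟨fun j => Set.image_mono (hCX i) (hi.1 j), hi.2⟩

theorem eulerChar_eq_of_embedding {Y : Type} [TopologicalSpace Y] {e : Y → V}
    (he : Topology.IsEmbedding e) {N : ℕ} (hN : ∀ n, N ≤ n →
      Module.finrank ℚ (homologyOf (sbd' V) (sub (singIn (Set.range e))) n) = 0) :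
    (eulerChar Y : ℚ) = ∑ n ∈ Finset.range N,
      (-1 : ℚ) ^ n * Module.finrank ℚ (homologyOf (sbd' V) (sub (singIn (Set.range e))) n) := by
  rw [eulerChar, finsum_eq_sum_of_support_subset (s := Finset.range N)]
  · push_cast
    exact Finset.sum_congr rfl fun n _ => by rw [betti_eq_finrank he]
  · intro n hn
    by_contra h
    refine hn ?_
    simp only [betti_eq_finrank he, hN n (by simpa using h), Nat.cast_zero, mul_zero]

theorem eulerChar_eq_finsum {Y ι : Type} [TopologicalSpace Y] [Finite ι] {e : Y → V}
    (he : Topology.IsEmbedding e) (C : ι → Set Y)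
    (hX : IsApprox r q φ W (Set.range e) ε) (hC : ∀ i, IsApprox r q φ W (e '' C i) ε)
    (hsep : ∀ i j, ∀ x ∈ C i, ∀ y ∈ C j, dist (e x) (e y) < 3 * ε → i = j)
    (hfix : ∀ s ⊆ Set.range e, (∀ x ∈ s, ∀ y ∈ s, dist x y < 3 * ε) → ∀ u ∈ convexHull ℝ s,
      q (φ (r u)) ∈ s → ∃ i, φ (r u) ∈ e '' C i) :
    eulerChar Y = ∑ᶠ i, eulerChar ↥(C i) := by
  have := Fintype.ofFinite ι
  obtain ⟨N, hN, hNC, h⟩ := hX.exists_sum_eq hC (fun i => Set.image_subset_range _ _)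
    (by rintro i j _ ⟨x, hx, rfl⟩ _ ⟨y, hy, rfl⟩; exact hsep i j x hx y hy) hfix
  have hi : ∀ i, (eulerChar ↥(C i) : ℚ) = ∑ n ∈ Finset.range N,
      (-1 : ℚ) ^ n * Module.finrank ℚ (homologyOf (sbd' V) (sub (singIn (e '' C i))) n) := by
    intro i
    have hr : Set.range (e ∘ ((↑) : C i → Y)) = e '' C i := by
      rw [Set.range_comp, Subtype.range_coe]
    have := eulerChar_eq_of_embedding (he.comp (Topology.IsEmbedding.subtypeVal (p := (· ∈ C i))))
      (N := N) (fun n hn => by rw [hr]; exact hNC i n hn)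
    rw [hr] at this
    exact this
  rw [finsum_eq_sum_of_fintype] at h ⊢
  rw [← Finset.sum_congr rfl fun i _ => hi i, ← eulerChar_eq_of_embedding he hN] at h
  exact_mod_cast h

end Comparison

section Reach

open Filter Topology Set

/-- Near a point where `G` is an immersion, there is at most one point close to `u` at which
the distance to `u` has a minimum. -/
theorem exists_nearest_eq {E F : Type} [NormedAddCommGroup E] [NormedSpace ℝ E]
    [FiniteDimensional ℝ E] [NormedAddCommGroup F] [InnerProductSpace ℝ F] {G : E → F} {x₀ : E}
    (hG : ContDiffAt ℝ 2 G x₀) (hinj : Function.Injective (fderiv ℝ G x₀)) :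
    ∃ δ > 0, ∀ᶠ p : E × E in 𝓝 (x₀, x₀), ∀ u, ‖G p.1 - u‖ < δ → ‖G p.2 - u‖ ≤ ‖G p.1 - u‖ →
      IsLocalMin (fun x => ‖G x - u‖) p.1 → p.1 = p.2 := by
  obtain ⟨k, hk, hkG⟩ := (fderiv ℝ G x₀ : E →ₗ[ℝ] F).exists_antilipschitzWith
    (LinearMap.ker_eq_bot.2 hinj)
  have hs := (hG.hasStrictFDerivAt (by norm_num)).isLittleO.def (c := (2 * (k : ℝ))⁻¹)
    (by positivity)
  obtain ⟨C, t, ht, hC⟩ := (hG.fderiv_right (m := 1) (by norm_num)).exists_lipschitzOnWith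
  have hdiff := hG.eventually (by decide)
  obtain ⟨ρ, hρ, hball⟩ := Metric.eventually_nhds_iff_ball.1
    (hdiff.and (mem_of_superset ht fun _ h => h))
  have hb : ∀ᶠ p : E × E in 𝓝 (x₀, x₀), p.1 ∈ Metric.ball x₀ ρ ∧ p.2 ∈ Metric.ball x₀ ρ := by
    exact prod_mem_nhds (Metric.ball_mem_nhds x₀ hρ) (Metric.ball_mem_nhds x₀ hρ)
  refine ⟨(8 * (k : ℝ) ^ 2 * (C + 1))⁻¹, by positivity, ?_⟩
  filter_upwards [hs, hb] with ⟨a, b⟩ hab ⟨ha, hb⟩ u hu hle hmin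
  simp only at hab hu hle hmin ⊢
  have h1 : ‖a - b‖ ≤ 2 * k * ‖G a - G b‖ := by
    have h2 := hkG.le_mul_dist a b
    rw [dist_eq_norm, dist_eq_norm, ← map_sub] at h2
    have h3 := norm_sub_norm_le (fderiv ℝ G x₀ (a - b)) (fderiv ℝ G x₀ (a - b) - (G a - G b))
    rw [sub_sub_cancel, norm_sub_rev] at h3
    have hk' : (0 : ℝ) < k := hk
    have h4 : (k : ℝ) * ((2 * (k : ℝ))⁻¹ * ‖a - b‖) = ‖a - b‖ / 2 := by field_simp
    have h5 := mul_le_mul_of_nonneg_left (h3.trans' (sub_le_sub_left hab _)) hk'.le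
    simp only [ContinuousLinearMap.coe_coe] at h2
    rw [mul_sub] at h5
    linarith
  have hfd : ∀ x ∈ Metric.ball x₀ ρ, HasFDerivAt G (fderiv ℝ G x) x := fun x hx =>
    ((hball x hx).1.differentiableAt (by norm_num)).hasFDerivAt
  have hseg : segment ℝ a b ⊆ Metric.ball x₀ ρ := (convex_ball x₀ ρ).segment_subset ha hb
  have h2 : ‖G b - G a - fderiv ℝ G a (b - a)‖ ≤ C * ‖b - a‖ * ‖b - a‖ := by
    refine Convex.norm_image_sub_le_of_norm_hasFDerivWithin_le' (𝕜 := ℝ) (s := segment ℝ a b)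
      (f' := fderiv ℝ G) (fun x hx => (hfd x (hseg hx)).hasFDerivWithinAt) (fun x hx => ?_)
      (convex_segment a b) (left_mem_segment ℝ a b) (right_mem_segment ℝ a b)
    have h3 := hC.dist_le_mul x (hball x (hseg hx)).2 a (hball a ha).2
    rw [dist_eq_norm, dist_eq_norm] at h3
    refine h3.trans (mul_le_mul_of_nonneg_left ?_ C.2)
    obtain ⟨θ, hθ, rfl⟩ := segment_eq_image' ℝ a b ▸ hx
    rw [add_sub_cancel_left, norm_smul, Real.norm_of_nonneg hθ.1]
    exact mul_le_of_le_one_left (norm_nonneg _) hθ.2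
  have h3 : inner ℝ (G a - u) (fderiv ℝ G a (b - a)) = 0 := by
    have hmin' : IsLocalMin (fun x => ‖G x - u‖ ^ 2) a :=
      hmin.mono fun x hx => pow_le_pow_left₀ (norm_nonneg _) hx 2
    have h4 := hmin'.hasFDerivAt_eq_zero ((hfd a ha).sub_const u).norm_sq
    have h5 := congrArg (fun T => T (b - a)) h4
    simp only [zero_apply] at h5
    change 2 • inner ℝ (G a - u) (fderiv ℝ G a (b - a)) = 0 at h5
    simpa only [smul_eq_zero, OfNat.ofNat_ne_zero, false_or] using h5
  have h4 : ‖G a - G b‖ ^ 2 ≤ 2 * (‖G a - u‖ * (C * ‖b - a‖ * ‖b - a‖)) := by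
    have h5 : ‖G b - u‖ ^ 2 =
        ‖G a - u‖ ^ 2 + 2 * inner ℝ (G a - u) (G b - G a) + ‖G b - G a‖ ^ 2 := by
      rw [← norm_add_sq_real]; congr 2; abel
    have h6 : ‖G b - u‖ ^ 2 ≤ ‖G a - u‖ ^ 2 := by gcongr
    have h7 : inner ℝ (G a - u) (G b - G a) =
        inner ℝ (G a - u) (G b - G a - fderiv ℝ G a (b - a)) := by
      rw [inner_sub_right (G a - u) (G b - G a), h3, sub_zero]
    have h8 := (abs_real_inner_le_norm (G a - u) (G b - G a - fderiv ℝ G a (b - a))).trans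
      (mul_le_mul_of_nonneg_left h2 (norm_nonneg _))
    rw [← h7] at h8
    rw [norm_sub_rev (G a)]
    linarith [neg_abs_le (inner ℝ (G a - u) (G b - G a))]
  by_contra hne
  have hpos : 0 < ‖a - b‖ := norm_pos_iff.2 (sub_ne_zero.2 hne)
  rw [norm_sub_rev b a] at h4
  have h5 : ‖a - b‖ ^ 2 ≤ (2 * k) ^ 2 * ‖G a - G b‖ ^ 2 := by
    rw [← mul_pow]; gcongr
  have h6 : 8 * (k : ℝ) ^ 2 * (C + 1) * ‖G a - u‖ < 1 := by
    have h7 : (0 : ℝ) < 8 * (k : ℝ) ^ 2 * (C + 1) := by positivity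
    calc _ < 8 * (k : ℝ) ^ 2 * (C + 1) * (8 * (k : ℝ) ^ 2 * (C + 1))⁻¹ := by gcongr
      _ = 1 := mul_inv_cancel₀ h7.ne'
  have h7 : (0 : ℝ) ≤ 8 * (k : ℝ) ^ 2 * ‖G a - u‖ := by positivity
  have h8 : ‖a - b‖ ^ 2 ≤ (8 * (k : ℝ) ^ 2 * C * ‖G a - u‖) * ‖a - b‖ ^ 2 := by
    calc _ ≤ (2 * k) ^ 2 * (2 * (‖G a - u‖ * (C * ‖a - b‖ * ‖a - b‖))) := by
          refine h5.trans ?_; gcongr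
      _ = _ := by ring
  have h9 : (8 * (k : ℝ) ^ 2 * C * ‖G a - u‖) < 1 := by linarith
  nlinarith [pow_pos hpos 2]

/-- Points at distance less than `δ` from `X` have a unique nearest point in `X`. -/
def UniqueNearest {V : Type} [PseudoMetricSpace V] (X : Set V) (δ : ℝ) : Prop :=
  ∀ u, ∀ a ∈ X, ∀ b ∈ X, dist u a = Metric.infDist u X → dist u b = Metric.infDist u X →
    Metric.infDist u X < δ → a = b

theorem exists_uniqueNearest {E V Y : Type} [NormedAddCommGroup E] [NormedSpace ℝ E]
    [FiniteDimensional ℝ E] [NormedAddCommGroup V] [InnerProductSpace ℝ V]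
    [TopologicalSpace Y] [CompactSpace Y] {e : Y → V} (he : IsEmbedding e)
    (hloc : ∀ p : Y, ∃ ψ : OpenPartialHomeomorph Y E, p ∈ ψ.source ∧
      ContDiffAt ℝ 2 (e ∘ ψ.symm) (ψ p) ∧ Function.Injective (fderiv ℝ (e ∘ ψ.symm) (ψ p))) :
    ∃ δ > 0, UniqueNearest (range e) δ := by
  let P : ℝ → Y × Y → Prop := fun δ z => ∀ u, dist u (e z.1) = Metric.infDist u (range e) →
    dist u (e z.2) = Metric.infDist u (range e) → Metric.infDist u (range e) < δ → z.1 = z.2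
  have hP : ∀ᶠ δ in 𝓝 (0 : ℝ), ∀ z ∈ (univ : Set (Y × Y)), P δ z := by
    refine isCompact_univ.eventually_forall_of_forall_eventually ?_
    rintro ⟨p, p'⟩ -
    by_cases hpp : p = p'
    · subst hpp
      obtain ⟨ψ, hp, hψ, hinj⟩ := hloc p
      obtain ⟨δ, hδ, hev⟩ := exists_nearest_eq hψ hinj
      have h1 : ∀ᶠ z : ℝ × Y × Y in 𝓝 (0, p, p), z.1 < δ := continuous_fst.continuousAt.eventually
        (eventually_lt_nhds hδ)
      have hsrc : ∀ᶠ y in 𝓝 p, y ∈ ψ.source := ψ.open_source.mem_nhds hp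
      have ht1 : Tendsto (fun z : ℝ × Y × Y => z.2.1) (𝓝 (0, p, p)) (𝓝 p) :=
        (continuous_fst.comp continuous_snd).continuousAt
      have ht2 : Tendsto (fun z : ℝ × Y × Y => z.2.2) (𝓝 (0, p, p)) (𝓝 p) :=
        (continuous_snd.comp continuous_snd).continuousAt
      have hψp : Tendsto ψ (𝓝 p) (𝓝 (ψ p)) := ψ.continuousAt hp
      have h2 := ((hψp.comp ht1).prodMk_nhds (hψp.comp ht2)).eventually hev
      filter_upwards [h1, h2, ht1.eventually hsrc, ht2.eventually hsrc]
      rintro ⟨η, a, b⟩ hη hab ha hb u hua hub hu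
      simp only [Function.comp_apply] at hη hab ha hb hua hub hu ⊢
      replace hab := hab u
      rw [ψ.left_inv ha, ψ.left_inv hb, ← dist_eq_norm, ← dist_eq_norm, dist_comm _ u,
        dist_comm _ u, hua, hub] at hab
      refine ψ.injOn ha hb (hab (hu.trans hη) le_rfl (Eventually.of_forall fun x => ?_))
      simp only [ψ.left_inv ha, ← dist_eq_norm]
      rw [dist_comm _ u, dist_comm _ u, hua]
      exact Metric.infDist_le_dist_of_mem (mem_range_self _)
    · have hne : 0 < dist (e p) (e p') := dist_pos.2 fun h => hpp (he.injective h)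
      have hc : Continuous fun z : ℝ × Y × Y => dist (e z.2.1) (e z.2.2) - 2 * z.1 := by
        have := he.continuous
        fun_prop
      have h1 := (hc.continuousAt (x := (0, p, p'))).eventually
        (eventually_gt_nhds (b := 0) (by simpa using hne))
      filter_upwards [h1]
      rintro ⟨η, a, b⟩ hη u hua hub hu
      simp only at hη hua hub hu
      have := dist_triangle_left (e a) (e b) u
      linarith
  obtain ⟨ε, hε, hball⟩ := Metric.eventually_nhds_iff_ball.1 hP
  refine ⟨ε / 2, by positivity, ?_⟩
  rintro u _ ⟨a, rfl⟩ _ ⟨b, rfl⟩ ha hb hu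
  exact congrArg e (hball (ε / 2) (by simp [abs_of_pos hε, hε]) (a, b) (mem_univ _) u ha hb hu)

end Reach

section Nearest

open Filter Topology Set

theorem exists_nearestMap {V : Type} [MetricSpace V] {X : Set V} (hX : IsCompact X)
    (hne : X.Nonempty) {δ : ℝ} (h : UniqueNearest X δ) :
    ∃ r : V → V, (∀ u, r u ∈ X) ∧ (∀ u, dist u (r u) = Metric.infDist u X) ∧
      ContinuousOn r {u | Metric.infDist u X < δ} := by
  choose r hrX hr using fun u => hX.exists_infDist_eq_dist hne u
  refine ⟨r, hrX, fun u => (hr u).symm, fun u hu => ContinuousAt.continuousWithinAt ?_⟩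
  refine tendsto_def.2 fun N hN => ?_
  obtain ⟨N', hN', hNo, huN⟩ := mem_nhds_iff.1 hN
  rcases (X \ N').eq_empty_or_nonempty with hK | hK
  · exact Eventually.of_forall fun v => hN' (sdiff_eq_empty.1 hK (hrX v))
  · have hlt : Metric.infDist u X < Metric.infDist u (X \ N') := by
      obtain ⟨b, hb, hbd⟩ := (hX.diff hNo).exists_infDist_eq_dist hK u
      rw [hbd]
      refine lt_of_le_of_ne (Metric.infDist_le_dist_of_mem hb.1) fun he => hb.2 ?_
      rwa [h u b hb.1 (r u) (hrX u) he.symm (hr u).symm hu]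
    have hev := (Metric.continuous_infDist_pt X).continuousAt.eventually_lt
      (Metric.continuous_infDist_pt (X \ N')).continuousAt hlt
    filter_upwards [hev] with v hv
    refine hN' (by_contra fun hn => hv.not_ge ?_)
    rw [hr v]
    exact Metric.infDist_le_dist_of_mem ⟨hrX v, hn⟩

/-- A linear isometry preserving `X` can be deformed inside `X` to a map all of whose almost fixed
points have images fixed by the isometry. -/
theorem exists_deformation {V : Type} [NormedAddCommGroup V] [InnerProductSpace ℝ V]
    [FiniteDimensional ℝ V] {X : Set V} (hX : IsCompact X) {δ : ℝ} (hδ : 0 < δ)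
    (h : UniqueNearest X δ) {r : V → V} (hrX : ∀ u, r u ∈ X)
    (hr : ∀ u, dist u (r u) = Metric.infDist u X)
    (hrc : ContinuousOn r {u | Metric.infDist u X < δ}) (L : V ≃ₗᵢ[ℝ] V) (hL : MapsTo L X X) :
    (∀ u, Metric.infDist u X < δ → L u = u → L (r u) = r u) ∧
    ∃ (H : ℝ → V → V), ContinuousOn (Function.uncurry H) (Icc 0 1 ×ˢ X) ∧
      (∀ t x, H t x ∈ X) ∧ (∀ x ∈ X, H 0 x = L x) ∧ (∀ x ∈ X, L x = x → H 1 x = x) ∧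
      ∃ ε > 0, ∀ x ∈ X, dist (H 1 x) x < ε → L (H 1 x) = H 1 x := by
  have hrfix : ∀ u, Metric.infDist u X < δ → L u = u → L (r u) = r u := by
    intro u hu hLu
    refine h u _ (hL (hrX u)) _ (hrX u) ?_ (hr u) hu
    rw [← hr u]
    nth_rw 1 [← hLu]
    exact L.dist_map _ _
  have hrid : ∀ x ∈ X, r x = x := fun x hx => by
    have h1 := hr x
    rw [Metric.infDist_zero_of_mem hx, dist_eq_zero] at h1
    exact h1.symm
  refine ⟨hrfix, ?_⟩
  let P : Submodule ℝ V := LinearMap.ker ((L.toLinearEquiv : V →ₗ[ℝ] V) - LinearMap.id)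
  have hP : ∀ w, w ∈ P ↔ L w = w := fun w => by
    rw [LinearMap.mem_ker, LinearMap.sub_apply, sub_eq_zero]; rfl
  let p : V →L[ℝ] V := P.starProjection
  have hpP : ∀ x, L (p x) = p x := fun x => (hP _).1 (P.starProjection_apply_mem x)
  let η : ℝ := δ / 3
  have hη : 0 < η := by positivity
  let lam : ℝ → ℝ := fun t => max 0 (min 1 (2 - t / η))
  have hlamc : Continuous lam := by fun_prop
  have hlam0 : ∀ t, 0 ≤ lam t := fun t => le_max_left _ _
  have hlam1 : ∀ t, lam t ≤ 1 := fun t => max_le zero_le_one (min_le_left _ _)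
  let d : V → ℝ := fun x => ‖x - p x‖
  have hdc : Continuous d := by fun_prop
  have hd0 : ∀ x, 0 ≤ d x := fun x => norm_nonneg _
  have hdL : ∀ x, ‖p x - L x‖ = d x := fun x => by
    rw [norm_sub_rev, ← hpP x, ← map_sub, L.norm_map]
  have hlamd : ∀ x, lam (d x) * d x < δ := fun x => by
    rcases le_or_gt (2 * η) (d x) with h2 | h2
    · have : lam (d x) = 0 := max_eq_left ((min_le_right _ _).trans (by
        rw [sub_nonpos, le_div_iff₀ hη]; exact h2))
      simpa [this] using hδ
    · have : 2 * η < δ := by simp only [η]; linarith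
      nlinarith [hlam1 (d x), hd0 x]
  let U : ℝ → V → V := fun s x => L x + (s * lam (d x)) • (p x - L x)
  have hUc : Continuous (Function.uncurry U) := by
    have := L.continuous
    simp only [Function.uncurry_def, U]
    fun_prop
  have hUd : ∀ s ∈ Icc (0 : ℝ) 1, ∀ x, dist (U s x) (L x) ≤ lam (d x) * d x := by
    intro s hs x
    rw [dist_eq_norm, add_sub_cancel_left, norm_smul, hdL, Real.norm_of_nonneg
      (mul_nonneg hs.1 (hlam0 _))]
    exact mul_le_mul_of_nonneg_right (mul_le_of_le_one_left (hlam0 _) hs.2) (hd0 x)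
  have hUW : ∀ s ∈ Icc (0 : ℝ) 1, ∀ x ∈ X, Metric.infDist (U s x) X < δ := fun s hs x hx =>
    ((Metric.infDist_le_dist_of_mem (hL hx)).trans (hUd s hs x)).trans_lt (hlamd x)
  have hHc : ContinuousOn (Function.uncurry fun s x => r (U s x)) (Icc 0 1 ×ˢ X) :=
    hrc.comp hUc.continuousOn fun z hz => hUW z.1 hz.1 z.2 hz.2
  have h1 : (1 : ℝ) ∈ Icc (0 : ℝ) 1 := by simp
  have hfix : ∀ x ∈ X, r (U 1 x) = x → L x = x := by
    intro x hx hxx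
    have h2 := hUd 1 h1 x
    have h3 : dist (U 1 x) x = Metric.infDist (U 1 x) X := by rw [← hr, hxx]
    have h4 := Metric.infDist_le_dist_of_mem (x := U 1 x) (hL hx)
    have h5 : ‖U 1 x - p x‖ = (1 - lam (d x)) * d x := by
      have : U 1 x - p x = -((1 - lam (d x)) • (p x - L x)) := by
        simp only [U]; module
      rw [this, norm_neg, norm_smul, hdL, Real.norm_of_nonneg (sub_nonneg.2 (hlam1 _))]
    have h6 : d x ≤ dist (U 1 x) x + ‖U 1 x - p x‖ := by
      rw [dist_comm, dist_eq_norm]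
      simpa [d] using norm_add_le (x - U 1 x) (U 1 x - p x)
    exact h (U 1 x) _ (hL hx) _ hx (by linarith) h3 (hUW 1 h1 x hx)
  have hLp : ∀ x, L x = x → p x = x := fun x hx =>
    Submodule.starProjection_eq_self_iff.2 ((hP x).2 hx)
  refine ⟨fun s x => r (U s x), hHc, fun t x => hrX _, fun x hx => ?_, fun x hx hLx => ?_, ?_⟩
  · simpa [U] using hrid _ (hL hx)
  · have : U 1 x = x := by simp [U, hLx, hLp x hLx]
    simp only [this, hrid x hx]
  · have hφ : ContinuousOn (fun x => r (U 1 x)) X :=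
      hHc.comp (f := fun x => ((1 : ℝ), x)) (by fun_prop) fun x hx => ⟨h1, hx⟩
    have hK : IsCompact (X ∩ {x | η ≤ d x}) := hX.inter_right (isClosed_le continuous_const hdc)
    obtain ⟨ε, hε, hmin⟩ := hK.exists_forall_le' (f := fun x => dist (r (U 1 x)) x) (a := 0)
      ((continuous_dist.comp_continuousOn (hφ.prodMk continuousOn_id)).mono inter_subset_left)
      fun x hx => dist_pos.2 fun hxx => by
        have h2 := hLp x (hfix x hx.1 hxx)
        have h3 : η ≤ d x := hx.2
        simp only [d, h2, sub_self, norm_zero] at h3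
        linarith
    refine ⟨ε, hε, fun x hx hlt => ?_⟩
    have h2 : d x < η := by
      by_contra hn
      exact (hmin x ⟨hx, not_lt.1 hn⟩).not_gt hlt
    have h3 : lam (d x) = 1 := by
      have : d x / η ≤ 1 := (div_le_one hη).2 h2.le
      simp only [lam]
      rw [min_eq_left (by linarith), max_eq_right zero_le_one]
    have h4 : U 1 x = p x := by simp [U, h3]
    have h5 := hUW 1 h1 x hx
    rw [h4] at h5
    simp only [h4]
    exact hrfix _ h5 (hpP x)

end Nearest

section FixedComponents

open Filter Topology Set

/-- A compact set can be discretised compatibly with finitely many subsets. -/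
theorem exists_discretisation {V : Type} [PseudoMetricSpace V] {X : Set V} (hX : IsCompact X)
    {S : Set (Set V)} (hS : S.Finite) {ε : ℝ} (hε : 0 < ε) :
    ∃ q : V → V, MapsTo q X X ∧ (q '' X).Finite ∧ (∀ x ∈ X, dist (q x) x < ε) ∧
      ∀ C ∈ S, C ⊆ X → MapsTo q C C := by
  obtain ⟨t, -, htf, ht⟩ := hX.finite_cover_balls (half_pos hε)
  have hc : ∀ x, ∃ c, x ∈ X → c ∈ t ∧ dist x c < ε / 2 := fun x => by
    by_cases hx : x ∈ X
    · obtain ⟨c, hc, hxc⟩ := mem_iUnion₂.1 (ht hx)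
      exact ⟨c, fun _ => ⟨hc, hxc⟩⟩
    · exact ⟨x, fun h => absurd h hx⟩
  choose c hc using hc
  let ℓ : V → V × Set (Set V) := fun x => (c x, {C ∈ S | x ∈ C})
  have hQ : ∀ z, ∃ y, z ∈ ℓ '' X → y ∈ X ∧ ℓ y = z := fun z => by
    by_cases hz : z ∈ ℓ '' X
    · obtain ⟨y, hy⟩ := hz
      exact ⟨y, fun _ => hy⟩
    · exact ⟨z.1, fun h => absurd h hz⟩
  choose Q hQ using hQ
  have hq : ∀ x ∈ X, Q (ℓ x) ∈ X ∧ ℓ (Q (ℓ x)) = ℓ x := fun x hx => hQ _ ⟨x, hx, rfl⟩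
  refine ⟨fun x => Q (ℓ x), fun x hx => (hq x hx).1, ?_, fun x hx => ?_, fun C hC hCX x hx => ?_⟩
  · refine ((htf.prod hS.powerset).image Q).subset ?_
    rintro _ ⟨x, hx, rfl⟩
    exact ⟨ℓ x, ⟨(hc x hx).1, sep_subset _ _⟩, rfl⟩
  · obtain ⟨h1, h2⟩ := hq x hx
    have h3 : c (Q (ℓ x)) = c x := congrArg Prod.fst h2
    have h4 := (hc _ h1).2
    rw [h3] at h4
    have := dist_triangle_right (Q (ℓ x)) x (c x)
    linarith [(hc x hx).2]
  · have h3 : {C ∈ S | Q (ℓ x) ∈ C} = {C ∈ S | x ∈ C} := congrArg Prod.snd (hq x (hCX hx)).2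
    have h4 : C ∈ {C ∈ S | Q (ℓ x) ∈ C} := h3 ▸ ⟨hC, hx⟩
    exact h4.2

theorem homologyOfMap_singMap_id {Y : Type} [TopologicalSpace Y] {X : Set Y}
    (hc : ContinuousOn (fun x : Y => x) X) (hm : MapsTo (fun x : Y => x) X X) (n : ℕ) :
    homologyOfMap (isSubcomplexMap_singMap hc hm) n = LinearMap.id := by
  rw [homologyOfMap_eq_of_eqOn (isSubcomplexMap_singMap hc hm)
    (isSubcomplexMap_id fun _ => le_rfl) fun n x _ => ?_]
  · exact homologyOfMap_id _ n
  · exact Finsupp.mapDomain_id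

theorem eulerChar_eq_finsum_fixed {V Y : Type} [NormedAddCommGroup V] [InnerProductSpace ℝ V]
    [FiniteDimensional ℝ V] [TopologicalSpace Y] [CompactSpace Y] {e : Y → V}
    (he : IsEmbedding e) {δ : ℝ} (hδ : 0 < δ) (hun : UniqueNearest (range e) δ)
    (L : V ≃ₗᵢ[ℝ] V) {f : Y → Y} (hLf : ∀ y, L (e y) = e (f y)) (Hf : ℝ → Y → Y)
    (hHf : Continuous (Function.uncurry Hf)) (h0 : ∀ y, Hf 0 y = y) (h1 : ∀ y, Hf 1 y = f y)
    (F : Set Y) (hF : ∀ y, y ∈ F ↔ f y = y) (hne : F.Nonempty) :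
    eulerChar Y = ∑ᶠ C ∈ {C : Set Y | ∃ p ∈ F, C = connectedComponentIn F p}, eulerChar ↥C := by
  have hXc : IsCompact (range e) := isCompact_range he.continuous
  have hne' : Nonempty Y := ⟨hne.some⟩
  obtain ⟨r, hrX, hr, hrc⟩ := exists_nearestMap hXc (range_nonempty e) hun
  have hLX : MapsTo L (range e) (range e) := by
    rintro _ ⟨y, rfl⟩
    exact ⟨f y, (hLf y).symm⟩
  obtain ⟨hrfix, H, hHc, hHX, hH0, hHfix, ε₀, hε₀, hH1⟩ :=
    exists_deformation hXc hδ hun hrX hr hrc L hLX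
  have hrid : ∀ x ∈ range e, r x = x := fun x hx => by
    have h1 := hr x
    rw [Metric.infDist_zero_of_mem hx, dist_eq_zero] at h1
    exact h1.symm
  have hFL : ∀ y, y ∈ F ↔ L (e y) = e y := fun y => by rw [hF, hLf, he.injective.eq_iff]
  obtain ⟨ε, hε, hεδ, hεε⟩ : ∃ ε > 0, 3 * ε < δ ∧ 7 * ε < ε₀ :=
    ⟨min δ ε₀ / 10, by positivity, by linarith [min_le_left δ ε₀, lt_min hδ hε₀],
      by linarith [min_le_right δ ε₀, lt_min hδ hε₀]⟩
  have hball : ∀ s : Set V, (∀ x ∈ s, ∀ y ∈ s, dist x y < 3 * ε) → ∀ u ∈ convexHull ℝ s,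
      ∀ x ∈ s, dist u x < 3 * ε := fun s hs u hu x hx =>
    convexHull_min (fun y hy => hs y hy x hx) (convex_ball x (3 * ε)) hu
  have hW : ∀ s ⊆ range e, (∀ x ∈ s, ∀ y ∈ s, dist x y < 3 * ε) → ∀ u ∈ convexHull ℝ s,
      Metric.infDist u (range e) < 3 * ε := fun s hsX hs u hu => by
    obtain ⟨x, hx⟩ := convexHull_nonempty_iff.1 ⟨u, hu⟩
    exact (Metric.infDist_le_dist_of_mem (hsX hx)).trans_lt (hball s hs u hu x hx)
  have hglue : ∀ s ⊆ e '' F, (∀ x ∈ s, ∀ y ∈ s, dist x y < 3 * ε) → ∀ x₀, e x₀ ∈ s →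
      ∀ u ∈ convexHull ℝ s, r u ∈ e '' connectedComponentIn F x₀ := by
    intro s hsF hs x₀ hx₀ u hu
    have hsX : s ⊆ range e := hsF.trans (image_subset_range _ _)
    have hfix : ∀ v ∈ convexHull ℝ s, L v = v := by
      have hP : s ⊆ (LinearMap.ker ((L.toLinearEquiv : V →ₗ[ℝ] V) - LinearMap.id) : Set V) := by
        intro v hv
        obtain ⟨y, hy, rfl⟩ := hsF hv
        simpa [sub_eq_zero] using (hFL y).1 hy
      intro v hv
      simpa [sub_eq_zero] using convexHull_min hP (Submodule.convex _) hv
    have hWδ : ∀ v ∈ convexHull ℝ s, Metric.infDist v (range e) < δ := fun v hv =>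
      (hW s hsX hs v hv).trans hεδ
    have hpre : IsPreconnected (r '' convexHull ℝ s) :=
      (convex_convexHull ℝ s).isPreconnected.image r (hrc.mono hWδ)
    have himg : e '' (e ⁻¹' (r '' convexHull ℝ s)) = r '' convexHull ℝ s :=
      image_preimage_eq_of_subset (image_subset_iff.2 fun v _ => hrX v)
    rw [← himg, he.isInducing.isPreconnected_image] at hpre
    have hsub := hpre.subset_connectedComponentIn (F := F) (x := x₀)
      ⟨e x₀, subset_convexHull ℝ s hx₀, hrid _ (mem_range_self _)⟩ (by
        rintro y ⟨v, hv, hvy⟩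
        rw [hFL, ← hvy]
        exact hrfix v (hWδ v hv) (hfix v hv))
    obtain ⟨y, hy⟩ := hrX u
    exact ⟨y, hsub ⟨u, hu, hy.symm⟩, hy⟩
  have hnear : ∀ x ∈ F, ∀ y ∈ F, dist (e x) (e y) < 3 * ε →
      connectedComponentIn F x = connectedComponentIn F y := by
    intro x hx y hy hxy
    have hy' : e y ∈ ({e x, e y} : Set V) := by simp
    obtain ⟨z, hz, hzy⟩ := hglue {e x, e y} (by
        rintro _ (rfl | rfl); exacts [mem_image_of_mem e hx, mem_image_of_mem e hy]) (by
        have h3 : 0 < 3 * ε := by positivity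
        rintro _ (rfl | rfl) _ (rfl | rfl)
        · simpa using h3
        · exact hxy
        · rwa [dist_comm]
        · simpa using h3) x (by simp) (e y) (subset_convexHull ℝ _ hy')
    rw [hrid _ (mem_range_self y)] at hzy
    exact connectedComponentIn_eq (he.injective hzy ▸ hz)
  let S : Set (Set Y) := {C : Set Y | ∃ p ∈ F, C = connectedComponentIn F p}
  have hS : S.Finite := by
    have hcl : IsClosed F := by
      have : F = {y | L (e y) = e y} := Set.ext hFL
      rw [this]
      exact isClosed_eq (L.continuous.comp he.continuous) he.continuous
    have : CompactSpace F := isCompact_iff_compactSpace.1 hcl.isCompact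
    have hlc : IsLocallyConstant fun x : F => connectedComponentIn F (x : Y) := by
      refine IsLocallyConstant.iff_eventually_eq _ |>.2 fun x => ?_
      have hcont : Continuous fun y : F => dist (e y) (e x) := by
        have := he.continuous
        fun_prop
      filter_upwards [hcont.continuousAt.eventually (eventually_lt_nhds (b := 3 * ε)
        (by simpa using hε))] with y hy
      exact hnear y y.2 x x.2 hy
    refine hlc.range_finite.subset ?_
    rintro _ ⟨p, hp, rfl⟩
    exact ⟨⟨p, hp⟩, rfl⟩
  have hSF : ∀ C ∈ S, C ⊆ F := by
    rintro _ ⟨p, -, rfl⟩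
    exact connectedComponentIn_subset F p
  have hSx : ∀ C ∈ S, ∀ x ∈ C, C = connectedComponentIn F x := by
    rintro _ ⟨p, -, rfl⟩ x hx
    exact connectedComponentIn_eq hx
  obtain ⟨q, hqX, hqf, hqd, hqC⟩ := exists_discretisation hXc (hS.image (image e)) hε
  have hone : (1 : ℝ) ∈ Icc (0 : ℝ) 1 := by simp
  have hφ : ContinuousOn (H 1) (range e) :=
    hHc.comp (f := fun x => ((1 : ℝ), x)) (by fun_prop) fun x hx => ⟨hone, hx⟩
  have hφF : ∀ y ∈ F, H 1 (e y) = e y := fun y hy => hHfix _ (mem_range_self y) ((hFL y).1 hy)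
  have hApX : IsApprox r q (H 1) {u | Metric.infDist u (range e) < δ} (range e) ε :=
    { pos := hε
      q_maps := hqX
      q_fin := hqf
      q_dist := hqd
      r_eq := hrid
      r_cont := hrc
      hull := fun s hs hs' u hu => ⟨(hW s hs hs' u hu).trans hεδ, hrX u⟩
      φ_cont := hφ
      φ_maps := fun x _ => hHX 1 x
      φ_hom := fun n => by
        have hinv : ContinuousOn (Function.invFun e) (range e) := by
          rw [he.isInducing.continuousOn_iff]
          refine continuousOn_id.congr ?_
          rintro _ ⟨y, rfl⟩
          exact congrArg e (Function.leftInverse_invFun he.injective y)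
        have hl := Function.leftInverse_invFun he.injective
        refine (homologyOfMap_singMap_eq L.continuous.continuousOn hLX hφ (fun x _ => hHX 1 x) H hHc
          (fun t _ x _ => hHX t x) hH0 (fun _ _ => rfl) n).symm.trans
          ((homologyOfMap_singMap_eq (φ := fun x => x) continuousOn_id (mapsTo_id (range e))
            L.continuous.continuousOn hLX (fun t x => e (Hf t (Function.invFun e x))) ?_
            (fun t _ x _ => mem_range_self _) ?_ ?_ n).symm.trans
            (homologyOfMap_singMap_id continuousOn_id (mapsTo_id (range e)) n))
        · refine he.continuous.comp_continuousOn (hHf.comp_continuousOn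
            (f := fun z : ℝ × V => (z.1, Function.invFun e z.2)) ?_)
          exact continuousOn_fst.prodMk (hinv.comp continuousOn_snd fun z hz => hz.2)
        · rintro _ ⟨y, rfl⟩
          simp only [hl y, h0]
        · rintro _ ⟨y, rfl⟩
          simp only [hl y, h1, hLf] }
  have hApC : ∀ i : S, IsApprox r q (H 1) {u | Metric.infDist u (range e) < δ} (e '' i.1) ε :=
    fun i => by
    have hid : EqOn (H 1) id (e '' i.1) := by
      rintro _ ⟨y, hy, rfl⟩
      exact hφF y (hSF i.1 i.2 hy)
    have hsub : e '' i.1 ⊆ range e := image_subset_range _ _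
    have hmaps : MapsTo (H 1) (e '' i.1) (e '' i.1) := fun x hx => by rwa [hid hx]
    exact
    { pos := hε
      q_maps := hqC _ (mem_image_of_mem _ i.2) hsub
      q_fin := hqf.subset (image_mono hsub)
      q_dist := fun x hx => hqd x (hsub hx)
      r_eq := fun x hx => hrid x (hsub hx)
      r_cont := hrc
      hull := fun s hs hs' u hu => by
        refine ⟨(hW s (hs.trans hsub) hs' u hu).trans hεδ, ?_⟩
        obtain ⟨_, hx⟩ := convexHull_nonempty_iff.1 ⟨u, hu⟩
        obtain ⟨x, hxi, rfl⟩ := hs hx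
        rw [hSx i.1 i.2 x hxi]
        exact hglue s (hs.trans (image_mono (hSF i.1 i.2))) hs' x hx u hu
      φ_cont := hφ.mono hsub
      φ_maps := hmaps
      φ_hom := fun n => by
        exact (homologyOfMap_singMap_eq (ψ := fun x => x) (hφ.mono hsub) hmaps continuousOn_id
          (mapsTo_id _) (fun _ x => x) continuousOn_snd (fun _ _ => mapsTo_id _)
          (fun x hx => (hid hx).symm) (fun _ _ => rfl) n).trans
          (homologyOfMap_singMap_id continuousOn_id (mapsTo_id _) n) }
  have hfin : Finite S := hS
  rw [eulerChar_eq_finsum he (fun i : S => i.1) hApX hApC]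
  · exact finsum_set_coe_eq_finsum_mem (f := fun C : Set Y => eulerChar ↥C) S
  · intro i j x hx y hy hxy
    refine Subtype.ext ?_
    rw [hSx i.1 i.2 x hx, hSx j.1 j.2 y hy]
    exact hnear x (hSF _ i.2 hx) y (hSF _ j.2 hy) hxy
  · intro s hs hs' u hu hqs
    have h2 := hball s hs' u hu _ hqs
    have h3 := hqd _ (hHX 1 (r u))
    have h4 := (hr u).trans_lt (hW s hs hs' u hu)
    have h5 := hH1 (r u) (hrX u) (by
      rw [dist_comm] at h3 h2
      have h6 := dist_triangle (H 1 (r u)) (q (H 1 (r u))) (r u)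
      have h7 := dist_triangle (q (H 1 (r u))) u (r u)
      linarith)
    obtain ⟨y, hy⟩ := hHX 1 (r u)
    have hyF : y ∈ F := (hFL y).2 (by rw [hy, h5])
    exact ⟨⟨connectedComponentIn F y, y, hyF, rfl⟩, y, mem_connectedComponentIn hyF, hy⟩

end FixedComponents

section Stabilization

open Filter Topology Set

theorem Submodule.le_of_eventually_mem {E : Type} [NormedAddCommGroup E] [NormedSpace ℝ E]
    {W W' : Submodule ℝ E} {y : E} (hy : y ∈ W) (h : ∀ᶠ z in 𝓝 y, z ∈ W → z ∈ W') : W ≤ W' := by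
  intro w hw
  have hy' : y ∈ W' := h.self_of_nhds hy
  have hc : Continuous fun t : ℝ => y + t • w := by fun_prop
  have ht : Tendsto (fun t : ℝ => y + t • w) (𝓝 0) (𝓝 y) := by
    have := hc.tendsto 0
    rwa [zero_smul, add_zero] at this
  obtain ⟨t, ht, ht0⟩ := ((ht.eventually h).filter_mono nhdsWithin_le_nhds |>.and
    (self_mem_nhdsWithin : {0}ᶜ ∈ 𝓝[≠] (0 : ℝ))).exists
  have h1 := ht (W.add_mem hy (W.smul_mem t hw))
  exact (W'.smul_mem_iff ht0).1 ((W'.add_mem_iff_right hy').1 h1)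

/-- A decreasing sequence of closed subsets of a compact space which locally look like linear
subspaces is eventually constant. -/
theorem exists_subset_iInter_of_locally_linear {M E : Type} [TopologicalSpace M] [CompactSpace M]
    [NormedAddCommGroup E] [NormedSpace ℝ E] [FiniteDimensional ℝ E] {A : ℕ → Set M}
    (hA : Antitone A) (hcl : ∀ k, IsClosed (A k))
    (hlin : ∀ N, ∀ q ∈ A N, ∃ Φ : OpenPartialHomeomorph M E, q ∈ Φ.source ∧
      ∀ k ≤ N, ∃ W : Submodule ℝ E, ∀ x ∈ Φ.source, x ∈ A k ↔ Φ x ∈ W) :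
    ∃ K, A K ⊆ ⋂ k, A k := by
  have hprop : ∀ N, ∀ q ∈ A N, ∃ U ∈ 𝓝 q, ∀ k ≤ N, ∀ q' ∈ U, q' ∈ A k →
      (∀ᶠ x in 𝓝 q', x ∈ A k → x ∈ A N) → ∀ x ∈ U, x ∈ A k → x ∈ A N := by
    intro N q hq
    obtain ⟨Φ, hqΦ, hΦ⟩ := hlin N q hq
    refine ⟨Φ.source, Φ.open_source.mem_nhds hqΦ, fun k hk q' hq' hqk hev => ?_⟩
    obtain ⟨W, hW⟩ := hΦ k hk
    obtain ⟨W', hW'⟩ := hΦ N le_rfl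
    have hle : W ≤ W' := by
      refine Submodule.le_of_eventually_mem ((hW q' hq').1 hqk) ?_
      have ht := (Φ.continuousAt_symm (Φ.map_source hq')).tendsto
      rw [Φ.left_inv hq'] at ht
      filter_upwards [ht.eventually hev, Φ.open_target.mem_nhds (Φ.map_source hq')] with z hz hzt
      have hzs := Φ.map_target hzt
      rw [hW _ hzs, hW' _ hzs, Φ.right_inv hzt] at hz
      exact hz
    exact fun x hx hxk => (hW' x hx).2 (hle ((hW x hx).1 hxk))
  have hlocal : ∀ p, ∃ K, ∀ᶠ x in 𝓝 p, x ∈ A K → x ∈ ⋂ k, A k := by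
    intro p
    by_cases hp : ∀ k, p ∈ A k
    swap
    · obtain ⟨k, hk⟩ := not_forall.1 hp
      refine ⟨k, ?_⟩
      filter_upwards [(hcl k).isOpen_compl.mem_nhds hk] with x hx hxk
      exact absurd hxk hx
    obtain ⟨K, hK⟩ : ∃ K, ∀ k, K ≤ k → ∀ᶠ x in 𝓝 p, x ∈ A K → x ∈ A k := by
      by_contra! hcon
      choose nxt hle hnxt using hcon
      let g : ℕ → ℕ := fun i => nxt^[i] 0
      have hg : ∀ i, g (i + 1) = nxt (g i) := fun i => Function.iterate_succ_apply' nxt i 0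
      have hgm : Monotone g := monotone_nat_of_le_succ fun i => hg i ▸ hle _
      let n := Module.finrank ℝ E
      obtain ⟨Φ, hpΦ, hΦ⟩ := hlin (g (n + 1)) p (hp _)
      choose! W hW using hΦ
      have hlt : ∀ i ≤ n, W (g (i + 1)) < W (g i) := by
        intro i hi
        have h1 : ∀ x ∈ Φ.source, x ∈ A (g i) ↔ Φ x ∈ W (g i) := hW _ (hgm (by omega))
        have h2 : ∀ x ∈ Φ.source, x ∈ A (g (i + 1)) ↔ Φ x ∈ W (g (i + 1)) :=
          hW _ (hgm (by omega))
        refine lt_of_le_not_ge ?_ fun hge => hnxt (g i) ?_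
        · refine Submodule.le_of_eventually_mem ((h2 p hpΦ).1 (hp _)) ?_
          filter_upwards [Φ.open_target.mem_nhds (Φ.map_source hpΦ)] with z hz hzW
          have hzs := Φ.map_target hz
          rw [← Φ.right_inv hz, ← h1 _ hzs]
          refine hA (hgm (Nat.le_succ i)) ((h2 _ hzs).2 ?_)
          rwa [Φ.right_inv hz]
        · filter_upwards [Φ.open_source.mem_nhds hpΦ] with x hx hxi
          exact hxi.2 (hg i ▸ (h2 x hx).2 (hge ((h1 x hx).1 hxi.1)))
      have hrank : ∀ i ≤ n + 1, Module.finrank ℝ (W (g i)) + i ≤ n := by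
        intro i
        induction i with
        | zero => exact fun _ => Submodule.finrank_le _
        | succ i ih =>
          intro hi
          have := Submodule.finrank_lt_finrank_of_lt (hlt i (by omega))
          have := ih (by omega)
          omega
      have := hrank (n + 1) le_rfl
      omega
    refine ⟨K, ?_⟩
    obtain ⟨Φ, hpΦ, hΦ⟩ := hlin K p (hp K)
    obtain ⟨W, hW⟩ := hΦ K le_rfl
    obtain ⟨ρ, hρ, hball⟩ := Metric.isOpen_iff.1 Φ.open_target _ (Φ.map_source hpΦ)
    let C : Set M := Φ.symm '' (W ∩ Metric.ball (Φ p) ρ)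
    have hpre : IsPreconnected C :=
      (W.convex.inter (convex_ball _ _)).isPreconnected.image _
        (Φ.continuousOn_symm.mono (inter_subset_right.trans hball))
    have hpC : p ∈ C := ⟨Φ p, ⟨(hW p hpΦ).1 (hp K), Metric.mem_ball_self hρ⟩, Φ.left_inv hpΦ⟩
    have hCK : ∀ x ∈ C, x ∈ A K := by
      rintro _ ⟨z, ⟨hzW, hz⟩, rfl⟩
      rw [hW _ (Φ.map_target (hball hz)), Φ.right_inv (hball hz)]
      exact hzW
    have hCk : ∀ k, K ≤ k → ∀ x ∈ C, x ∈ A k := by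
      intro k hk x hx
      let O : Set M := {q | ∀ᶠ x in 𝓝 q, x ∈ A K → x ∈ A k}
      have hO : IsOpen O := isOpen_setOfPred_eventually_nhds
      have hiff : p ∈ O ↔ x ∈ O := by
        refine hpre.induction₂ (fun x y => x ∈ O ↔ y ∈ O) (fun q hq => ?_)
          (fun _ _ _ _ _ _ => Iff.trans) (fun _ _ _ _ => Iff.symm) hpC hx
        by_cases hqO : q ∈ O
        · filter_upwards [nhdsWithin_le_nhds (hO.mem_nhds hqO)] with y hy
          exact iff_of_true hqO hy
        by_cases hqk : q ∈ A k
        · obtain ⟨U, hU, hUk⟩ := hprop k q hqk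
          filter_upwards [nhdsWithin_le_nhds hU, self_mem_nhdsWithin] with y hyU hyC
          refine iff_of_false hqO fun hyO => hqO ?_
          filter_upwards [hU] with z hz
          exact hUk K hk y hyU (hCK y hyC) hyO z hz
        · filter_upwards [nhdsWithin_le_nhds ((hcl k).isOpen_compl.mem_nhds hqk),
            self_mem_nhdsWithin] with y hy hyC
          exact iff_of_false hqO fun hyO => hy (hyO.self_of_nhds (hCK y hyC))
      exact (hiff.1 (hK k hk)).self_of_nhds (hCK x hx)
    filter_upwards [Φ.open_source.mem_nhds hpΦ,
      (Φ.continuousAt hpΦ).preimage_mem_nhds (Metric.ball_mem_nhds _ hρ)] with x hx hxb hxK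
    have hxC : x ∈ C := ⟨Φ x, ⟨(hW x hx).1 hxK, hxb⟩, Φ.left_inv hx⟩
    refine mem_iInter.2 fun k => ?_
    rcases le_total K k with h | h
    · exact hCk k h x hxC
    · exact hA h hxK
  have hind := isCompact_univ.induction_on (X := M)
    (p := fun s => ∃ K, ∀ x ∈ s, x ∈ A K → x ∈ ⋂ k, A k) ⟨0, by simp⟩
    (fun s t hst ⟨K, hK⟩ => ⟨K, fun x hx => hK x (hst hx)⟩)
    (fun s t ⟨K, hK⟩ ⟨K', hK'⟩ => ⟨max K K', fun x hx hxA => hx.elim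
      (fun hx => hK x hx (hA (le_max_left _ _) hxA))
      (fun hx => hK' x hx (hA (le_max_right _ _) hxA))⟩)
    (fun p _ => by
      obtain ⟨K, hK⟩ := hlocal p
      exact ⟨_, nhdsWithin_le_nhds hK, K, fun x hx => hx⟩)
  obtain ⟨K, hK⟩ := hind
  exact ⟨K, fun x hx => hK x (mem_univ x) hx⟩

end Stabilization

section Linearization

open Filter Topology Set

/-- A homeomorphism of finite order is linear in suitable coordinates around a fixed point near
which it is differentiable. -/
theorem exists_linearization {M E : Type} [TopologicalSpace M] [NormedAddCommGroup E]
    [NormedSpace ℝ E] [FiniteDimensional ℝ E] {f : M → M} (hf : Continuous f) {m : ℕ} (hm : 0 < m)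
    (hfm : ∀ x, f^[m] x = x) {q : M} (hq : f q = q) (ψ : OpenPartialHomeomorph M E)
    (hqψ : q ∈ ψ.source) (hdiff : ContDiffAt ℝ 1 (ψ ∘ f ∘ ψ.symm) (ψ q)) :
    ∃ Φ : OpenPartialHomeomorph M E, q ∈ Φ.source ∧
      ∀ j, ∃ W : Submodule ℝ E, ∀ x ∈ Φ.source, f^[j] x = x ↔ Φ x ∈ W := by
  have hqi : ∀ i, f^[i] q = q := fun i => Function.iterate_fixed hq i
  have hsymm : Tendsto ψ.symm (𝓝 (ψ q)) (𝓝 q) := by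
    have := (ψ.continuousAt_symm (ψ.map_source hqψ)).tendsto
    rwa [ψ.left_inv hqψ] at this
  have hit : ∀ i, Tendsto (f^[i]) (𝓝 q) (𝓝 q) := fun i => by
    have := (hf.iterate i).tendsto q
    rwa [hqi] at this
  let L : E →L[ℝ] E := fderiv ℝ (ψ ∘ f ∘ ψ.symm) (ψ q)
  have hL : HasStrictFDerivAt (ψ ∘ f ∘ ψ.symm) L (ψ q) := hdiff.hasStrictFDerivAt (by norm_num)
  have hder : ∀ i, HasStrictFDerivAt (ψ ∘ f^[i] ∘ ψ.symm) (L ^ i) (ψ q) := by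
    intro i
    induction i with
    | zero =>
      refine (hasStrictFDerivAt_id (ψ q)).congr_of_eventuallyEq ?_
      filter_upwards [ψ.open_target.mem_nhds (ψ.map_source hqψ)] with y hy
      exact (ψ.right_inv hy).symm
    | succ i ih =>
      have hval : (ψ ∘ f^[i] ∘ ψ.symm) (ψ q) = ψ q := by
        simp [ψ.left_inv hqψ, hqi]
      have hL' : HasStrictFDerivAt (ψ ∘ f ∘ ψ.symm) L ((ψ ∘ f^[i] ∘ ψ.symm) (ψ q)) := by
        rwa [hval]
      rw [pow_succ']
      refine (hL'.comp (ψ q) ih).congr_of_eventuallyEq ?_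
      filter_upwards [((hit i).comp hsymm).eventually (ψ.open_source.mem_nhds hqψ)] with y hy
      simp only [Function.comp_apply] at hy
      simp only [Function.comp_apply, ψ.left_inv hy, Function.iterate_succ_apply']
  have hLm : L ^ m = 1 := by
    refine (hder m).hasFDerivAt.unique ?_
    refine (hasFDerivAt_id (ψ q)).congr_of_eventuallyEq ?_
    filter_upwards [ψ.open_target.mem_nhds (ψ.map_source hqψ)] with y hy
    simp [hfm, ψ.right_inv hy]
  let Ψ : M → E := fun x => ∑ i ∈ Finset.range m, (L ^ (m - i)) (ψ (f^[i] x))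
  have hΨf : ∀ x, Ψ (f x) = L (Ψ x) := by
    intro x
    have h1 : Ψ (f x) = ∑ i ∈ Finset.range m, (L ^ (m - (i + 1) + 1)) (ψ (f^[i + 1] x)) := by
      refine Finset.sum_congr rfl fun i hi => ?_
      rw [Finset.mem_range] at hi
      rw [show m - (i + 1) + 1 = m - i by omega, Function.iterate_succ_apply]
    have h2 : L (Ψ x) = ∑ i ∈ Finset.range m, (L ^ (m - i + 1)) (ψ (f^[i] x)) := by
      simp only [Ψ, map_sum, pow_succ']
      rfl
    rw [h1, h2]
    have h3 := Finset.sum_range_succ (fun i => (L ^ (m - i + 1)) (ψ (f^[i] x))) m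
    rw [Finset.sum_range_succ'] at h3
    simpa [hfm, pow_succ, hLm] using h3
  have hΨj : ∀ j x, Ψ (f^[j] x) = (L ^ j) (Ψ x) := by
    intro j x
    induction j with
    | zero => rfl
    | succ j ih => rw [Function.iterate_succ_apply', hΨf, ih, pow_succ']; rfl
  have hΨd : HasStrictFDerivAt (Ψ ∘ ψ.symm) ((ContinuousLinearEquiv.smulLeft
      (Units.mk0 (m : ℝ) (by positivity)) : E ≃L[ℝ] E) : E →L[ℝ] E) (ψ q) := by
    have h1 : HasStrictFDerivAt (Ψ ∘ ψ.symm)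
        (∑ i ∈ Finset.range m, (L ^ (m - i)) ∘L (L ^ i)) (ψ q) := by
      have := HasStrictFDerivAt.fun_sum (u := Finset.range m)
        fun i _ => (L ^ (m - i)).hasStrictFDerivAt.comp (ψ q) (hder i)
      exact this
    convert h1 using 1
    have h2 : ∀ i ∈ Finset.range m, (L ^ (m - i)) ∘L (L ^ i) = 1 := fun i hi => by
      rw [Finset.mem_range] at hi
      have : (L ^ (m - i)) ∘L (L ^ i) = L ^ (m - i) * L ^ i := rfl
      rw [this, ← pow_add, Nat.sub_add_cancel hi.le, hLm]
    rw [Finset.sum_congr rfl h2]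
    ext v
    simp [Units.smul_def, Nat.cast_smul_eq_nsmul]
  let Φ₀ := ψ.trans (hΨd.toOpenPartialHomeomorph _)
  have hqΦ₀ : q ∈ Φ₀.source := by
    rw [OpenPartialHomeomorph.trans_source]
    exact ⟨hqψ, hΨd.mem_toOpenPartialHomeomorph_source⟩
  have hΦ₀ : ∀ x ∈ Φ₀.source, Φ₀ x = Ψ x := by
    intro x hx
    rw [OpenPartialHomeomorph.trans_source] at hx
    change Ψ (ψ.symm (ψ x)) = Ψ x
    rw [ψ.left_inv hx.1]
  let S : Set M := ⋂ i ∈ Finset.range m, f^[i] ⁻¹' Φ₀.source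
  have hS : IsOpen S := isOpen_biInter_finset fun i _ => Φ₀.open_source.preimage (hf.iterate i)
  have hSj : ∀ x ∈ S, ∀ j, f^[j] x ∈ Φ₀.source := by
    intro x hx j
    have hper : Function.IsPeriodicPt f m x := hfm x
    rw [← hper.iterate_mod_apply]
    exact mem_iInter₂.1 hx _ (Finset.mem_range.2 (Nat.mod_lt _ hm))
  refine ⟨Φ₀.restrOpen S hS, ?_, fun j => ⟨LinearMap.ker ((L ^ j - 1 : E →L[ℝ] E) : E →ₗ[ℝ] E),
    fun x hx => ?_⟩⟩
  · rw [OpenPartialHomeomorph.restrOpen_source]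
    exact ⟨hqΦ₀, mem_iInter₂.2 fun i _ => by simpa [hqi] using hqΦ₀⟩
  · rw [OpenPartialHomeomorph.restrOpen_source] at hx
    change _ ↔ Φ₀ x ∈ _
    rw [← Φ₀.injOn.eq_iff (hSj x hx.2 j) hx.1, hΦ₀ x hx.1, hΦ₀ _ (hSj x hx.2 j), hΨj,
      LinearMap.mem_ker]
    exact sub_eq_zero.symm

end Linearization

section Torus

open Filter Topology Set

/-- The point of the circle of angle `2 * π * x`. -/
def circleTurn (x : ℝ) : Circle := Circle.exp (2 * Real.pi * x)

theorem continuous_circleTurn : Continuous circleTurn := by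
  unfold circleTurn
  fun_prop

theorem circleTurn_pow (x : ℝ) (k : ℕ) : circleTurn x ^ k = circleTurn (k * x) := by
  induction k with
  | zero => simp [circleTurn]
  | succ k ih =>
    rw [pow_succ, ih, circleTurn, circleTurn, circleTurn, ← Circle.exp_add]
    congr 1
    push_cast
    ring

theorem circleTurn_natCast (k : ℕ) : circleTurn k = 1 := by
  rw [← mul_one (k : ℝ), ← circleTurn_pow, circleTurn, mul_one, Circle.exp_two_pi, one_pow]

theorem exists_circleTurn_eq (z : Circle) : ∃ x : ℝ, 0 ≤ x ∧ circleTurn x = z := by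
  have hpi := Real.pi_pos
  refine ⟨(Complex.arg z + 2 * Real.pi) / (2 * Real.pi), ?_, ?_⟩
  · have := Complex.neg_pi_lt_arg (z : ℂ)
    apply div_nonneg <;> linarith
  · rw [circleTurn, mul_div_cancel₀ _ (by positivity), Circle.exp_add, Circle.exp_two_pi, mul_one,
      Circle.exp_arg]

/-- The element of the torus whose `i`-th coordinate is a primitive `p ^ k`-th root of unity, `p`
being the `i`-th prime number. -/
def torusRoot (l k : ℕ) : Fin l → Circle := fun i => circleTurn (1 / (Nat.nth Nat.Prime i : ℝ) ^ k)

theorem nthPrime_prime (i : ℕ) : (Nat.nth Nat.Prime i).Prime :=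
  Nat.nth_mem_of_infinite Nat.infinite_setOfPred_prime i

theorem circleTurn_pow_eq_one {p k N : ℕ} (hp : 0 < p) (h : p ^ k ∣ N) :
    circleTurn (1 / (p : ℝ) ^ k) ^ N = 1 := by
  obtain ⟨c, rfl⟩ := h
  rw [pow_mul, circleTurn_pow]
  have : ((p ^ k : ℕ) : ℝ) * (1 / (p : ℝ) ^ k) = (1 : ℕ) := by
    push_cast
    field_simp
  rw [this, circleTurn_natCast, one_pow]

theorem torusRoot_pow_eq_one (l k : ℕ) :
    torusRoot l k ^ (∏ i : Fin l, Nat.nth Nat.Prime i ^ k) = 1 := by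
  funext i
  exact circleTurn_pow_eq_one (nthPrime_prime i).pos
    (Finset.dvd_prod_of_mem (fun i : Fin l => Nat.nth Nat.Prime i ^ k) (Finset.mem_univ i))

theorem mulSingle_mem_powers_torusRoot (l k : ℕ) (i : Fin l) :
    Pi.mulSingle i (torusRoot l k i) ∈ Submonoid.powers (torusRoot l k) := by
  let N : ℕ := ∏ j ∈ Finset.univ.erase i, Nat.nth Nat.Prime (j : Fin l) ^ k
  let p : ℕ := Nat.nth Nat.Prime i
  have hp : p.Prime := nthPrime_prime i
  have hcop : Nat.Coprime N (p ^ k) := by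
    refine Nat.Coprime.prod_left fun j hj => Nat.Coprime.pow _ _ ?_
    refine (Nat.coprime_primes (nthPrime_prime j) hp).2 fun h => Finset.ne_of_mem_erase hj ?_
    exact Fin.ext (Nat.nth_injective Nat.infinite_setOfPred_prime h)
  obtain ⟨r, hr⟩ : ∃ r, N * r ≡ 1 [MOD p ^ k] := by
    rcases Nat.lt_or_ge 1 (p ^ k) with h | h
    · obtain ⟨r, -, hr⟩ := Nat.exists_mul_mod_eq_one_of_coprime hcop h
      exact ⟨r, by rw [Nat.ModEq, hr, Nat.mod_eq_of_lt h]⟩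
    · have : p ^ k = 1 := le_antisymm h (Nat.pos_of_ne_zero (pow_pos hp.pos k).ne')
      exact ⟨0, by rw [this]; exact Nat.modEq_one⟩
  refine ⟨N * r, funext fun j => ?_⟩
  have hone : torusRoot l k i ^ (p ^ k) = 1 := circleTurn_pow_eq_one hp.pos dvd_rfl
  by_cases hj : j = i
  · subst hj
    simp only [Pi.pow_apply, Pi.mulSingle_eq_same]
    have h1 : torusRoot l k j ^ (N * r) = torusRoot l k j ^ 1 :=
      pow_eq_pow_iff_modEq.2 (hr.of_dvd (orderOf_dvd_of_pow_eq_one hone))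
    rw [h1, pow_one]
  · simp only [Pi.pow_apply, Pi.mulSingle_eq_of_ne hj]
    refine circleTurn_pow_eq_one (nthPrime_prime j).pos (Dvd.dvd.mul_right ?_ r)
    exact Finset.dvd_prod_of_mem (fun j : Fin l => Nat.nth Nat.Prime j ^ k)
      (Finset.mem_erase.2 ⟨hj, Finset.mem_univ j⟩)

theorem torusRoot_pow {l k N : ℕ} (h : k ≤ N) (i : Fin l) :
    torusRoot l N i ^ (Nat.nth Nat.Prime i ^ (N - k)) = torusRoot l k i := by
  have hp : (Nat.nth Nat.Prime i : ℝ) ≠ 0 := by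
    exact_mod_cast (nthPrime_prime i).pos.ne'
  obtain ⟨d, rfl⟩ := Nat.exists_eq_add_of_le h
  rw [torusRoot, circleTurn_pow, torusRoot, Nat.add_sub_cancel_left]
  congr 1
  push_cast
  rw [pow_add]
  field_simp

theorem torusRoot_mem_powers {l k N : ℕ} (h : k ≤ N) :
    torusRoot l k ∈ Submonoid.powers (torusRoot l N) := by
  rw [← Finset.univ_prod_mulSingle (torusRoot l k)]
  refine prod_mem fun i _ => ?_
  rw [← torusRoot_pow h, Pi.mulSingle_pow]
  exact pow_mem (mulSingle_mem_powers_torusRoot l N i) _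

theorem eq_top_of_torusRoot_mem {l : ℕ} {H : Subgroup (Fin l → Circle)}
    (hH : IsClosed (H : Set (Fin l → Circle))) (h : ∀ k, torusRoot l k ∈ H) : H = ⊤ := by
  have hsingle : ∀ i z, Pi.mulSingle i z ∈ H := by
    intro i z
    obtain ⟨x, hx, rfl⟩ := exists_circleTurn_eq z
    let p : ℕ := Nat.nth Nat.Prime i
    have hp : p.Prime := nthPrime_prime i
    have hp1 : (1 : ℝ) < p := by exact_mod_cast hp.one_lt
    have hlim : Tendsto (fun k : ℕ => (⌊x * (p : ℝ) ^ k⌋₊ : ℝ) / (p : ℝ) ^ k) atTop (𝓝 x) :=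
      (tendsto_nat_floor_mul_div_atTop hx).comp (tendsto_pow_atTop_atTop_of_one_lt hp1)
    have hlim' := ((continuous_mulSingle (A := fun _ : Fin l => Circle) i).comp
      continuous_circleTurn).continuousAt.tendsto.comp hlim
    refine hH.mem_of_tendsto hlim' (Eventually.of_forall fun k => ?_)
    have h1 : Pi.mulSingle i (torusRoot l k i) ∈ H :=
      (Submonoid.powers_le (P := H.toSubmonoid)).2 (h k) (mulSingle_mem_powers_torusRoot l k i)
    have h2 := pow_mem h1 ⌊x * (p : ℝ) ^ k⌋₊
    rw [← Pi.mulSingle_pow, torusRoot, circleTurn_pow, mul_one_div] at h2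
    exact h2
  refine (Subgroup.eq_top_iff' H).2 fun t => ?_
  rw [← Finset.univ_prod_mulSingle t]
  exact prod_mem fun i _ => hsingle i (t i)

/-- The fixed points of a torus are those of a single element of finite order. -/
theorem exists_torusRoot_fixed {M E : Type} [TopologicalSpace M] [T2Space M] [CompactSpace M]
    [NormedAddCommGroup E] [NormedSpace ℝ E] [FiniteDimensional ℝ E] {l : ℕ}
    [MulAction (Fin l → Circle) M] [ContinuousSMul (Fin l → Circle) M]
    (hdiff : ∀ (a : Fin l → Circle) (q : M), a • q = q → ∃ ψ : OpenPartialHomeomorph M E,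
      q ∈ ψ.source ∧ ContDiffAt ℝ 1 (ψ ∘ (fun x => a • x) ∘ ψ.symm) (ψ q)) :
    ∃ K, ∀ x : M, x ∈ MulAction.fixedPoints (Fin l → Circle) M ↔ torusRoot l K • x = x := by
  let A : ℕ → Set M := fun k => {x | torusRoot l k • x = x}
  have hit : ∀ (a : Fin l → Circle) (j : ℕ) (x : M), (fun x => a • x)^[j] x = a ^ j • x :=
    fun a j x => by rw [smul_iterate]
  have hA : Antitone A := by
    intro k N hkN x hx
    obtain ⟨j, hj⟩ := torusRoot_mem_powers (l := l) hkN
    change torusRoot l k • x = x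
    rw [← hj]
    exact (MulAction.stabilizer (Fin l → Circle) x).pow_mem hx j
  have hcl : ∀ k, IsClosed (A k) := fun k =>
    isClosed_eq (continuous_const_smul _) continuous_id
  obtain ⟨K, hK⟩ := exists_subset_iInter_of_locally_linear (E := E) hA hcl fun N q hq => by
    obtain ⟨ψ, hqψ, hψ⟩ := hdiff (torusRoot l N) q hq
    obtain ⟨Φ, hqΦ, hΦ⟩ := exists_linearization (continuous_const_smul (torusRoot l N))
      (m := ∏ i : Fin l, Nat.nth Nat.Prime i ^ N)
      (Finset.prod_pos fun i _ => pow_pos (nthPrime_prime i).pos N)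
      (fun x => by rw [hit, torusRoot_pow_eq_one, one_smul]) hq ψ hqψ hψ
    refine ⟨Φ, hqΦ, fun k hk => ?_⟩
    obtain ⟨j, hj⟩ := torusRoot_mem_powers (l := l) hk
    obtain ⟨W, hW⟩ := hΦ j
    refine ⟨W, fun x hx => ?_⟩
    rw [← hW x hx, hit]
    change torusRoot l k • x = x ↔ _
    rw [← hj]
  refine ⟨K, fun x => ⟨fun hx => hx _, fun hx => ?_⟩⟩
  have hstab : MulAction.stabilizer (Fin l → Circle) x = ⊤ :=
    eq_top_of_torusRoot_mem (isClosed_eq (f := fun t : Fin l → Circle => t • x)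
      (continuous_id.smul continuous_const) continuous_const) fun k => mem_iInter.1 (hK hx) k
  intro t
  have ht : t ∈ MulAction.stabilizer (Fin l → Circle) x := hstab ▸ Subgroup.mem_top t
  exact ht

end Torus

section Manifold

open Filter Topology Set

variable {n : ℕ} {M : Type} [TopologicalSpace M] [ChartedSpace (EuclideanSpace ℝ (Fin n)) M]

theorem ContMDiff.contDiffAt_comp_chartAt_symm {F : Type} [NormedAddCommGroup F] [NormedSpace ℝ F]
    {f : M → F} (hf : ContMDiff (𝓡 n) 𝓘(ℝ, F) (⊤ : ℕ∞) f) (p : M) :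
    ContDiffAt ℝ (⊤ : ℕ∞) (f ∘ (chartAt (EuclideanSpace ℝ (Fin n)) p).symm)
      (chartAt (EuclideanSpace ℝ (Fin n)) p p) := by
  have h := ((contMDiffAt_iff (f := f) (x := p)).1 (hf p)).2
  simpa [Function.comp_def, extChartAt, contDiffWithinAt_univ,
    chartAt_self_eq] using h

theorem ContMDiff.contDiffAt_chartAt_comp {f : M → M}
    (hf : ContMDiff (𝓡 n) (𝓡 n) (⊤ : ℕ∞) f) {q : M} (hq : f q = q) :
    ContDiffAt ℝ (⊤ : ℕ∞) (chartAt (EuclideanSpace ℝ (Fin n)) q ∘ f ∘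
      (chartAt (EuclideanSpace ℝ (Fin n)) q).symm) (chartAt (EuclideanSpace ℝ (Fin n)) q q) := by
  have h := ((contMDiffAt_iff (f := f) (x := q)).1 (hf q)).2
  simpa [Function.comp_def, extChartAt, contDiffWithinAt_univ, hq] using h

theorem ContMDiff.injective_fderiv_comp_chartAt_symm {F : Type} [NormedAddCommGroup F]
    [NormedSpace ℝ F] {f : M → F} (hf : ContMDiff (𝓡 n) 𝓘(ℝ, F) (⊤ : ℕ∞) f) {p : M}
    (hinj : Function.Injective (mfderiv (𝓡 n) 𝓘(ℝ, F) f p)) :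
    Function.Injective (fderiv ℝ (f ∘ (chartAt (EuclideanSpace ℝ (Fin n)) p).symm)
      (chartAt (EuclideanSpace ℝ (Fin n)) p p)) := by
  rw [((hf p).mdifferentiableAt (by simp)).mfderiv] at hinj
  simp only [writtenInExtChartAt, extChartAt, Function.comp_def, chartAt_self_eq, mfld_simps,
    fderivWithin_univ] at hinj
  exact hinj

/-- A compact manifold with a smooth action of a finite group embeds into a Euclidean space on
which a given group element acts by an isometry. -/
theorem exists_equivariant_embedding [T2Space M] [CompactSpace M]
    [IsManifold (𝓡 n) (⊤ : ℕ∞) M] {G : Type} [Group G] [Finite G] [MulAction G M]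
    (hG : ∀ b : G, ContMDiff (𝓡 n) (𝓡 n) (⊤ : ℕ∞) (fun x : M => b • x)) (a : G) :
    ∃ (V : Type) (_ : NormedAddCommGroup V) (_ : InnerProductSpace ℝ V)
      (_ : FiniteDimensional ℝ V) (e : M → V) (L : V ≃ₗᵢ[ℝ] V), IsEmbedding e ∧
      (∀ y, L (e y) = e (a • y)) ∧
      ∀ p, ∃ ψ : OpenPartialHomeomorph M (EuclideanSpace ℝ (Fin n)), p ∈ ψ.source ∧
        ContDiffAt ℝ 2 (e ∘ ψ.symm) (ψ p) ∧
        Function.Injective (fderiv ℝ (e ∘ ψ.symm) (ψ p)) := by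
  have := Fintype.ofFinite G
  obtain ⟨N, e, hsm, hemb, hinj⟩ := exists_embedding_euclidean_of_compact (I := 𝓡 n) (M := M)
  have hsmooth : ∀ b : G, ContMDiff (𝓡 n) 𝓘(ℝ, EuclideanSpace ℝ (Fin N)) (⊤ : ℕ∞)
      (fun x : M => e (b • x)) := fun b => hsm.comp (hG b)
  let e' : M → PiLp 2 (fun _ : G => EuclideanSpace ℝ (Fin N)) :=
    fun y => WithLp.toLp 2 (fun b : G => e (b • y))
  have he'c : Continuous e' :=
    (PiLp.continuous_toLp 2 _).comp (continuous_pi fun b => (hsmooth b).continuous)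
  have he'1 : ∀ y, e' y 1 = e y := fun y => by simp [e']
  refine ⟨PiLp 2 (fun _ : G => EuclideanSpace ℝ (Fin N)), inferInstance, inferInstance,
    inferInstance, e', LinearIsometryEquiv.piLpCongrLeft 2 ℝ _ (Equiv.mulRight a).symm,
    (he'c.isClosedEmbedding fun x y hxy => hemb.injective ?_).isEmbedding, fun y => ?_, fun p =>
    ⟨chartAt _ p, mem_chart_source _ p, ?_⟩⟩
  · rw [← he'1, ← he'1, hxy]
  · ext b
    simp [e', LinearIsometryEquiv.piLpCongrLeft_apply, mul_smul]
  · have hd : ContDiffAt ℝ 2 (e' ∘ (chartAt (EuclideanSpace ℝ (Fin n)) p).symm)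
        (chartAt (EuclideanSpace ℝ (Fin n)) p p) :=
      contDiffAt_piLp' 2 fun b =>
        ((hsmooth b).contDiffAt_comp_chartAt_symm p).of_le
          (WithTop.coe_le_coe.2 (le_top (a := (2 : ℕ∞))))
    refine ⟨hd, fun u v huv => hsm.injective_fderiv_comp_chartAt_symm (hinj p) ?_⟩
    have hproj : HasFDerivAt (e ∘ (chartAt (EuclideanSpace ℝ (Fin n)) p).symm)
        ((PiLp.proj 2 (fun _ : G => EuclideanSpace ℝ (Fin N)) (1 : G) : _ →L[ℝ] _).comp
          (fderiv ℝ (e' ∘ (chartAt (EuclideanSpace ℝ (Fin n)) p).symm)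
            (chartAt (EuclideanSpace ℝ (Fin n)) p p)))
        (chartAt (EuclideanSpace ℝ (Fin n)) p p) := by
      have h := (hasFDerivWithinAt_piLp 2).1
        ((hd.differentiableAt (by simp)).hasFDerivAt.hasFDerivWithinAt (s := univ)) (1 : G)
      rw [hasFDerivWithinAt_univ] at h
      simpa only [Function.comp_def, he'1] using h
    rw [hproj.fderiv]
    exact congrArg (fun w : PiLp 2 (fun _ : G => EuclideanSpace ℝ (Fin N)) => w 1) huv

theorem eulerChar_eq_finsum_fixedPoints [T2Space M] [CompactSpace M]
    [IsManifold (𝓡 n) (⊤ : ℕ∞) M] {l : ℕ} [MulAction (Fin l → Circle) M]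
    [ContinuousSMul (Fin l → Circle) M]
    (hsm : ∀ a : Fin l → Circle, ContMDiff (𝓡 n) (𝓡 n) (⊤ : ℕ∞) (fun x : M => a • x))
    (hne : (MulAction.fixedPoints (Fin l → Circle) M).Nonempty) :
    eulerChar M =
      ∑ᶠ C ∈ {C : Set M | ∃ p ∈ MulAction.fixedPoints (Fin l → Circle) M,
          C = connectedComponentIn (MulAction.fixedPoints (Fin l → Circle) M) p},
        eulerChar ↥C := by
  obtain ⟨K, hK⟩ := exists_torusRoot_fixed (M := M) (E := EuclideanSpace ℝ (Fin n)) (l := l)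
    fun a q hq => ⟨chartAt _ q, mem_chart_source _ q,
      ((hsm a).contDiffAt_chartAt_comp hq).of_le (by exact_mod_cast le_top)⟩
  have hpos : 0 < ∏ i : Fin l, Nat.nth Nat.Prime i ^ K :=
    Finset.prod_pos fun i _ => pow_pos (nthPrime_prime i).pos K
  have : Finite (Subgroup.zpowers (torusRoot l K)) :=
    isOfFinOrder_iff_pow_eq_one.2 ⟨_, hpos, torusRoot_pow_eq_one l K⟩ |>.finite_zpowers
  obtain ⟨V, _, _, _, e, L, he, hL, hloc⟩ := exists_equivariant_embedding (M := M)
    (fun b : Subgroup.zpowers (torusRoot l K) => hsm b)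
    ⟨torusRoot l K, Subgroup.mem_zpowers _⟩
  obtain ⟨δ, hδ, hun⟩ := exists_uniqueNearest he hloc
  refine eulerChar_eq_finsum_fixed he hδ hun L (f := fun y => torusRoot l K • y) hL
    (fun t y => (fun i : Fin l => circleTurn (t / (Nat.nth Nat.Prime i : ℝ) ^ K)) • y)
    ?_ (fun y => ?_) (fun y => rfl) _ hK hne
  · have : Continuous fun t : ℝ =>
        (fun i : Fin l => circleTurn (t / (Nat.nth Nat.Prime i : ℝ) ^ K)) :=
      continuous_pi fun i => continuous_circleTurn.comp (continuous_id.div_const _)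
    exact (this.comp continuous_fst).smul continuous_snd
  · have : (fun i : Fin l => circleTurn (0 / (Nat.nth Nat.Prime i : ℝ) ^ K)) = 1 := by
      ext1 i
      simp [circleTurn]
    simp only [this, one_smul]

end Manifold

/-- **Additivity of the Euler characteristic over fixed point components.**
Let a torus act by isometries on a compact orientable even-dimensional Riemannian
manifold `M` with nonempty fixed point set.  Then the Euler characteristic of `M` is
the sum of the Euler characteristics of the connected components of the fixed point
set. -/
theorem eulerChar_eq_sum_fixed_components
    (n : ℕ) (hn : Even n)
    (M : Type) [TopologicalSpace M] [T2Space M] [CompactSpace M]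
    [ChartedSpace (EuclideanSpace ℝ (Fin n)) M] [IsManifold (𝓡 n) (⊤ : ℕ∞) M]
    (g : RiemannianMetric n M) (hor : IsOrientable n M)
    (l : ℕ) [MulAction (Fin l → Circle) M] [ContinuousSMul (Fin l → Circle) M]
    (hiso : ∀ a : Fin l → Circle, IsRiemannianIsometry g (fun x : M => a • x))
    (hne : (MulAction.fixedPoints (Fin l → Circle) M).Nonempty) :
    eulerChar M =
      ∑ᶠ C ∈ {C : Set M | ∃ p ∈ MulAction.fixedPoints (Fin l → Circle) M,
          C = connectedComponentIn (MulAction.fixedPoints (Fin l → Circle) M) p},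
        eulerChar ↥C := by
  exact eulerChar_eq_finsum_fixedPoints (fun a => (hiso a).2.1) hne
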